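/- arXiv:1610.01943 — 2 statements merged into one kernel-verified Lean document; each statement's English description precedes it below -/
import Mathlib

section
/- Assume the Generalized Riemann Hypothesis for Dirichlet L-functions. Then, as x → ∞, max over fundamental discriminants d ≤ x of 𝓛_{χ_d} is asymptotic to log log log x; that is, max_{d ≤ x} 𝓛_{χ_d} = log log log x + O(1). -/
open Filter

/-- The Dirichlet L-function of `χ` (extended by `0` for modulus `0`). -/
noncomputable def LFun (d : ℕ) (χ : DirichletCharacter ℂ d) (s : ℂ) : ℂ :=
  if h : d ≠ 0 then
    letI : NeZero d := ⟨h⟩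
    DirichletCharacter.LFunction χ s
  else 0

/-- `𝓛_χ = Σ_p χ(p)/p` has value `L`: the partial sums over primes `p < y`
converge to `L` as `y → ∞`. -/
def HasCurlyL {d : ℕ} (χ : DirichletCharacter ℂ d) (L : ℝ) : Prop :=
  Filter.Tendsto
    (fun y : ℕ => ∑ p ∈ (Finset.range y).filter Nat.Prime, (χ p).re / (p : ℝ))
    Filter.atTop (nhds L)

/-- Number of ordered pairs `(p, q)` of primes with `p * q ≤ x` satisfying `P p q`. -/
noncomputable def pairCount (x : ℝ) (P : ℕ → ℕ → Prop) : ℕ :=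
  Nat.card {pq : ℕ × ℕ // pq.1.Prime ∧ pq.2.Prime ∧ ((pq.1 * pq.2 : ℕ) : ℝ) ≤ x ∧ P pq.1 pq.2}

/-- The race ratio `#{pq ≤ x : χ(p) = χ(q) = η} / ((1/4) #{pq ≤ x : gcd(pq, d) = 1})`,
where products of two primes are counted as ordered pairs. -/
noncomputable def raceRatio {d : ℕ} (χ : DirichletCharacter ℂ d) (η : ℂ) (x : ℝ) : ℝ :=
  (pairCount x (fun p q => χ p = η ∧ χ q = η) : ℝ) /
    ((1 / 4 : ℝ) * (pairCount x (fun p q => Nat.gcd (p * q) d = 1) : ℝ))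

/-- A positive integer is a fundamental discriminant if it is `≡ 1 (mod 4)` and squarefree,
or is `4m` with `m ≡ 2, 3 (mod 4)` squarefree. -/
def IsFundamentalDiscriminant (d : ℕ) : Prop :=
  0 < d ∧ ((d % 4 = 1 ∧ Squarefree d) ∨
    (d % 4 = 0 ∧ Squarefree (d / 4) ∧ (d / 4 % 4 = 2 ∨ d / 4 % 4 = 3)))

/-- The Generalized Riemann Hypothesis for Dirichlet L-functions: all zeros in the
critical strip lie on the critical line. -/
def GRH : Prop :=
  ∀ (d : ℕ), d ≠ 0 → ∀ (χ : DirichletCharacter ℂ d) (s : ℂ),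
    LFun d χ s = 0 → 0 < s.re → s.re < 1 → s.re = 1 / 2

/-- `L(s, χ)` has no real zero `β` with `1 - c / log d ≤ β ≤ 1` (a Siegel zero). -/
def HasNoSiegelZero (c : ℝ) (d : ℕ) (χ : DirichletCharacter ℂ d) : Prop :=
  ¬ ∃ β : ℝ, 1 - c / Real.log d ≤ β ∧ β ≤ 1 ∧ LFun d χ (β : ℂ) = 0

/-- The logarithmic integral `Li(t) = ∫_2^t du / log u`. -/
noncomputable def Li (t : ℝ) : ℝ := ∫ u in (2:ℝ)..t, 1 / Real.log u

section PartNoa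

open Filter
open Complex in
lemma char_sum_range_level {q : ℕ} [NeZero q] (χ : DirichletCharacter ℂ q) (hχ : χ ≠ 1) :
    ∑ k ∈ Finset.range q, χ (k : ZMod q) = 0 := by
  have h := MulChar.sum_eq_zero_of_ne_one hχ
  rw [← h]
  symm
  refine Finset.sum_bij' (fun a _ => ZMod.val a) (fun k _ => (k : ZMod q)) ?_ ?_ ?_ ?_ ?_
  · intro a _; simpa using ZMod.val_lt a
  · intro a _; simp
  · intro a _; simp
  · intro a ha; exact ZMod.val_natCast_of_lt (by simpa using ha)
  · intro a _; simp

lemma char_sum_range_bound {q : ℕ} [NeZero q] (χ : DirichletCharacter ℂ q) (hχ : χ ≠ 1) (n : ℕ) :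
    ‖∑ k ∈ Finset.range n, χ (k : ZMod q)‖ ≤ q := by
  induction n using Nat.strong_induction_on with
  | _ n ih =>
    rcases lt_or_ge n q with h | h
    · calc ‖∑ k ∈ Finset.range n, χ (k : ZMod q)‖ ≤ ∑ k ∈ Finset.range n, ‖χ (k : ZMod q)‖ :=
            norm_sum_le _ _
        _ ≤ ∑ k ∈ Finset.range n, 1 := Finset.sum_le_sum fun _ _ => χ.norm_le_one _
        _ = n := by simp
        _ ≤ q := by exact_mod_cast h.le
    · obtain ⟨m, rfl⟩ := Nat.exists_eq_add_of_le h
      rw [Finset.sum_range_add, char_sum_range_level χ hχ, zero_add]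
      have : 0 < q := Nat.pos_of_ne_zero (NeZero.ne q)
      simpa using ih m (by omega)

lemma char_sum_Icc_bound {q : ℕ} [NeZero q] (χ : DirichletCharacter ℂ q) (hχ : χ ≠ 1) (n : ℕ) :
    ‖∑ k ∈ Finset.Icc 1 n, χ (k : ZMod q)‖ ≤ q := by
  have hq : q ≠ 1 := by
    rintro rfl
    exact hχ (Subsingleton.elim _ _)
  have h0 : χ ((0 : ℕ) : ZMod q) = 0 := by
    have : Nontrivial (ZMod q) := by
      have : Fact (1 < q) := ⟨by have := NeZero.ne q; omega⟩
      infer_instance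
    simpa using χ.map_zero
  have : ∑ k ∈ Finset.Icc 1 n, χ (k : ZMod q) = ∑ k ∈ Finset.range (n+1), χ (k : ZMod q) := by
    rw [Finset.sum_range_succ', h0, add_zero, Finset.range_eq_Ico, Finset.sum_Ico_add' (fun k : ℕ => χ (k : ZMod q)) 0 n 1]
    rfl
  rw [this]; exact char_sum_range_bound χ hχ _

open MeasureTheory Set in
/-- Growth bound for `L(s, χ)`. -/
lemma LFunction_bound {q : ℕ} [NeZero q] (χ : DirichletCharacter ℂ q) (hχ : χ ≠ 1) (s : ℂ)
    (hs : 0 < s.re) : ‖DirichletCharacter.LFunction χ s‖ ≤ ‖s‖ * (q / s.re) := by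
  set S : ℝ → ℂ := fun t => (Set.Ioi (1:ℝ)).indicator
    (fun t => ∑ k ∈ Finset.Icc 1 ⌊t⌋₊, χ (k : ZMod q)) t with hS
  have hSb : ∀ t, ‖S t‖ ≤ q := by
    intro t
    simp only [hS, Set.indicator]
    split_ifs
    · exact char_sum_Icc_bound χ hχ _
    · simp
  have hSm : Measurable S := by
    refine Measurable.indicator ?_ measurableSet_Ioi
    exact (measurable_from_nat (f := fun n : ℕ => ∑ k ∈ Finset.Icc 1 n, χ (k : ZMod q))).comp Nat.measurable_floor
  have hloc : LocallyIntegrableOn S (Ioi 0) := by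
    refine LocallyIntegrable.locallyIntegrableOn ?_ _
    refine (locallyIntegrable_const (q : ℝ)).mono hSm.aestronglyMeasurable ?_
    filter_upwards with t
    simpa using hSb t
  have htop : S =O[atTop] (fun x : ℝ => x ^ (-(0:ℝ))) := by
    simp only [neg_zero, Real.rpow_zero]
    exact Asymptotics.IsBigO.of_bound q (by filter_upwards with t; simpa using hSb t)
  have hbot : ∀ b : ℝ, S =O[nhdsWithin 0 (Ioi 0)] (fun x : ℝ => x ^ (-b)) := by
    intro b
    refine Asymptotics.IsBigO.of_bound 0 ?_
    have : Set.Iio (1:ℝ) ∈ nhdsWithin (0:ℝ) (Ioi 0) := mem_nhdsWithin_of_mem_nhds (Iio_mem_nhds one_pos)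
    filter_upwards [this] with t ht
    have : t ∉ Ioi (1:ℝ) := by simpa using (show t < 1 from ht).le
    simp [hS, Set.indicator_of_notMem this]
  have hdiff : ∀ s : ℂ, 0 < s.re → DifferentiableAt ℂ (fun s => s * mellin S (-s)) s := by
    intro s hs
    have h1 : DifferentiableAt ℂ (mellin S) (-s) :=
      mellin_differentiableAt_of_isBigO_rpow hloc htop (by simpa using hs) (hbot (-s.re - 1)) (by simp)
    exact differentiableAt_id.mul (h1.comp s differentiableAt_id.neg)
  have hmel : ∀ s : ℂ, mellin S (-s) = ∫ t in Set.Ioi (1 : ℝ), (∑ k ∈ Finset.Icc 1 ⌊t⌋₊, χ (k : ZMod q)) * (t:ℂ) ^ (-(s + 1)) := by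
    intro s
    rw [mellin]
    have : ∀ t : ℝ, (t:ℂ) ^ (-s - 1) • S t = (Set.Ioi (1:ℝ)).indicator
       (fun t : ℝ => (∑ k ∈ Finset.Icc 1 ⌊t⌋₊, χ (k : ZMod q)) * (t:ℂ) ^ (-(s + 1))) t := by
      intro t
      simp only [hS, Set.indicator]
      split_ifs
      · rw [smul_eq_mul, mul_comm]; congr 2; ring
      · simp
    simp_rw [this]
    rw [setIntegral_indicator measurableSet_Ioi]
    congr 2
    ext t; simp
  have heq : ∀ s : ℂ, 1 < s.re → DirichletCharacter.LFunction χ s = s * mellin S (-s) := by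
    intro s hs
    rw [DirichletCharacter.LFunction_eq_LSeries χ hs, hmel,
      LSeries_eq_mul_integral (fun n => χ n) (r := 0) le_rfl (by linarith) (DirichletCharacter.LSeriesSummable_of_one_lt_re χ hs)]
    simp only [Real.rpow_zero]
    exact Asymptotics.IsBigO.of_bound q (by filter_upwards with t; simpa using char_sum_Icc_bound χ hχ t)
  have hcont : DirichletCharacter.LFunction χ s = s * mellin S (-s) := by
    have hU : IsOpen {s : ℂ | 0 < s.re} := isOpen_lt continuous_const Complex.continuous_re
    have hf : AnalyticOnNhd ℂ (DirichletCharacter.LFunction χ) {s : ℂ | 0 < s.re} :=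
      (DirichletCharacter.differentiable_LFunction hχ).differentiableOn.analyticOnNhd hU
    have hg : AnalyticOnNhd ℂ (fun s => s * mellin S (-s)) {s : ℂ | 0 < s.re} :=
      DifferentiableOn.analyticOnNhd (fun s hs => (hdiff s hs).differentiableWithinAt) hU
    refine hf.eqOn_of_preconnected_of_eventuallyEq hg (convex_halfSpace_re_gt 0).isPreconnected (z₀ := 2) (by simp) ?_ hs
    have : {s : ℂ | 1 < s.re} ∈ nhds (2:ℂ) := (isOpen_lt continuous_const Complex.continuous_re).mem_nhds (by simp)
    filter_upwards [this] with z hz using heq z hz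
  rw [hcont, norm_mul]
  gcongr
  rw [hmel]
  have hIntg : IntegrableOn (fun t : ℝ => (q:ℝ) * t ^ (-s.re - 1)) (Ioi 1) :=
    (integrableOn_Ioi_rpow_of_lt (by linarith) one_pos).const_mul _
  refine (norm_integral_le_of_norm_le hIntg ?_).trans ?_
  · filter_upwards [self_mem_ae_restrict measurableSet_Ioi] with t ht
    have ht0 : 0 < t := lt_trans one_pos ht
    rw [norm_mul, Complex.norm_cpow_eq_rpow_re_of_pos ht0]
    have : (-(s+1)).re = -s.re - 1 := by simp; ring
    rw [this]
    gcongr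
    exact char_sum_Icc_bound χ hχ _
  · rw [integral_const_mul, integral_Ioi_rpow_of_lt (by linarith) one_pos]
    simp [div_eq_mul_inv]

end PartNoa

section PartNob

open Filter

lemma GRH_ne_zero (hGRH : GRH) {q : ℕ} [NeZero q] (χ : DirichletCharacter ℂ q) (hχ : χ ≠ 1) (s : ℂ)
    (hs : 1/2 < s.re) : DirichletCharacter.LFunction χ s ≠ 0 := by
  intro h
  rcases le_or_gt 1 s.re with h1 | h1
  · exact DirichletCharacter.LFunction_ne_zero_of_one_le_re χ (.inl hχ) h1 h
  · have := hGRH q (NeZero.ne q) χ s (by simp only [LFun]; rw [dif_pos (NeZero.ne q)]; exact h) (by linarith) h1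
    linarith

lemma logDeriv_bound {f : ℂ → ℂ} {c : ℂ} {B m : ℝ} (hm : 0 < m) (hBm : m < B)
    (hf : DifferentiableOn ℂ f (Metric.ball c (3/2))) (h0 : ∀ z ∈ Metric.ball c (3/2), f z ≠ 0)
    (hB : ∀ z ∈ Metric.ball c (3/2), ‖f z‖ ≤ B) (hc : m ≤ ‖f c‖) {z : ℂ} (hz : dist z c ≤ 5/4) :
    ‖deriv f z / f z‖ ≤ 176 * Real.log (B / m) := by
  have hcb : c ∈ Metric.ball c (3/2) := Metric.mem_ball_self (by norm_num)
  have hzb : z ∈ Metric.ball c (3/2) := Metric.mem_ball.2 (by linarith)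
  have hM : 0 < Real.log (B / m) := Real.log_pos ((one_lt_div hm).2 hBm)
  have hdf : DifferentiableOn ℂ (fun z => deriv f z / f z) (Metric.ball c (3/2)) :=
    (hf.deriv Metric.isOpen_ball).div hf h0
  obtain ⟨g, hgc, hg⟩ := (hdf.isExactOn_ball).with_val_at c 0
  have hgd : DifferentiableOn ℂ g (Metric.ball c (3/2)) := fun w hw => (hg w hw).differentiableAt.differentiableWithinAt
  have hexp : ∀ w ∈ Metric.ball c (3/2), f w = f c * Complex.exp (g w) := by
    intro w hw
    have key : ∀ w ∈ Metric.ball c (3/2), HasDerivAt (fun w => f w * Complex.exp (- g w)) 0 w := by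
      intro w hw
      have h1 : HasDerivAt f (deriv f w) w := (hf.differentiableAt (Metric.isOpen_ball.mem_nhds hw)).hasDerivAt
      have h2 := h1.mul ((hg w hw).neg.cexp)
      have h4 : deriv f w * Complex.exp ((-g) w) + f w * (Complex.exp ((-g) w) * -(deriv f w / f w)) = 0 := by
        have := h0 w hw
        field_simp
        ring
      rw [h4] at h2
      exact h2
    have h3 : (fun w => f w * Complex.exp (- g w)) w = (fun w => f w * Complex.exp (- g w)) c := by
      refine (convex_ball c (3/2)).is_const_of_fderivWithin_eq_zero (𝕜 := ℂ)
        (fun w hw => (key w hw).differentiableAt.differentiableWithinAt) ?_ hw hcb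
      intro w hw
      rw [fderivWithin_of_isOpen Metric.isOpen_ball hw]
      have := (key w hw).hasFDerivAt.fderiv
      rw [this]; ext; simp
    simp only [hgc, neg_zero, Complex.exp_zero, mul_one] at h3
    rw [← h3, mul_assoc, ← Complex.exp_add]; simp
  have hre : ∀ w ∈ Metric.ball c (3/2), (g w).re ≤ Real.log (B / m) := by
    intro w hw
    have h1 : ‖f w‖ = ‖f c‖ * Real.exp (g w).re := by rw [hexp w hw, norm_mul, Complex.norm_exp]
    rw [Real.le_log_iff_exp_le (div_pos (hm.trans hBm) hm), le_div_iff₀ hm]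
    calc Real.exp (g w).re * m ≤ Real.exp (g w).re * ‖f c‖ := by gcongr
      _ = ‖f w‖ := by rw [h1]; ring
      _ ≤ B := hB w hw
  have hbc : ∀ w, dist w c ≤ 11/8 → ‖g w‖ ≤ 22 * Real.log (B / m) := by
    intro w hw
    have hd : DifferentiableOn ℂ (fun u => g (c + u)) (Metric.ball 0 (3/2)) := by
      refine hgd.comp (by fun_prop) ?_
      intro u hu; simpa using hu
    have := Complex.borelCaratheodory_zero (f := fun u => g (c + u)) (R := 3/2) (z := w - c) hM hd
      (fun u hu => hre _ (by simpa using hu)) (by norm_num) (by simp [← dist_eq_norm]; linarith) (by simpa using hgc)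
    simp only [add_sub_cancel] at this
    refine this.trans ?_
    rw [← dist_eq_norm]
    rw [div_le_iff₀ (by linarith)]
    nlinarith
  have hder : deriv g z = deriv f z / f z := (hg z hzb).deriv
  rw [← hder]
  have := Complex.norm_deriv_le_of_forall_mem_sphere_norm_le (f := g) (c := z) (R := 1/8) (C := 22 * Real.log (B / m)) (by norm_num) ?_ ?_
  · refine this.trans (le_of_eq ?_); ring
  · refine (hgd.mono ?_).diffContOnCl
    refine Metric.closure_ball_subset_closedBall.trans ?_
    intro w hw
    rw [Metric.mem_closedBall] at hw
    rw [Metric.mem_ball]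
    linarith [dist_triangle w z c]
  · intro w hw
    rw [mem_sphere_iff_norm, ← dist_eq_norm] at hw
    exact hbc w (by linarith [dist_triangle w z c])

lemma LFunction_two_lower {q : ℕ} [NeZero q] (χ : DirichletCharacter ℂ q) (s : ℂ)
    (hs : s.re = 2) : 1/4 ≤ ‖DirichletCharacter.LFunction χ s‖ := by
  have hs1 : 1 < s.re := by rw [hs]; norm_num
  rw [DirichletCharacter.LFunction_eq_LSeries χ hs1]
  have hsum := DirichletCharacter.LSeriesSummable_of_one_lt_re χ hs1
  have hz := hasSum_zeta_two
  have hle : ∀ n : ℕ, ‖LSeries.term (fun n => χ n) s n‖ ≤ 1 / (n:ℝ)^2 := by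
    intro n
    rw [LSeries.norm_term_eq]
    split_ifs with h
    · simp [h]
    · rw [hs, Real.rpow_two]; gcongr; exact χ.norm_le_one _
  have h1 : LSeries (fun n => χ n) s = 1 + ∑' n : ℕ, LSeries.term (fun n => χ n) s (n + 2) := by
    rw [LSeries, ← hsum.sum_add_tsum_nat_add 2]
    simp [Finset.sum_range_succ, LSeries.term]
  have hz2 : HasSum (fun n : ℕ => 1 / ((n + 2 : ℕ):ℝ)^2) (Real.pi^2/6 - 1) := by
    have := (hasSum_nat_add_iff' (f := fun n : ℕ => 1 / (n:ℝ)^2) 2).2 hz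
    simpa [Finset.sum_range_succ] using this
  have h2 : ‖∑' n : ℕ, LSeries.term (fun n => χ n) s (n + 2)‖ ≤ Real.pi^2/6 - 1 :=
    tsum_of_norm_bounded hz2 (fun n => hle (n+2))
  rw [h1]
  have h3 := norm_sub_le_norm_add (1:ℂ) (∑' n : ℕ, LSeries.term (fun n => χ n) s (n + 2))
  rw [norm_one] at h3
  have := Real.pi_lt_d2
  have := Real.pi_pos
  nlinarith

lemma LFunction_logDeriv_bound (hGRH : GRH) {q : ℕ} [NeZero q] (χ : DirichletCharacter ℂ q) (hχ : χ ≠ 1) (s : ℂ)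
    (hs : 3/4 ≤ s.re) (hs2 : s.re ≤ 2) :
    ‖deriv (DirichletCharacter.LFunction χ) s / DirichletCharacter.LFunction χ s‖ ≤ 176 * Real.log (40 * q * (1 + |s.im|)) := by
  set c : ℂ := ⟨2, s.im⟩ with hc
  have hq : (1:ℝ) ≤ q := by exact_mod_cast Nat.one_le_iff_ne_zero.2 (NeZero.ne q)
  have habs : 0 ≤ |s.im| := abs_nonneg _
  have hre : ∀ z ∈ Metric.ball c (3/2), 1/2 < z.re := by
    intro z hz
    rw [Metric.mem_ball, dist_eq_norm] at hz
    have := (abs_le.1 (Complex.abs_re_le_norm (z - c))).1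
    simp [hc] at this hz
    linarith
  have key := logDeriv_bound (f := DirichletCharacter.LFunction χ) (c := c) (B := 10 * q * (1 + |s.im|)) (m := 1/4) (by norm_num) (by nlinarith)
    (DirichletCharacter.differentiable_LFunction hχ).differentiableOn
    (fun z hz => GRH_ne_zero hGRH χ hχ z (hre z hz)) ?_ (LFunction_two_lower χ c (by simp [hc])) (z := s) ?_
  · refine key.trans (le_of_eq ?_); congr 2; ring
  · intro z hz
    have h1 := hre z hz
    refine (LFunction_bound χ hχ z (by linarith)).trans ?_
    have hzn : ‖z‖ ≤ 5 * (1 + |s.im|) := by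
      have h2 : ‖z‖ ≤ ‖z - c‖ + ‖c‖ := by simpa using norm_add_le (z - c) c
      have h3 := Complex.norm_le_abs_re_add_abs_im c
      rw [Metric.mem_ball, dist_eq_norm] at hz
      simp [hc] at h3 h2 hz
      linarith
    have h4 : (q:ℝ) / z.re ≤ 2 * q := by
      rw [div_le_iff₀ (by linarith)]; nlinarith
    calc ‖z‖ * (q / z.re) ≤ (5 * (1 + |s.im|)) * (2 * q) := by gcongr
      _ = _ := by ring
  · rw [dist_eq_norm]
    have : s - c = ((s.re - 2 : ℝ) : ℂ) := by apply Complex.ext <;> simp [hc]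
    rw [this, Complex.norm_real, Real.norm_eq_abs, abs_le]
    constructor <;> linarith

end PartNob

section PartNoc

open Filter
open ArithmeticFunction in
lemma vM_summable {δ : ℝ} (hδ : 0 < δ) : Summable (fun n : ℕ => vonMangoldt n * (n:ℝ)^(-(1+δ))) := by
  have h := (LSeriesSummable_vonMangoldt (s := ((1 + δ : ℝ) : ℂ)) (by simpa using hδ)).norm
  refine h.congr ?_
  intro n
  rw [LSeries.norm_term_eq]
  split_ifs with h
  · simp [h]
  · rw [Real.rpow_neg (by positivity), div_eq_mul_inv]
    simp [vonMangoldt_nonneg]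

open ArithmeticFunction MeasureTheory in
lemma vM_sum_le {δ : ℝ} (hδ : 0 < δ) (hδ1 : δ ≤ 1) :
    ∑' n : ℕ, vonMangoldt n * (n:ℝ)^(-(1+δ)) ≤ 12 / δ := by
  have hpsi : ∀ t : ℝ, 0 ≤ t → ∑ k ∈ Finset.Icc 1 ⌊t⌋₊, vonMangoldt k ≤ (Real.log 4 + 4) * t := by
    intro t ht
    have := Chebyshev.psi_le_const_mul_self ht
    exact this
  have hs : (1:ℝ) < ((1 + δ : ℝ) : ℂ).re := by simpa using hδ
  have key := LSeries_eq_mul_integral_of_nonneg (fun n => vonMangoldt n) (r := 1) zero_le_one hs ?_ (fun n => vonMangoldt_nonneg)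
  · have h1 : LSeries (fun n => (vonMangoldt n : ℂ)) ((1 + δ : ℝ) : ℂ) = ((∑' n : ℕ, vonMangoldt n * (n:ℝ)^(-(1+δ)) : ℝ) : ℂ) := by
      rw [LSeries, Complex.ofReal_tsum]
      refine tsum_congr fun n => ?_
      rw [LSeries.term]
      split_ifs with h
      · simp [h]
      · rw [Real.rpow_neg (by positivity), div_eq_mul_inv]
        push_cast
        rw [Complex.ofReal_cpow (by positivity)]
        simp
    have h0 : 0 ≤ ∑' n : ℕ, vonMangoldt n * (n:ℝ)^(-(1+δ)) :=
      tsum_nonneg fun n => mul_nonneg vonMangoldt_nonneg (by positivity)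
    have h2 : ∑' n : ℕ, vonMangoldt n * (n:ℝ)^(-(1+δ)) = ‖LSeries (fun n => (vonMangoldt n : ℂ)) ((1 + δ : ℝ) : ℂ)‖ := by
      rw [h1, Complex.norm_real, Real.norm_of_nonneg h0]
    rw [h2, key, norm_mul]
    have hIntg : IntegrableOn (fun t : ℝ => (Real.log 4 + 4) * t ^ (-(1+δ))) (Set.Ioi 1) :=
      (integrableOn_Ioi_rpow_of_lt (by linarith) one_pos).const_mul _
    have h3 : ‖∫ t in Set.Ioi (1 : ℝ), (∑ k ∈ Finset.Icc 1 ⌊t⌋₊, (vonMangoldt k : ℂ)) * (t:ℂ) ^ (-(((1 + δ : ℝ) : ℂ) + 1))‖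
        ≤ (Real.log 4 + 4) / δ := by
      refine (norm_integral_le_of_norm_le hIntg ?_).trans ?_
      · filter_upwards [self_mem_ae_restrict measurableSet_Ioi] with t ht
        have ht0 : 0 < t := lt_trans one_pos ht
        rw [norm_mul, Complex.norm_cpow_eq_rpow_re_of_pos ht0, ← Complex.ofReal_sum, Complex.norm_real,
          Real.norm_of_nonneg (Finset.sum_nonneg fun _ _ => vonMangoldt_nonneg)]
        have e : (-(((1 + δ : ℝ) : ℂ) + 1)).re = -(1+δ) - 1 := by simp; ring
        rw [e, Real.rpow_sub ht0, Real.rpow_one]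
        calc _ ≤ (Real.log 4 + 4) * t * (t ^ (-(1+δ)) / t) := by gcongr; exact hpsi t ht0.le
          _ = _ := by field_simp
      · rw [integral_const_mul, integral_Ioi_rpow_of_lt (by linarith) one_pos]
        simp [div_eq_mul_inv]
    have h4 : Real.log 4 ≤ 1.4 := by
      have : (4:ℝ) = 2^2 := by norm_num
      rw [this, Real.log_pow]; have := Real.log_two_lt_d9; push_cast; linarith
    rw [Complex.norm_real, Real.norm_of_nonneg (by linarith)]
    calc (1+δ) * _ ≤ 2 * ((Real.log 4 + 4) / δ) := by gcongr; linarith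
      _ ≤ 2 * (6/δ) := by gcongr; linarith
      _ = _ := by ring
  · refine Asymptotics.IsBigO.of_bound (Real.log 4 + 4) ?_
    filter_upwards with n
    have := hpsi n (by positivity)
    simp only [Nat.floor_natCast] at this
    rw [Real.rpow_one, Real.norm_of_nonneg (Finset.sum_nonneg fun _ _ => vonMangoldt_nonneg), Real.norm_natCast]
    exact this

open ArithmeticFunction in
lemma logDeriv_right {q : ℕ} [NeZero q] (χ : DirichletCharacter ℂ q) {δ : ℝ} (hδ : 0 < δ) (hδ1 : δ ≤ 1) (s : ℂ)
    (hs : s.re = 1 + δ) :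
    ‖deriv (DirichletCharacter.LFunction χ) s / DirichletCharacter.LFunction χ s‖ ≤ 12 / δ := by
  have hs1 : 1 < s.re := by linarith
  rw [DirichletCharacter.deriv_LFunction_eq_deriv_LSeries χ hs1, DirichletCharacter.LFunction_eq_LSeries χ hs1]
  have := DirichletCharacter.LSeries_twist_vonMangoldt_eq χ hs1
  rw [← norm_neg, ← neg_div, ← this, LSeries]
  refine (tsum_of_norm_bounded (vM_summable hδ).hasSum ?_).trans (vM_sum_le hδ hδ1)
  intro n
  rw [LSeries.norm_term_eq]
  split_ifs with h
  · simp [h]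
  · rw [hs, Real.rpow_neg (by positivity), ← div_eq_mul_inv]
    gcongr
    simp only [Pi.mul_apply, norm_mul, Complex.norm_real, Real.norm_of_nonneg vonMangoldt_nonneg]
    have := χ.norm_le_one n
    have h2 : 0 ≤ vonMangoldt n := vonMangoldt_nonneg
    nlinarith

lemma logDeriv_damped (hGRH : GRH) {q : ℕ} [NeZero q] (χ : DirichletCharacter ℂ q) (hχ : χ ≠ 1) (s : ℂ)
    (hs : 3/4 ≤ s.re) (hs2 : s.re ≤ 2) :
    ‖deriv (DirichletCharacter.LFunction χ) s / DirichletCharacter.LFunction χ s * Complex.exp ((s-1)^2)‖ ≤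
      528 * (5 + Real.log q) := by
  have hq : (1:ℝ) ≤ q := by exact_mod_cast Nat.one_le_iff_ne_zero.2 (NeZero.ne q)
  have hlq : 0 ≤ Real.log q := Real.log_nonneg hq
  rw [norm_mul, Complex.norm_exp]
  have h1 : ((s-1)^2).re = (s.re - 1)^2 - s.im^2 := by
    rw [pow_two]; simp; ring
  have h2 : Real.exp ((s-1)^2).re ≤ 3 * Real.exp (-s.im^2) := by
    rw [h1, sub_eq_add_neg, Real.exp_add]
    gcongr
    have : Real.exp ((s.re-1)^2) ≤ Real.exp 1 := Real.exp_le_exp.2 (by nlinarith)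
    have := Real.exp_one_lt_d9
    linarith
  have h3 : Real.log (40 * q * (1 + |s.im|)) ≤ 4 + Real.log q + |s.im| := by
    have ha : 0 ≤ |s.im| := abs_nonneg _
    rw [Real.log_mul (by positivity) (by positivity), Real.log_mul (by positivity) (by positivity)]
    have e1 : Real.log (1 + |s.im|) ≤ |s.im| := by
      have := Real.log_le_sub_one_of_pos (show 0 < 1 + |s.im| by positivity); linarith
    have e2 : Real.log 40 ≤ 4 := by
      rw [Real.log_le_iff_le_exp (by norm_num)]
      have : Real.exp 4 = (Real.exp 1)^4 := by rw [← Real.exp_nat_mul]; norm_num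
      rw [this]
      have := Real.exp_one_gt_d9
      calc (40:ℝ) ≤ 2.7^4 := by norm_num
        _ ≤ _ := by gcongr; linarith
    linarith
  have h4 := LFunction_logDeriv_bound hGRH χ hχ s hs hs2
  have h5 : |s.im| * Real.exp (-s.im^2) ≤ 1 := by
    rw [Real.exp_neg, ← div_eq_mul_inv, div_le_one (Real.exp_pos _)]
    have := Real.add_one_le_exp (s.im^2)
    have := sq_abs s.im
    nlinarith [sq_nonneg (|s.im| - 1)]
  have h6 : Real.exp (-s.im^2) ≤ 1 := by
    rw [Real.exp_le_one_iff]; nlinarith [sq_nonneg s.im]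
  calc _ ≤ (176 * (4 + Real.log q + |s.im|)) * (3 * Real.exp (-s.im^2)) := by
        gcongr
        linarith
    _ = 528 * ((4 + Real.log q) * Real.exp (-s.im^2) + |s.im| * Real.exp (-s.im^2)) := by ring
    _ ≤ 528 * ((4 + Real.log q) * 1 + 1) := by gcongr
    _ = _ := by ring

lemma logDeriv_near_one (hGRH : GRH) : ∃ C : ℝ, 0 < C ∧ ∀ δ : ℝ, 0 < δ → δ ≤ 1 →
    ∀ (q : ℕ) [NeZero q] (χ : DirichletCharacter ℂ q), χ ≠ 1 → Real.log q ≤ Real.exp (1/δ) →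
    ∀ σ : ℝ, 1 ≤ σ → σ ≤ 1 + δ →
    ‖deriv (DirichletCharacter.LFunction χ) σ / DirichletCharacter.LFunction χ σ‖ ≤ C / δ := by
  refine ⟨3168^4 * Real.exp 4 * 36, by positivity, ?_⟩
  intro δ hδ hδ1 q _ χ hχ hq σ hσ1 hσ2
  set E := Real.exp (1/δ) with hE
  have hE1 : 1 ≤ E := Real.one_le_exp (by positivity)
  set G : ℂ → ℂ := fun s => deriv (DirichletCharacter.LFunction χ) s / DirichletCharacter.LFunction χ s * Complex.exp ((s-1)^2) with hG
  have hGb : ∀ s : ℂ, 3/4 ≤ s.re → s.re ≤ 2 → ‖G s‖ ≤ 3168 * E := by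
    intro s h1 h2
    refine (logDeriv_damped hGRH χ hχ s h1 h2).trans ?_
    linarith
  have hGd : DifferentiableOn ℂ G {s | 1/2 < s.re} := by
    have hU : IsOpen {s : ℂ | 1/2 < s.re} := isOpen_lt continuous_const Complex.continuous_re
    have hd := (DirichletCharacter.differentiable_LFunction hχ).differentiableOn (s := {s : ℂ | 1/2 < s.re})
    refine ((hd.deriv hU).div hd ?_).mul (by fun_prop)
    intro s hs
    exact GRH_ne_zero hGRH χ hχ s hs
  have h3 := Complex.HadamardThreeLines.norm_le_interp_of_mem_verticalClosedStrip' (f := G) (z := (σ:ℂ)) (a := 3168 * E) (b := 36/δ)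
    (l := 3/4) (u := 1 + δ) (by linarith) (by simp [Complex.HadamardThreeLines.verticalClosedStrip]; constructor <;> linarith)
    (by
      refine (hGd.mono ?_).diffContOnCl
      rw [Complex.HadamardThreeLines.verticalStrip, Complex.closure_preimage_re, closure_Ioo (by linarith)]
      intro s hs
      have := hs.1
      simp at this ⊢
      linarith)
    ⟨3168 * E, by
      rintro _ ⟨s, hs, rfl⟩
      exact hGb s hs.1 (by have := hs.2; linarith)⟩
    (fun s hs => hGb s (le_of_eq hs.symm) (by rw [show s.re = 3/4 from hs]; norm_num))
    (by
      intro s hs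
      have hs' : s.re = 1 + δ := hs
      rw [hG]
      simp only
      rw [norm_mul]
      have e1 := logDeriv_right χ hδ hδ1 s hs'
      have e2 : ‖Complex.exp ((s-1)^2)‖ ≤ 3 := by
        rw [Complex.norm_exp]
        have h1 : ((s-1)^2).re = (s.re - 1)^2 - s.im^2 := by
          rw [pow_two]; simp; ring
        have : Real.exp ((s-1)^2).re ≤ Real.exp 1 := Real.exp_le_exp.2 (by rw [h1, hs']; nlinarith [sq_nonneg s.im])
        have := Real.exp_one_lt_d9
        linarith
      calc _ ≤ 12 / δ * 3 := by gcongr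
        _ = _ := by ring)
  simp only [Complex.ofReal_re] at h3
  set θ : ℝ := (σ - 3/4) / (1 + δ - 3/4) with hθ
  have hden : 0 < 1 + δ - 3/4 := by linarith
  have hθ1 : θ ≤ 1 := by rw [hθ, div_le_one hden]; linarith
  have hθ2 : 1 - θ ≤ 4 * δ := by
    rw [hθ, sub_le_iff_le_add, ← sub_le_iff_le_add', le_div_iff₀ hden]
    nlinarith
  have hθ0 : 0 ≤ θ := by rw [hθ]; apply div_nonneg <;> linarith
  have ha : (3168 * E) ^ (1 - θ) ≤ 3168^4 * Real.exp 4 := by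
    calc (3168 * E) ^ (1 - θ) ≤ (3168 * E) ^ (4 * δ) := Real.rpow_le_rpow_of_exponent_le (by linarith) hθ2
      _ = 3168 ^ (4 * δ) * E ^ (4 * δ) := Real.mul_rpow (by norm_num) (by positivity)
      _ ≤ 3168 ^ (4:ℝ) * Real.exp 4 := by
        gcongr
        · norm_num
        · linarith
        · rw [hE, ← Real.exp_mul]
          apply le_of_eq; congr 1; field_simp
      _ = _ := by norm_num
  have hb : (36/δ) ^ θ ≤ 36 / δ := by
    have : 1 ≤ 36/δ := by rw [le_div_iff₀ hδ]; linarith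
    calc (36/δ) ^ θ ≤ (36/δ) ^ (1:ℝ) := Real.rpow_le_rpow_of_exponent_le this hθ1
      _ = _ := Real.rpow_one _
  have hG1 : ‖deriv (DirichletCharacter.LFunction χ) σ / DirichletCharacter.LFunction χ σ‖ ≤ ‖G σ‖ := by
    rw [hG]; simp only; rw [norm_mul]
    refine le_mul_of_one_le_right (norm_nonneg _) ?_
    rw [Complex.norm_exp]
    refine Real.one_le_exp ?_
    have : ((σ:ℂ) - 1)^2 = (((σ - 1)^2 : ℝ) : ℂ) := by push_cast; ring
    rw [this, Complex.ofReal_re]; positivity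
  calc _ ≤ ‖G σ‖ := hG1
    _ ≤ _ := h3
    _ ≤ (3168^4 * Real.exp 4) * (36 / δ) := by gcongr
    _ = _ := by ring

end PartNoc

section PartNod

/-- The prime sum at `σ`. -/
noncomputable def PrimeS {q : ℕ} (χ : DirichletCharacter ℂ q) (σ : ℝ) : ℝ :=
  ∑' p : Nat.Primes, (χ (p : ℕ)).re * (p : ℝ) ^ (-σ)

lemma re_char_le {q : ℕ} (χ : DirichletCharacter ℂ q) (a : ZMod q) : |(χ a).re| ≤ 1 :=
  (Complex.abs_re_le_norm _).trans (DirichletCharacter.norm_le_one χ a)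

lemma PrimeS_summable {q : ℕ} (χ : DirichletCharacter ℂ q) {σ : ℝ} (hσ : 1 < σ) :
    Summable (fun p : Nat.Primes => (χ (p : ℕ)).re * (p : ℝ) ^ (-σ)) := by
  refine Summable.of_norm_bounded (Nat.Primes.summable_rpow.mpr (by linarith : -σ < -1)) ?_
  intro p
  rw [norm_mul, Real.norm_eq_abs, Real.norm_of_nonneg (Real.rpow_nonneg (Nat.cast_nonneg _) _)]
  exact mul_le_of_le_one_left (Real.rpow_nonneg (Nat.cast_nonneg _) _) (re_char_le χ _)

lemma log_LFunction_PrimeS {q : ℕ} [NeZero q] (χ : DirichletCharacter ℂ q) {σ : ℝ} (hσ : 1 < σ) :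
    |Real.log ‖DirichletCharacter.LFunction χ σ‖ - PrimeS χ σ| ≤ 2 := by
  have hs : 1 < (σ : ℂ).re := by simpa using hσ
  have hsum := DirichletCharacter.summable_neg_log_one_sub_mul_prime_cpow χ hs
  rw [DirichletCharacter.LFunction_eq_LSeries χ hs, ← DirichletCharacter.LSeries_eulerProduct_exp_log χ hs,
    Complex.norm_exp, Real.log_exp, Complex.re_tsum hsum, PrimeS]
  have hsum' : Summable (fun p : Nat.Primes => (-Complex.log (1 - χ p * (p:ℂ) ^ (-(σ:ℂ)))).re) :=
    (Complex.hasSum_re hsum.hasSum).summable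
  rw [← hsum'.tsum_sub (PrimeS_summable χ hσ)]
  have hz2 : Summable (fun p : Nat.Primes => (1:ℝ) / ((p:ℕ):ℝ)^2) :=
    hasSum_zeta_two.summable.comp_injective Subtype.val_injective
  have hz2' : ∑' p : Nat.Primes, (1:ℝ) / ((p:ℕ):ℝ)^2 ≤ 2 := by
    calc _ ≤ ∑' n : ℕ, (1:ℝ) / (n:ℝ)^2 :=
          hz2.tsum_le_tsum_of_inj _ Subtype.val_injective (fun _ _ => by positivity) (fun _ => le_rfl) hasSum_zeta_two.summable
      _ = Real.pi ^ 2 / 6 := hasSum_zeta_two.tsum_eq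
      _ ≤ 2 := by nlinarith [Real.pi_lt_d2, Real.pi_pos]
  refine le_trans ?_ hz2'
  rw [← Real.norm_eq_abs]
  refine tsum_of_norm_bounded hz2.hasSum ?_
  intro p
  have hp2 : (2:ℝ) ≤ (p:ℕ) := by exact_mod_cast p.2.two_le
  have hp0 : (0:ℝ) < (p:ℕ) := by linarith
  set z : ℂ := χ p * (p:ℂ) ^ (-(σ:ℂ)) with hz
  have hpow : ((p:ℕ):ℂ) ^ (-(σ:ℂ)) = (((p:ℕ):ℝ) ^ (-σ) : ℝ) := by
    rw [Complex.ofReal_cpow hp0.le]; push_cast; rfl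
  have hre : (χ (p:ℕ)).re * ((p:ℕ):ℝ) ^ (-σ) = z.re := by
    rw [hz, hpow, Complex.re_mul_ofReal]
  have hnorm : ‖z‖ ≤ 1 / (p:ℕ) := by
    rw [hz, norm_mul, hpow, Complex.norm_real, Real.norm_of_nonneg (by positivity)]
    calc _ ≤ 1 * ((p:ℕ):ℝ) ^ (-σ) := by gcongr; exact DirichletCharacter.norm_le_one χ _
      _ ≤ ((p:ℕ):ℝ) ^ (-1:ℝ) := by
        rw [one_mul]; exact Real.rpow_le_rpow_of_exponent_le (by linarith) (by linarith)
      _ = _ := by rw [Real.rpow_neg_one, one_div]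
  have hhalf : ‖z‖ ≤ 1/2 := hnorm.trans (by gcongr)
  have hb := Complex.norm_log_one_add_sub_self_le (z := -z) (by rw [norm_neg]; linarith)
  rw [norm_neg] at hb
  have h1 : (1 - ‖z‖)⁻¹ ≤ 2 := by
    rw [inv_le_comm₀ (by linarith) (by norm_num)]; linarith
  rw [hre, ← Complex.sub_re]
  calc ‖(-Complex.log (1 - z) - z).re‖ ≤ ‖-Complex.log (1 - z) - z‖ := Complex.abs_re_le_norm _
    _ = ‖Complex.log (1 + -z) - -z‖ := by rw [← norm_neg]; congr 1; ring_nf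
    _ ≤ ‖z‖^2 * (1 - ‖z‖)⁻¹ / 2 := hb
    _ ≤ ‖z‖^2 * 2 / 2 := by gcongr
    _ = ‖z‖^2 := by ring
    _ ≤ (1 / (p:ℕ))^2 := by gcongr
    _ = _ := by rw [div_pow, one_pow]

lemma PrimeS_near (hGRH : GRH) : ∃ C : ℝ, 0 < C ∧ ∀ δ : ℝ, 0 < δ → δ ≤ 1 →
    ∀ (q : ℕ) [NeZero q] (χ : DirichletCharacter ℂ q), χ ≠ 1 → Real.log q ≤ Real.exp (1/δ) →
    ∀ η : ℝ, 0 < η → η ≤ δ → |PrimeS χ (1+η) - PrimeS χ (1+δ)| ≤ C := by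
  obtain ⟨C, hC, h⟩ := logDeriv_near_one hGRH
  refine ⟨C + 4, by linarith, ?_⟩
  intro δ hδ hδ1 q _ χ hχ hq η hη hηδ
  have hd : ∀ t ∈ Set.Icc (1:ℝ) (1+δ), HasDerivWithinAt (fun t : ℝ => Real.log (‖DirichletCharacter.LFunction χ t‖^2))
      ((2 * inner ℝ (DirichletCharacter.LFunction χ t) (deriv (DirichletCharacter.LFunction χ) t)) / ‖DirichletCharacter.LFunction χ t‖^2)
      (Set.Icc (1:ℝ) (1+δ)) t := by
    intro t ht
    have hne : DirichletCharacter.LFunction χ t ≠ 0 :=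
      GRH_ne_zero hGRH χ hχ t (by simp only [Complex.ofReal_re]; linarith [ht.1])
    have h1 : HasDerivAt (fun t : ℝ => DirichletCharacter.LFunction χ t) (deriv (DirichletCharacter.LFunction χ) t) t :=
      ((DirichletCharacter.differentiable_LFunction hχ) (t:ℂ)).hasDerivAt.comp_ofReal
    exact ((h1.norm_sq).log (by positivity)).hasDerivWithinAt
  have hb : ∀ t ∈ Set.Icc (1:ℝ) (1+δ), ‖(2 * inner ℝ (DirichletCharacter.LFunction χ t) (deriv (DirichletCharacter.LFunction χ) t)) / ‖DirichletCharacter.LFunction χ t‖^2‖ ≤ 2 * (C / δ) := by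
    intro t ht
    have hne : DirichletCharacter.LFunction χ t ≠ 0 :=
      GRH_ne_zero hGRH χ hχ t (by simp only [Complex.ofReal_re]; linarith [ht.1])
    have hpos : 0 < ‖DirichletCharacter.LFunction χ t‖ := norm_pos_iff.mpr hne
    have := h δ hδ hδ1 q χ hχ hq t ht.1 ht.2
    rw [norm_div] at this
    rw [norm_div, norm_mul, norm_pow, norm_norm]
    have h3 := norm_inner_le_norm (𝕜 := ℝ) (DirichletCharacter.LFunction χ t) (deriv (DirichletCharacter.LFunction χ) t)
    rw [div_le_iff₀ (by positivity)]
    rw [div_le_iff₀ hpos] at this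
    rw [Real.norm_of_nonneg (by norm_num : (0:ℝ) ≤ 2)]
    nlinarith
  have hm := (convex_Icc (1:ℝ) (1+δ)).norm_image_sub_le_of_norm_hasDerivWithin_le hd hb
    (x := 1+δ) (y := 1+η) (by constructor <;> linarith) (by constructor <;> linarith)
  simp only [Real.log_pow] at hm
  have h5 : ‖1 + η - (1+δ)‖ ≤ δ := by rw [Real.norm_eq_abs, abs_le]; constructor <;> linarith
  have h6 : 2 * (C/δ) * ‖1 + η - (1+δ)‖ ≤ 2 * C := by
    calc _ ≤ 2 * (C/δ) * δ := by gcongr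
      _ = _ := by field_simp
  have h7 := hm.trans h6
  have e1 := log_LFunction_PrimeS χ (σ := 1+η) (by linarith)
  have e2 := log_LFunction_PrimeS χ (σ := 1+δ) (by linarith)
  rw [Real.norm_eq_abs, abs_le] at h7
  rw [abs_le] at e1 e2 ⊢
  push_cast at h7
  push_cast at e1 e2
  constructor <;> linarith [h7.1, h7.2, e1.1, e1.2, e2.1, e2.2]

end PartNod

section PartNoe

open Filter

lemma abel_limit {b : ℕ → ℝ} {r : ℝ} (hb : Tendsto (fun y : ℕ => ∑ n ∈ Finset.range y, b n) atTop (nhds r))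
    {δ : ℝ} (hδ : 0 < δ) : ∃ η, 0 < η ∧ η ≤ δ ∧ ∀ T, HasSum (fun n : ℕ => b n * (max (n:ℝ) 1)^(-η)) T →
      |T - r| ≤ 2 := by
  set c : ℕ → ℝ := fun n => b n - if n = 0 then r else 0 with hc
  set E : ℕ → ℝ := fun n => ∑ i ∈ Finset.range n, c i with hE
  have hEn : ∀ n, 1 ≤ n → E n = (∑ i ∈ Finset.range n, b i) - r := by
    intro n hn
    simp only [hE, hc, Finset.sum_sub_distrib]
    congr 1
    rw [Finset.sum_ite_eq' (Finset.range n) 0 (fun _ => r)]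
    simp [Nat.pos_iff_ne_zero.mp hn]
  have hE0 : Tendsto E atTop (nhds 0) := by
    have h1 : Tendsto (fun y : ℕ => (∑ n ∈ Finset.range y, b n) - r) atTop (nhds 0) := by
      simpa using hb.sub_const r
    refine h1.congr' ?_
    filter_upwards [eventually_ge_atTop 1] with n hn
    rw [hEn n hn]
  obtain ⟨K, hK⟩ := (Metric.isBounded_range_of_tendsto E hE0).exists_norm_le
  have hK' : ∀ n, |E n| ≤ K := fun n => hK _ ⟨n, rfl⟩
  have hK0 : 0 ≤ K := (abs_nonneg _).trans (hK' 0)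
  obtain ⟨M, hM⟩ : ∃ M, ∀ n ≥ M, |E n| ≤ 1 := by
    have := (Metric.tendsto_atTop.mp hE0) 1 one_pos
    obtain ⟨M, hM⟩ := this
    exact ⟨M, fun n hn => by simpa using (hM n hn).le⟩
  have hcont : Tendsto (fun η : ℝ => K * (1 - (max (M:ℝ) 1)^(-η))) (nhdsWithin 0 (Set.Ioi 0)) (nhds 0) := by
    have h0 : (0:ℝ) < max (M:ℝ) 1 := lt_of_lt_of_le one_pos (le_max_right _ _)
    have : Continuous (fun η : ℝ => K * (1 - (max (M:ℝ) 1)^(-η))) := by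
      have := Real.continuous_const_rpow h0.ne'
      fun_prop
    have h2 := this.tendsto 0
    simp only [neg_zero, Real.rpow_zero, sub_self, mul_zero] at h2
    exact h2.mono_left nhdsWithin_le_nhds
  have hev : ∀ᶠ η in nhdsWithin (0:ℝ) (Set.Ioi 0), K * (1 - (max (M:ℝ) 1)^(-η)) ≤ 1 ∧ η ∈ Set.Ioc 0 δ :=
    (hcont.eventually (eventually_le_nhds one_pos)).and (Ioc_mem_nhdsGT hδ)
  obtain ⟨η, hη1, hη0, hηδ⟩ := hev.exists
  refine ⟨η, hη0, hηδ, ?_⟩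
  intro T hT
  set w : ℕ → ℝ := fun n => (max (n:ℝ) 1)^(-η) with hw
  have hw0 : w 0 = 1 := by simp [hw]
  have hwpos : ∀ n, 0 ≤ w n := fun n => Real.rpow_nonneg (le_trans zero_le_one (le_max_right _ _)) _
  have hwanti : ∀ n, w (n+1) ≤ w n := by
    intro n
    apply Real.rpow_le_rpow_of_nonpos (lt_of_lt_of_le one_pos (le_max_right _ _)) _ (by linarith)
    apply max_le_max _ le_rfl
    push_cast; linarith
  have hT' : HasSum (fun n => w n * c n) (T - r) := by
    have h1 : HasSum (fun n : ℕ => if n = 0 then r else 0) r := hasSum_ite_eq 0 r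
    have := hT.sub h1
    refine this.congr_fun ?_ |> fun h => h
    intro n
    by_cases hn : n = 0
    · subst hn; simp only [hc, hw0, if_true]; simp
    · simp [hc, hn, hw, mul_comm]
  have hlim := hT'.tendsto_sum_nat.abs
  refine le_of_tendsto hlim ?_
  filter_upwards [eventually_ge_atTop (M+1)] with N hN
  have hparts := Finset.sum_range_by_parts w c N
  simp only [smul_eq_mul] at hparts
  rw [hparts]
  change |w (N-1) * E N - ∑ i ∈ Finset.range (N-1), (w (i+1) - w i) * E (i+1)| ≤ 2
  have h1 : |w (N-1) * E N| ≤ w (N-1) := by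
    rw [abs_mul, abs_of_nonneg (hwpos _)]
    exact mul_le_of_le_one_right (hwpos _) (hM N (by omega))
  have h2 : |∑ i ∈ Finset.range (N-1), (w (i+1) - w i) * E (i+1)| ≤ (1 - w (N-1)) + K * (1 - w M) := by
    calc _ ≤ ∑ i ∈ Finset.range (N-1), |(w (i+1) - w i) * E (i+1)| := Finset.abs_sum_le_sum_abs _ _
      _ ≤ ∑ i ∈ Finset.range (N-1), ((w i - w (i+1)) + if i < M then K * (w i - w (i+1)) else 0) := by
        apply Finset.sum_le_sum
        intro i _
        have hd : 0 ≤ w i - w (i+1) := by linarith [hwanti i]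
        rw [abs_mul, abs_sub_comm, abs_of_nonneg hd]
        split_ifs with hi
        · nlinarith [hK' (i+1)]
        · nlinarith [hM (i+1) (by omega)]
      _ = (∑ i ∈ Finset.range (N-1), (w i - w (i+1))) + ∑ i ∈ Finset.range (N-1), (if i < M then K * (w i - w (i+1)) else 0) :=
        Finset.sum_add_distrib
      _ ≤ (1 - w (N-1)) + ∑ i ∈ Finset.range M, K * (w i - w (i+1)) := by
        rw [Finset.sum_range_sub', hw0, ← Finset.sum_filter]
        gcongr 1
        apply Finset.sum_le_sum_of_subset_of_nonneg
        · intro i hi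
          simp only [Finset.mem_filter, Finset.mem_range] at hi ⊢
          exact hi.2
        · intro i _ _
          exact mul_nonneg hK0 (by linarith [hwanti i])
      _ = _ := by rw [← Finset.mul_sum, Finset.sum_range_sub', hw0]
  calc _ ≤ |w (N-1) * E N| + |∑ i ∈ Finset.range (N-1), (w (i+1) - w i) * E (i+1)| := abs_sub _ _
    _ ≤ 2 := by linarith

lemma PrimeS_hasSum {q : ℕ} (χ : DirichletCharacter ℂ q) {η : ℝ} (hη : 0 < η) :
    HasSum (fun n : ℕ => (if n.Prime then (χ n).re / (n:ℝ) else 0) * (max (n:ℝ) 1)^(-η)) (PrimeS χ (1+η)) := by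
  have h := (PrimeS_summable χ (σ := 1+η) (by linarith)).hasSum
  change HasSum _ (PrimeS χ (1+η)) at h
  have h2 := (hasSum_subtype_iff_indicator (f := fun n : ℕ => (χ n).re * (n:ℝ)^(-(1+η))) (s := {p | p.Prime})).mp h
  convert h2 using 1
  ext n
  by_cases hn : n.Prime
  · have hn1 : (1:ℝ) ≤ n := by exact_mod_cast hn.one_le
    rw [Set.indicator_of_mem (by exact hn), if_pos hn, max_eq_left hn1, neg_add, Real.rpow_add (by linarith), Real.rpow_neg_one]
    ring
  · rw [Set.indicator_of_notMem (by exact hn), if_neg hn, zero_mul]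

lemma curlyL_near (hGRH : GRH) : ∃ C : ℝ, 0 < C ∧ ∀ δ : ℝ, 0 < δ → δ ≤ 1 →
    ∀ (q : ℕ) [NeZero q] (χ : DirichletCharacter ℂ q), χ ≠ 1 → Real.log q ≤ Real.exp (1/δ) →
    ∀ r : ℝ, HasCurlyL χ r → |r - PrimeS χ (1+δ)| ≤ C := by
  obtain ⟨C, hC, h⟩ := PrimeS_near hGRH
  refine ⟨C + 2, by linarith, ?_⟩
  intro δ hδ hδ1 q _ χ hχ hq r hr
  have hr' : Tendsto (fun y : ℕ => ∑ n ∈ Finset.range y, (if n.Prime then (χ n).re / (n:ℝ) else 0)) atTop (nhds r) := by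
    simp_rw [← Finset.sum_filter]
    exact hr
  obtain ⟨η, hη0, hηδ, hη⟩ := abel_limit hr' hδ
  have h1 := hη _ (PrimeS_hasSum χ hη0)
  have h2 := h δ hδ hδ1 q χ hχ hq η hη0 hηδ
  rw [abs_le] at *
  constructor <;> linarith [h1.1, h1.2, h2.1, h2.2]

lemma PrimeS_zeta : ∀ᶠ δ in nhdsWithin (0:ℝ) (Set.Ioi 0),
    |PrimeS (1 : DirichletCharacter ℂ 1) (1+δ) - Real.log (1/δ)| ≤ 3 := by
  have h1 : Tendsto (fun δ : ℝ => ((1 + δ : ℝ) : ℂ)) (nhdsWithin (0:ℝ) (Set.Ioi 0)) (nhdsWithin 1 {1}ᶜ) := by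
    apply tendsto_nhdsWithin_iff.mpr
    constructor
    · have : Continuous (fun δ : ℝ => ((1 + δ : ℝ) : ℂ)) := by fun_prop
      have h := this.tendsto 0
      simp only [add_zero, Complex.ofReal_one] at h
      exact h.mono_left nhdsWithin_le_nhds
    · filter_upwards [self_mem_nhdsWithin] with δ hδ
      simp only [Set.mem_compl_iff, Set.mem_singleton_iff]
      intro h
      have : (1 + δ : ℝ) = 1 := by exact_mod_cast h
      have h0 : (0:ℝ) < δ := hδ
      linarith
  have h2 := ((riemannZeta_residue_one.comp h1).norm).log (by simp)
  simp only [norm_one, Real.log_one] at h2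
  have h3 := h2.eventually (Metric.closedBall_mem_nhds 0 one_pos)
  filter_upwards [h3, self_mem_nhdsWithin] with δ h3 hδ
  have hδ0 : (0:ℝ) < δ := hδ
  simp only [Function.comp, Metric.mem_closedBall, dist_zero_right, norm_mul] at h3
  have e : ((1+δ:ℝ):ℂ) - 1 = (δ : ℂ) := by push_cast; ring
  have hz : riemannZeta ((1+δ:ℝ):ℂ) ≠ 0 := riemannZeta_ne_zero_of_one_lt_re (by simp [hδ0])
  rw [e, Complex.norm_real, Real.norm_of_nonneg hδ0.le, Real.log_mul hδ0.ne' (by simpa using hz)] at h3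
  have h4 := log_LFunction_PrimeS (1 : DirichletCharacter ℂ 1) (σ := 1+δ) (by linarith)
  rw [DirichletCharacter.LFunction_modOne_eq] at h4
  rw [one_div, Real.log_inv]
  rw [Real.norm_eq_abs] at h3
  rw [abs_le] at *
  constructor <;> linarith [h3.1, h3.2, h4.1, h4.2]

end PartNoe

section PartNof

open Filter

lemma curlyL_ne_one {d : ℕ} (hd : 0 < d) {χ : DirichletCharacter ℂ d} (hp : χ.IsPrimitive) {r : ℝ}
    (h : HasCurlyL χ r) : χ ≠ 1 := by
  rintro rfl
  have hc : (1 : DirichletCharacter ℂ d).conductor = d := hp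
  have : NeZero d := ⟨hd.ne'⟩
  rw [DirichletCharacter.conductor_one] at hc
  subst hc
  have h1 := not_summable_one_div_on_primes
  rw [not_summable_iff_tendsto_nat_atTop_of_nonneg] at h1
  · refine not_tendsto_nhds_of_tendsto_atTop h1 r ?_
    refine h.congr ?_
    intro y
    rw [Finset.sum_filter]
    apply Finset.sum_congr rfl
    intro n _
    have : (1 : DirichletCharacter ℂ 1) n = 1 := MulChar.one_apply (isUnit_of_subsingleton _)
    rw [this]
    by_cases hn : n.Prime
    · rw [if_pos hn, Set.indicator_of_mem (by exact hn)]; simp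
    · rw [if_neg hn, Set.indicator_of_notMem (by exact hn)]
  · intro n
    exact Set.indicator_nonneg (fun _ _ => by positivity) _

lemma PrimeS_le_zeta {q : ℕ} (χ : DirichletCharacter ℂ q) {σ : ℝ} (hσ : 1 < σ) :
    PrimeS χ σ ≤ PrimeS (1 : DirichletCharacter ℂ 1) σ := by
  refine (PrimeS_summable χ hσ).tsum_le_tsum ?_ (PrimeS_summable _ hσ)
  intro p
  have : (1 : DirichletCharacter ℂ 1) (p:ℕ) = 1 := MulChar.one_apply (isUnit_of_subsingleton _)
  rw [this, Complex.one_re]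
  exact mul_le_mul_of_nonneg_right ((le_abs_self _).trans (re_char_le χ _)) (Real.rpow_nonneg (Nat.cast_nonneg _) _)

lemma tendsto_delta : Tendsto (fun x : ℝ => 1 / Real.log (Real.log x)) atTop (nhdsWithin 0 (Set.Ioi 0)) := by
  have h : Tendsto (fun x : ℝ => Real.log (Real.log x)) atTop atTop :=
    Real.tendsto_log_atTop.comp Real.tendsto_log_atTop
  simp_rw [one_div]
  exact tendsto_inv_atTop_nhdsGT_zero.comp h

lemma upper_bound (hGRH : GRH) : ∃ K : ℝ, 0 < K ∧ ∀ᶠ x : ℝ in atTop,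
    ∀ r ∈ {r : ℝ | ∃ d : ℕ, (d : ℝ) ≤ x ∧ IsFundamentalDiscriminant d ∧
            ∃ χ : DirichletCharacter ℂ d, χ.IsPrimitive ∧ MulChar.IsQuadratic χ ∧
              HasCurlyL χ r}, r ≤ Real.log (Real.log (Real.log x)) + K := by
  obtain ⟨C, hC, h⟩ := curlyL_near hGRH
  refine ⟨C + 3, by linarith, ?_⟩
  filter_upwards [tendsto_delta.eventually PrimeS_zeta, tendsto_delta.eventually (Ioc_mem_nhdsGT one_pos),
    eventually_gt_atTop 1] with x hx1 hx2 hx3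
  rintro r ⟨d, hd, ⟨hd0, -⟩, χ, hp, -, hr⟩
  have hχ := curlyL_ne_one hd0 hp hr
  have : NeZero d := ⟨hd0.ne'⟩
  have hlog : 0 < Real.log x := Real.log_pos hx3
  have h1 := h _ hx2.1 hx2.2 d χ hχ (by
    rw [one_div_one_div, Real.exp_log hlog]
    exact Real.log_le_log (by exact_mod_cast hd0) hd) r hr
  have h2 := PrimeS_le_zeta χ (σ := 1 + 1 / Real.log (Real.log x)) (by linarith [hx2.1])
  rw [one_div_one_div] at hx1
  rw [abs_le] at *
  linarith [h1.2, hx1.2]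

end PartNof

section PartNog

open Filter

lemma abel_range_bound {w : ℕ → ℝ} (hw : Antitone w) (hw0 : ∀ n, 0 ≤ w n) {z : ℕ → ℂ} {B : ℝ}
    (hB : ∀ n, ‖∑ i ∈ Finset.range n, z i‖ ≤ B) (n : ℕ) :
    ‖∑ i ∈ Finset.range n, w i • z i‖ ≤ B * w 0 := by
  have hB0 : 0 ≤ B := (norm_nonneg _).trans (hB 0)
  rw [Finset.sum_range_by_parts]
  calc _ ≤ ‖w (n-1) • ∑ i ∈ Finset.range n, z i‖ + ‖∑ i ∈ Finset.range (n-1), (w (i+1) - w i) • ∑ j ∈ Finset.range (i+1), z j‖ := norm_sub_le _ _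
    _ ≤ w (n-1) * B + ∑ i ∈ Finset.range (n-1), (w i - w (i+1)) * B := by
      gcongr
      · rw [norm_smul, Real.norm_of_nonneg (hw0 _)]
        exact mul_le_mul_of_nonneg_left (hB n) (hw0 _)
      · refine (norm_sum_le _ _).trans (Finset.sum_le_sum fun i _ => ?_)
        have hd : 0 ≤ w i - w (i+1) := by linarith [hw (Nat.le_succ i)]
        rw [norm_smul, Real.norm_eq_abs, abs_sub_comm, abs_of_nonneg hd]
        exact mul_le_mul_of_nonneg_left (hB _) hd
    _ = B * w 0 := by
      rw [← Finset.sum_mul, Finset.sum_range_sub']; ring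

lemma char_weight_bound {q : ℕ} [NeZero q] (χ : DirichletCharacter ℂ q) (hχ : χ ≠ 1) (w : ℕ → ℝ) (m : ℕ)
    (hw : ∀ a b, m ≤ a → a ≤ b → w b ≤ w a) (hw0 : ∀ n, 0 ≤ w n) (n : ℕ) :
    ‖∑ i ∈ Finset.Ico m n, w i • χ (i : ZMod q)‖ ≤ 2 * q * w m := by
  rw [Finset.sum_Ico_eq_sum_range]
  have := abel_range_bound (w := fun i => w (m+i)) (z := fun i => χ ((m+i : ℕ) : ZMod q)) (B := 2 * q)
    (fun a b hab => hw _ _ (by omega) (by omega)) (fun n => hw0 _) (fun n => by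
      have h1 := Finset.sum_range_add_sum_Ico (fun i : ℕ => χ (i : ZMod q)) (Nat.le_add_right m n)
      rw [Finset.sum_Ico_eq_sum_range, Nat.add_sub_cancel_left] at h1
      rw [← sub_eq_iff_eq_add'.mpr h1.symm]
      refine (norm_sub_le _ _).trans ?_
      linarith [char_sum_range_bound χ hχ m, char_sum_range_bound χ hχ (m+n)]) (n - m)
  simpa using this

lemma LFunction_one_approx {q : ℕ} [NeZero q] (χ : DirichletCharacter ℂ q) (hχ : χ ≠ 1) (y : ℕ) (hy : 1 ≤ y) :
    ‖DirichletCharacter.LFunction χ 1 - ∑ k ∈ Finset.range y, ((1:ℝ) / k) • χ (k : ZMod q)‖ ≤ 2 * q / y := by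
  have hy0 : (1:ℝ) ≤ y := by exact_mod_cast hy
  have key : ∀ σ : ℝ, 1 < σ → ‖DirichletCharacter.LFunction χ σ - ∑ k ∈ Finset.range y, ((k:ℝ)^(-σ)) • χ (k : ZMod q)‖ ≤ 2 * q / y := by
    intro σ hσ
    have hs : 1 < (σ : ℂ).re := by simpa using hσ
    have hsum := (DirichletCharacter.LSeriesSummable_of_one_lt_re χ hs).hasSum
    have hterm : ∀ n : ℕ, LSeries.term (fun n => χ n) (σ:ℂ) n = ((n:ℝ)^(-σ)) • χ (n : ZMod q) := by
      intro n
      rcases eq_or_ne n 0 with rfl | hn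
      · simp [Real.zero_rpow (by linarith : -σ ≠ 0)]
      · rw [LSeries.term_of_ne_zero hn, Complex.real_smul, Complex.ofReal_cpow (Nat.cast_nonneg _)]
        push_cast
        rw [Complex.cpow_neg, div_eq_mul_inv, mul_comm]
    have ht := hsum.tendsto_sum_nat
    change Tendsto _ _ (nhds (LSeries (fun n => χ n) σ)) at ht
    rw [← DirichletCharacter.LFunction_eq_LSeries χ hs] at ht
    simp_rw [hterm] at ht
    refine le_of_tendsto (ht.sub_const _).norm ?_
    filter_upwards [eventually_ge_atTop y] with N hN
    rw [← Finset.sum_range_add_sum_Ico _ hN, add_sub_cancel_left]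
    refine (char_weight_bound χ hχ (fun n => (n:ℝ)^(-σ)) y ?_ (fun n => by positivity) N).trans ?_
    · intro a b ha hab
      refine Real.rpow_le_rpow_of_nonpos ?_ (by exact_mod_cast hab) (by linarith)
      exact_mod_cast lt_of_lt_of_le hy ha
    · rw [div_eq_mul_inv]
      gcongr
      rw [← Real.rpow_neg_one]
      exact Real.rpow_le_rpow_of_exponent_le hy0 (by linarith)
  have hc : Tendsto (fun σ : ℝ => ‖DirichletCharacter.LFunction χ σ - ∑ k ∈ Finset.range y, ((k:ℝ)^(-σ)) • χ (k : ZMod q)‖)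
      (nhdsWithin 1 (Set.Ioi 1)) (nhds ‖DirichletCharacter.LFunction χ 1 - ∑ k ∈ Finset.range y, ((1:ℝ) / k) • χ (k : ZMod q)‖) := by
    apply Tendsto.norm
    apply Tendsto.sub
    · have h1 := (DirichletCharacter.differentiable_LFunction hχ).continuous
      have h2 : Continuous (fun σ : ℝ => DirichletCharacter.LFunction χ σ) := h1.comp Complex.continuous_ofReal
      have := h2.tendsto 1
      rw [Complex.ofReal_one] at this
      exact this.mono_left nhdsWithin_le_nhds
    · apply tendsto_finsetSum
      intro k _
      apply Tendsto.smul_const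
      rcases Nat.eq_zero_or_pos k with rfl | hk
      · simp only [Nat.cast_zero, div_zero]
        refine tendsto_const_nhds.congr' ?_
        filter_upwards [self_mem_nhdsWithin] with σ hσ
        have : (1:ℝ) < σ := hσ
        rw [Real.zero_rpow (by linarith)]
      · have hk0 : (0:ℝ) < k := by exact_mod_cast hk
        have : Continuous (fun σ : ℝ => (k:ℝ)^(-σ)) := by
          have := Real.continuous_const_rpow hk0.ne'
          fun_prop
        have h := this.tendsto 1
        rw [Real.rpow_neg_one, ← one_div] at h
        exact h.mono_left nhdsWithin_le_nhds
  refine le_of_tendsto hc ?_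
  filter_upwards [self_mem_nhdsWithin] with σ hσ using key σ hσ

lemma log_char_bounded {q : ℕ} [NeZero q] (χ : DirichletCharacter ℂ q) (hχ : χ ≠ 1) :
    ∃ B : ℝ, ∀ N, ‖∑ k ∈ Finset.range N, (Real.log k / k) • χ (k : ZMod q)‖ ≤ B := by
  refine ⟨∑ k ∈ Finset.range 3, ‖(Real.log k / k) • χ (k : ZMod q)‖ + 2 * q * (Real.log (3:ℕ) / (3:ℕ)), ?_⟩
  intro N
  have hpos : ∀ n : ℕ, 0 ≤ Real.log n / n := fun n => div_nonneg (Real.log_natCast_nonneg n) (Nat.cast_nonneg _)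
  rcases le_total 3 N with hN | hN
  · rw [← Finset.sum_range_add_sum_Ico _ hN]
    refine (norm_add_le _ _).trans (add_le_add (norm_sum_le _ _) ?_)
    refine char_weight_bound χ hχ (fun n => Real.log n / n) 3 ?_ hpos N
    intro a b ha hab
    have he : Real.exp 1 ≤ 3 := by linarith [Real.exp_one_lt_d9]
    have ha' : (3:ℝ) ≤ a := by exact_mod_cast ha
    have hab' : (a:ℝ) ≤ b := by exact_mod_cast hab
    exact Real.log_div_self_antitoneOn (Set.mem_Ici.mpr (by linarith)) (Set.mem_Ici.mpr (by linarith)) hab'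
  · refine (norm_sum_le _ _).trans ?_
    have h1 := Finset.sum_le_sum_of_subset_of_nonneg (f := fun k : ℕ => ‖(Real.log k / k) • χ (k : ZMod q)‖)
      (Finset.range_mono hN) (fun _ _ _ => norm_nonneg _)
    have h2 := hpos 3
    have : (0:ℝ) ≤ 2 * q * (Real.log (3:ℕ) / (3:ℕ)) := by positivity
    linarith

end PartNog

section PartNoh

open Filter

lemma sum_Ioc_range {f : ℕ → ℂ} (hf : f 0 = 0) (N : ℕ) :
    ∑ n ∈ Finset.Ioc 0 N, f n = ∑ n ∈ Finset.range (N+1), f n := by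
  apply Finset.sum_subset
  · intro n hn
    simp only [Finset.mem_Ioc, Finset.mem_range] at hn ⊢
    omega
  · intro n hn hn'
    simp only [Finset.mem_Ioc, Finset.mem_range] at hn hn'
    have : n = 0 := by omega
    rw [this, hf]

lemma mertens_identity {q : ℕ} (χ : DirichletCharacter ℂ q) (N : ℕ) :
    ∑ k ∈ Finset.range (N+1), (Real.log k / k) • χ (k : ZMod q) =
    ∑ m ∈ Finset.Ioc 0 N, (ArithmeticFunction.vonMangoldt m / (m:ℝ)) • χ (m : ZMod q) *
      ∑ k ∈ Finset.range (N/m + 1), ((1:ℝ) / k) • χ (k : ZMod q) := by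
  let f : ArithmeticFunction ℂ := ⟨fun m => (ArithmeticFunction.vonMangoldt m / (m:ℝ)) • χ (m : ZMod q), by simp⟩
  let g : ArithmeticFunction ℂ := ⟨fun k => ((1:ℝ) / k) • χ (k : ZMod q), by simp⟩
  have h := ArithmeticFunction.sum_Ioc_mul_eq_sum_sum f g N
  have hfg : ∀ n : ℕ, (f * g) n = (Real.log n / n) • χ (n : ZMod q) := by
    intro n
    rcases eq_or_ne n 0 with rfl | hn
    · simp
    rw [ArithmeticFunction.mul_apply, ← ArithmeticFunction.vonMangoldt_sum,
      Nat.sum_divisorsAntidiagonal (fun a b => f a * g b) , Finset.sum_div, Finset.sum_smul]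
    apply Finset.sum_congr rfl
    intro m hm
    obtain ⟨k, rfl⟩ := Nat.dvd_of_mem_divisors hm
    have hm0 : m ≠ 0 := fun h => hn (by simp [h])
    have hk0 : k ≠ 0 := fun h => hn (by simp [h])
    rw [Nat.mul_div_cancel_left _ (Nat.pos_of_ne_zero hm0)]
    change (ArithmeticFunction.vonMangoldt m / (m:ℝ)) • χ (m : ZMod q) * (((1:ℝ) / k) • χ (k : ZMod q)) = _
    rw [smul_mul_smul_comm, ← map_mul, ← Nat.cast_mul]
    congr 1
    push_cast
    field_simp
  rw [Finset.sum_congr rfl (fun n _ => hfg n), sum_Ioc_range (by simp)] at h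
  rw [h]
  apply Finset.sum_congr rfl
  intro m _
  rw [sum_Ioc_range (by simp)]
  rfl

lemma vM_char_bounded {q : ℕ} [NeZero q] (χ : DirichletCharacter ℂ q) (hχ : χ ≠ 1) :
    ∃ B : ℝ, ∀ N, ‖∑ m ∈ Finset.Ioc 0 N, (ArithmeticFunction.vonMangoldt m / (m:ℝ)) • χ (m : ZMod q)‖ ≤ B := by
  obtain ⟨B, hB⟩ := log_char_bounded χ hχ
  set L := DirichletCharacter.LFunction χ 1 with hL
  have hL0 : 0 < ‖L‖ := norm_pos_iff.mpr (DirichletCharacter.LFunction_apply_one_ne_zero hχ)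
  refine ⟨(B + 2 * q * (Real.log 4 + 4)) / ‖L‖, ?_⟩
  intro N
  rw [le_div_iff₀ hL0, ← norm_mul]
  rcases Nat.eq_zero_or_pos N with rfl | hN
  · have := (norm_nonneg _).trans (hB 0)
    have h4 : 0 ≤ Real.log 4 := Real.log_nonneg (by norm_num)
    simp only [Finset.Ioc_self, Finset.sum_empty, zero_mul, norm_zero]
    positivity
  have hN0 : (0:ℝ) < N := by exact_mod_cast hN
  have e : (∑ m ∈ Finset.Ioc 0 N, (ArithmeticFunction.vonMangoldt m / (m:ℝ)) • χ (m : ZMod q)) * L =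
      ∑ k ∈ Finset.range (N+1), (Real.log k / k) • χ (k : ZMod q) +
      ∑ m ∈ Finset.Ioc 0 N, (ArithmeticFunction.vonMangoldt m / (m:ℝ)) • χ (m : ZMod q) *
      (L - ∑ k ∈ Finset.range (N/m + 1), ((1:ℝ) / k) • χ (k : ZMod q)) := by
    rw [mertens_identity, ← Finset.sum_add_distrib, Finset.sum_mul]
    apply Finset.sum_congr rfl
    intro m _
    ring
  rw [e]
  refine (norm_add_le _ _).trans (add_le_add (hB _) ?_)
  refine (norm_sum_le _ _).trans ?_
  have hterm : ∀ m ∈ Finset.Ioc 0 N, ‖(ArithmeticFunction.vonMangoldt m / (m:ℝ)) • χ (m : ZMod q) *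
      (L - ∑ k ∈ Finset.range (N/m + 1), ((1:ℝ) / k) • χ (k : ZMod q))‖ ≤ 2 * q / N * ArithmeticFunction.vonMangoldt m := by
    intro m hm
    have hm1 : 0 < m := (Finset.mem_Ioc.mp hm).1
    have hm0 : (0:ℝ) < m := by exact_mod_cast hm1
    have hΛ : 0 ≤ ArithmeticFunction.vonMangoldt m := ArithmeticFunction.vonMangoldt_nonneg
    have h1 := LFunction_one_approx χ hχ (N/m+1) (Nat.le_add_left 1 _)
    rw [norm_mul, norm_smul, Real.norm_of_nonneg (by positivity)]
    have h2 : (N:ℝ) / m ≤ ((N/m+1 : ℕ):ℝ) := by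
      push_cast
      rw [div_le_iff₀ hm0]
      have := Nat.lt_div_mul_add hm1 (a := N)
      have h3 : N ≤ (N/m + 1) * m := by rw [add_mul, one_mul]; exact this.le
      exact_mod_cast h3
    calc _ ≤ (ArithmeticFunction.vonMangoldt m / m) * 1 * (2 * q / ((N:ℝ)/m)) := by
          gcongr
          · exact DirichletCharacter.norm_le_one χ _
          · refine h1.trans ?_
            gcongr
      _ = _ := by field_simp
  refine (Finset.sum_le_sum hterm).trans ?_
  rw [← Finset.mul_sum]
  have hpsi := Chebyshev.psi_le_const_mul_self hN0.le
  have : Chebyshev.psi N = ∑ m ∈ Finset.Ioc 0 N, ArithmeticFunction.vonMangoldt m := by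
    rw [Chebyshev.psi, Nat.floor_natCast]
  rw [← this]
  calc 2 * q / N * Chebyshev.psi N ≤ 2 * q / N * ((Real.log 4 + 4) * N) := by gcongr
    _ = _ := by field_simp

lemma prime_char_bounded {q : ℕ} [NeZero q] (χ : DirichletCharacter ℂ q) (hχ : χ ≠ 1) :
    ∃ B : ℝ, ∀ N, ‖∑ m ∈ Finset.range N, if m.Prime then (Real.log m / (m:ℝ)) • χ (m : ZMod q) else 0‖ ≤ B := by
  obtain ⟨B, hB⟩ := vM_char_bounded χ hχ
  have hs0 := ArithmeticFunction.vonMangoldt.summable_residueClass_non_primes_div (q := 1) 0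
  have hs : Summable (fun n : ℕ => (if n.Prime then 0 else ArithmeticFunction.vonMangoldt n) / (n:ℝ)) := by
    refine hs0.congr ?_
    intro n
    congr 2
    simp only [ArithmeticFunction.vonMangoldt.residueClass]
    rw [Set.indicator_of_mem]
    exact Subsingleton.elim (α := ZMod 1) _ _
  have hpos : ∀ n : ℕ, 0 ≤ (if n.Prime then 0 else ArithmeticFunction.vonMangoldt n) / (n:ℝ) := by
    intro n
    have hΛ : 0 ≤ ArithmeticFunction.vonMangoldt n := ArithmeticFunction.vonMangoldt_nonneg
    split_ifs <;> positivity
  have hB0 : 0 ≤ B := (norm_nonneg _).trans (hB 0)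
  refine ⟨B + ∑' n : ℕ, (if n.Prime then 0 else ArithmeticFunction.vonMangoldt n) / (n:ℝ), ?_⟩
  intro N
  rcases N with _ | N
  · have : 0 ≤ ∑' n : ℕ, (if n.Prime then 0 else ArithmeticFunction.vonMangoldt n) / (n:ℝ) := tsum_nonneg hpos
    simp only [Finset.range_zero, Finset.sum_empty, norm_zero]
    linarith
  have e : (∑ m ∈ Finset.range (N+1), if m.Prime then (Real.log m / (m:ℝ)) • χ (m : ZMod q) else 0) =
     ∑ m ∈ Finset.Ioc 0 N, (ArithmeticFunction.vonMangoldt m / (m:ℝ)) • χ (m : ZMod q)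
      - ∑ m ∈ Finset.range (N+1), ((if m.Prime then 0 else ArithmeticFunction.vonMangoldt m) / (m:ℝ)) • χ (m : ZMod q) := by
    rw [sum_Ioc_range (by simp), ← Finset.sum_sub_distrib]
    apply Finset.sum_congr rfl
    intro m _
    split_ifs with hm
    · rw [ArithmeticFunction.vonMangoldt_apply_prime hm]; simp
    · simp
  rw [e]
  refine (norm_sub_le _ _).trans (add_le_add (hB N) ?_)
  refine (norm_sum_le _ _).trans (le_trans ?_ (hs.sum_le_tsum (Finset.range (N+1)) (fun n _ => hpos n)))
  apply Finset.sum_le_sum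
  intro m _
  rw [norm_smul, Real.norm_of_nonneg (hpos m)]
  exact mul_le_of_le_one_right (hpos m) (DirichletCharacter.norm_le_one χ _)

lemma curlyL_exists {q : ℕ} [NeZero q] (χ : DirichletCharacter ℂ q) (hχ : χ ≠ 1) : ∃ r, HasCurlyL χ r := by
  obtain ⟨B, hB⟩ := prime_char_bounded χ hχ
  have hpos : ∀ n : ℕ, 0 < Real.log (max (n:ℝ) 2) := fun n => Real.log_pos (lt_of_lt_of_le one_lt_two (le_max_right _ _))
  have hanti : Antitone (fun n : ℕ => (Real.log (max (n:ℝ) 2))⁻¹) := by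
    intro a b hab
    apply inv_anti₀ (hpos a)
    apply Real.log_le_log (lt_of_lt_of_le two_pos (le_max_right _ _))
    exact max_le_max (by exact_mod_cast hab) le_rfl
  have h0 : Tendsto (fun n : ℕ => (Real.log (max (n:ℝ) 2))⁻¹) atTop (nhds 0) := by
    apply tendsto_inv_atTop_zero.comp
    apply Real.tendsto_log_atTop.comp
    exact tendsto_atTop_mono (fun n => le_max_left _ _) tendsto_natCast_atTop_atTop
  have hc := hanti.cauchySeq_series_mul_of_tendsto_zero_of_bounded h0 hB
  obtain ⟨l, hl⟩ := cauchySeq_tendsto_of_complete hc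
  refine ⟨l.re, ?_⟩
  have := (Complex.continuous_re.tendsto l).comp hl
  refine this.congr ?_
  intro y
  simp only [Function.comp, Complex.re_sum, Finset.sum_filter]
  apply Finset.sum_congr rfl
  intro n _
  by_cases hn : n.Prime
  · have h2 : (2:ℝ) ≤ n := by exact_mod_cast hn.two_le
    have hl0 : Real.log n ≠ 0 := (Real.log_pos (by linarith)).ne'
    rw [if_pos hn, if_pos hn, max_eq_left h2, smul_smul, Complex.real_smul, Complex.re_ofReal_mul]
    field_simp
  · simp [hn]

end PartNoh

section PartNoi

open Filter

/-- The complex quadratic character modulo a prime. -/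
noncomputable def qchar (q : ℕ) [Fact q.Prime] : DirichletCharacter ℂ q :=
  (quadraticChar (ZMod q)).ringHomComp (Int.castRingHom ℂ)

lemma qchar_sq (q : ℕ) [Fact q.Prime] : (qchar q)^2 = 1 :=
  ((quadraticChar_isQuadratic (ZMod q)).comp (Int.castRingHom ℂ)).sq_eq_one

lemma qchar_ne_one (q : ℕ) [Fact q.Prime] (hq : q ≠ 2) : qchar q ≠ 1 :=
  (MulChar.ringHomComp_ne_one_iff (RingHom.injective_int _)).mpr
    (quadraticChar_ne_one (by rwa [ZMod.ringChar_zmod_n]))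

lemma qchar_conductor (q : ℕ) [hf : Fact q.Prime] (hq : q ≠ 2) : (qchar q).conductor = q := by
  rcases (Nat.dvd_prime hf.out).mp (DirichletCharacter.conductor_dvd_level (qchar q)) with h | h
  · exact absurd (DirichletCharacter.eq_one_iff_conductor_eq_one.mpr h) (qchar_ne_one q hq)
  · exact h

lemma pair_char {q₁ q₂ y : ℕ} (h₁ : q₁.Prime) (h₂ : q₂.Prime) (hne : q₁ ≠ q₂) (ho₁ : q₁ ≠ 2) (ho₂ : q₂ ≠ 2)
    (hmod : q₁ % 4 = q₂ % 4) (hy₁ : y < q₁) (hy₂ : y < q₂)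
    (hsq : ∀ p : ℕ, p.Prime → p ≤ y → (IsSquare (p : ZMod q₁) ↔ IsSquare (p : ZMod q₂))) :
    IsFundamentalDiscriminant (q₁ * q₂) ∧ ∃ χ : DirichletCharacter ℂ (q₁ * q₂), χ.IsPrimitive ∧
      MulChar.IsQuadratic χ ∧ χ ≠ 1 ∧ ∀ p : ℕ, p.Prime → p ≤ y → χ p = 1 := by
  have : Fact q₁.Prime := ⟨h₁⟩
  have : Fact q₂.Prime := ⟨h₂⟩
  have hcop : Nat.Coprime q₁ q₂ := (Nat.coprime_primes h₁ h₂).mpr hne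
  have : NeZero (q₁ * q₂) := ⟨Nat.mul_ne_zero h₁.ne_zero h₂.ne_zero⟩
  refine ⟨⟨Nat.mul_pos h₁.pos h₂.pos, Or.inl ⟨?_, ?_⟩⟩, ?_⟩
  · have o₁ := h₁.eq_two_or_odd.resolve_left ho₁
    have o₂ := h₂.eq_two_or_odd.resolve_left ho₂
    rw [Nat.mul_mod, hmod]
    have : q₂ % 4 = 1 ∨ q₂ % 4 = 3 := by omega
    rcases this with h | h <;> rw [h]
  · exact (Nat.squarefree_mul hcop).mpr ⟨h₁.squarefree, h₂.squarefree⟩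
  set ψ₁ := DirichletCharacter.changeLevel (Nat.dvd_mul_right q₁ q₂) (qchar q₁) with hψ₁
  set ψ₂ := DirichletCharacter.changeLevel (Nat.dvd_mul_left q₂ q₁) (qchar q₂) with hψ₂
  have s₁ : ψ₁^2 = 1 := by rw [hψ₁, ← map_pow, qchar_sq, map_one]
  have s₂ : ψ₂^2 = 1 := by rw [hψ₂, ← map_pow, qchar_sq, map_one]
  have c₁ : ψ₁.conductor = q₁ := by rw [hψ₁, DirichletCharacter.conductor_changeLevel, qchar_conductor q₁ ho₁]
  have c₂ : ψ₂.conductor = q₂ := by rw [hψ₂, DirichletCharacter.conductor_changeLevel, qchar_conductor q₂ ho₂]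
  have hprim : (ψ₁ * ψ₂).IsPrimitive := by
    rw [DirichletCharacter.isPrimitive_def]
    apply Nat.dvd_antisymm (DirichletCharacter.conductor_dvd_level _)
    apply Nat.Coprime.mul_dvd_of_dvd_of_dvd hcop
    · have e : ψ₁ = (ψ₁ * ψ₂) * ψ₂ := by rw [mul_assoc, ← sq, s₂, mul_one]
      have h := DirichletCharacter.conductor_mul_dvd_lcm_conductor (ψ₁ * ψ₂) ψ₂
      rw [← e, c₁, c₂] at h
      exact hcop.dvd_of_dvd_mul_right (h.trans (Nat.lcm_dvd_mul _ _))
    · have e : ψ₂ = (ψ₁ * ψ₂) * ψ₁ := by rw [mul_comm ψ₁, mul_assoc, ← sq, s₁, mul_one]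
      have h := DirichletCharacter.conductor_mul_dvd_lcm_conductor (ψ₁ * ψ₂) ψ₁
      rw [← e, c₁, c₂] at h
      exact hcop.symm.dvd_of_dvd_mul_right (h.trans (Nat.lcm_dvd_mul _ _))
  refine ⟨ψ₁ * ψ₂, hprim, ?_, ?_, ?_⟩
  · rw [MulChar.isQuadratic_iff_sq_eq_one, mul_pow, s₁, s₂, one_mul]
  · intro h
    rw [DirichletCharacter.isPrimitive_def, h, DirichletCharacter.conductor_one] at hprim
    exact h₁.ne_one (Nat.eq_one_of_mul_eq_one_right hprim.symm)
  · intro p hp hpy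
    have hp₁ : Nat.Coprime p q₁ := (Nat.coprime_primes hp h₁).mpr (by omega)
    have hp₂ : Nat.Coprime p q₂ := (Nat.coprime_primes hp h₂).mpr (by omega)
    have hc : IsCoprime (p : ℤ) ((q₁ * q₂ : ℕ) : ℤ) := Nat.isCoprime_iff_coprime.mpr (hp₁.mul_right hp₂)
    have v₁ : ψ₁ (p : ZMod (q₁ * q₂)) = qchar q₁ p := by
      have := DirichletCharacter.changeLevel_eq_cast_of_dvd' (qchar q₁) (Nat.dvd_mul_right q₁ q₂) hc
      simpa using this
    have v₂ : ψ₂ (p : ZMod (q₁ * q₂)) = qchar q₂ p := by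
      have := DirichletCharacter.changeLevel_eq_cast_of_dvd' (qchar q₂) (Nat.dvd_mul_left q₂ q₁) hc
      simpa using this
    have n₁ : (p : ZMod q₁) ≠ 0 := by
      rw [Ne, ZMod.natCast_eq_zero_iff]; exact fun h => by have := Nat.le_of_dvd hp.pos h; omega
    have n₂ : (p : ZMod q₂) ≠ 0 := by
      rw [Ne, ZMod.natCast_eq_zero_iff]; exact fun h => by have := Nat.le_of_dvd hp.pos h; omega
    rw [MulChar.mul_apply, v₁, v₂]
    simp only [qchar, MulChar.ringHomComp_apply]
    rw [← map_mul]
    have key : quadraticChar (ZMod q₁) p * quadraticChar (ZMod q₂) p = 1 := by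
      by_cases h : IsSquare (p : ZMod q₁)
      · rw [(quadraticChar_one_iff_isSquare n₁).mpr h, (quadraticChar_one_iff_isSquare n₂).mpr ((hsq p hp hpy).mp h), one_mul]
      · rw [quadraticChar_neg_one_iff_not_isSquare.mpr h,
          quadraticChar_neg_one_iff_not_isSquare.mpr (fun h' => h ((hsq p hp hpy).mpr h'))]
        norm_num
    rw [key, map_one]

end PartNoi

section PartNoj

open Filter

open Classical in
lemma pigeon {y N : ℕ} (h : y + 3 + 4 * 2^(y+1) < Nat.primeCounting N) :
    ∃ q₁ q₂ : ℕ, q₁.Prime ∧ q₂.Prime ∧ q₁ ≠ q₂ ∧ q₁ ≠ 2 ∧ q₂ ≠ 2 ∧ q₁ % 4 = q₂ % 4 ∧ y < q₁ ∧ y < q₂ ∧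
      q₁ ≤ N ∧ q₂ ≤ N ∧
      ∀ p : ℕ, p.Prime → p ≤ y → (IsSquare (p : ZMod q₁) ↔ IsSquare (p : ZMod q₂)) := by
  set A := (Finset.range (N+1)).filter Nat.Prime with hA
  have hAc : A.card = Nat.primeCounting N := by
    rw [hA, Nat.primeCounting, Nat.primeCounting', Nat.count_eq_card_filter_range]
  set S := A \ Finset.range (y+3) with hS
  have hSc : 4 * 2^(y+1) < S.card := by
    have := Finset.le_card_sdiff (Finset.range (y+3)) A
    rw [Finset.card_range, hAc, ← hS] at this
    omega
  set T := (Finset.range 4) ×ˢ (Finset.range (y+1)).powerset with hT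
  have hTc : T.card = 4 * 2^(y+1) := by
    rw [hT, Finset.card_product, Finset.card_powerset, Finset.card_range, Finset.card_range]
  let f : ℕ → ℕ × Finset ℕ := fun q => (q % 4, (Finset.range (y+1)).filter (fun p => IsSquare (p : ZMod q)))
  obtain ⟨q₁, m₁, q₂, m₂, hne, hf⟩ := Finset.exists_ne_map_eq_of_card_lt_of_maps_to (s := S) (t := T) (f := f)
    (by rw [hTc]; exact hSc) (by
      intro q hq
      simp only [hT, f, Finset.coe_product, Set.mem_prod, Finset.mem_coe, Finset.mem_range, Finset.mem_powerset]
      exact ⟨Nat.mod_lt _ (by norm_num), Finset.filter_subset _ _⟩)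
  simp only [hS, hA, Finset.mem_sdiff, Finset.mem_filter, Finset.mem_range] at m₁ m₂
  simp only [f, Prod.mk.injEq] at hf
  refine ⟨q₁, q₂, m₁.1.2, m₂.1.2, hne, by omega, by omega, hf.1, by omega, by omega, by omega, by omega, ?_⟩
  intro p hp hpy
  have := Finset.ext_iff.mp hf.2 p
  simp only [Finset.mem_filter, Finset.mem_range] at this
  have hlt : p < y + 1 := by omega
  simpa [hlt] using this

lemma pi_ge_sqrt : ∀ᶠ n : ℕ in atTop, Real.sqrt n ≤ Nat.primeCounting n := by
  have h1 := (isLittleO_log_rpow_atTop (r := 1/2) (by norm_num)).bound (c := 1/10) (by norm_num)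
  have h2 := tendsto_natCast_atTop_atTop (R := ℝ) |>.eventually h1
  have h3 := (tendsto_natCast_atTop_atTop (R := ℝ)).comp (tendsto_add_atTop_nat 1) |>.eventually h1
  filter_upwards [h2, h3, eventually_ge_atTop 2] with n h2 h3 hn
  have hn' : (2:ℝ) ≤ n := by exact_mod_cast hn
  simp only [Function.comp] at h3
  rw [← Real.sqrt_eq_rpow, Real.norm_eq_abs, Real.norm_eq_abs, abs_of_nonneg (Real.sqrt_nonneg _)] at h2 h3
  have hl := Real.log_pos (by linarith : (1:ℝ) < n)
  refine le_trans ?_ (Chebyshev.pi_ge n)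
  rw [le_div_iff₀ hl]
  have a1 : Real.log n ≤ 1/10 * Real.sqrt n := (le_abs_self _).trans h2
  have a2 : Real.log (n+1) ≤ 1/10 * Real.sqrt (n+1) := by
    push_cast at h3; exact (le_abs_self _).trans h3
  have a3 : Real.sqrt (n+1) ≤ n + 1 := by
    rw [Real.sqrt_le_left (by linarith)]; nlinarith
  have a4 : Real.sqrt n * Real.sqrt n = n := Real.mul_self_sqrt (by linarith)
  have a5 := Real.log_two_gt_d9
  nlinarith [Real.sqrt_nonneg (n:ℝ)]

lemma exists_good : ∀ᶠ x : ℝ in atTop, ∃ d : ℕ, 0 < d ∧ (d:ℝ) ≤ x ∧ IsFundamentalDiscriminant d ∧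
    ∃ χ : DirichletCharacter ℂ d, χ.IsPrimitive ∧ MulChar.IsQuadratic χ ∧ χ ≠ 1 ∧
      ∀ p : ℕ, p.Prime → (p:ℝ) ≤ Real.sqrt (Real.log x) → χ p = 1 := by
  have hN : Tendsto (fun x : ℝ => ⌊Real.sqrt x⌋₊) atTop atTop :=
    tendsto_nat_floor_atTop.comp Real.tendsto_sqrt_atTop
  have hu : Tendsto (fun x : ℝ => Real.sqrt (Real.log x)) atTop atTop :=
    Real.tendsto_sqrt_atTop.comp Real.tendsto_log_atTop
  filter_upwards [hN.eventually pi_ge_sqrt, hu.eventually_ge_atTop 20, eventually_ge_atTop 4] with x hx hu20 hx4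
  set u := Real.sqrt (Real.log x) with hudef
  set N := ⌊Real.sqrt x⌋₊ with hNdef
  have hlog : 0 ≤ Real.log x := Real.log_nonneg (by linarith)
  have hu2 : u^2 = Real.log x := Real.sq_sqrt hlog
  have hxe : x = Real.exp (u^2) := by rw [hu2, Real.exp_log (by linarith)]
  have hsx : Real.sqrt x = Real.exp (u^2/2) := by
    rw [hxe, ← Real.exp_half]
  have hs2 : 2 ≤ Real.sqrt x := Real.le_sqrt_of_sq_le (by linarith)
  have hNge : Real.exp (u^2/2) / 4 ≤ N := by
    have := (Nat.lt_floor_add_one (Real.sqrt x)).le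
    rw [← hNdef] at this
    rw [← hsx]; linarith
  have hsN : Real.exp (u^2/4) / 2 ≤ Real.sqrt N := by
    apply Real.le_sqrt_of_sq_le
    refine le_trans (le_of_eq ?_) hNge
    rw [div_pow, ← Real.exp_nat_mul]
    norm_num
    ring_nf
  set y := ⌊u⌋₊ with hy
  have hyu : (y:ℝ) ≤ u := Nat.floor_le (by linarith)
  have hcount : y + 3 + 4 * 2^(y+1) < Nat.primeCounting N := by
    have h2 : (2:ℝ)^y ≤ Real.exp u := by
      calc (2:ℝ)^y ≤ (Real.exp 1)^y := by
            gcongr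
            linarith [Real.add_one_le_exp (1:ℝ)]
        _ = Real.exp y := by rw [← Real.exp_nat_mul, mul_one]
        _ ≤ _ := Real.exp_le_exp.mpr hyu
    have h3 : u + 1 ≤ Real.exp u := Real.add_one_le_exp u
    have h4 : 24 * Real.exp u < Real.exp (u^2/4) := by
      have e1 : 24 < Real.exp (u^2/4 - u) := by
        have := Real.add_one_le_exp (u^2/4 - u)
        nlinarith
      have e2 : Real.exp (u^2/4) = Real.exp (u^2/4 - u) * Real.exp u := by rw [← Real.exp_add]; ring_nf
      rw [e2]
      exact mul_lt_mul_of_pos_right e1 (Real.exp_pos _)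
    have : (y:ℝ) + 3 + 4 * 2^(y+1) < Nat.primeCounting N := by
      refine lt_of_lt_of_le ?_ (hsN.trans hx)
      rw [pow_succ]
      linarith
    exact_mod_cast this
  obtain ⟨q₁, q₂, h₁, h₂, hne, ho₁, ho₂, hmod, hy₁, hy₂, hq₁, hq₂, hsq⟩ := pigeon hcount
  obtain ⟨hfd, χ, hp, hq, hχ, hv⟩ := pair_char h₁ h₂ hne ho₁ ho₂ hmod hy₁ hy₂ hsq
  refine ⟨q₁ * q₂, hfd.1, ?_, hfd, χ, hp, hq, hχ, fun p hpp hpu => hv p hpp (Nat.le_floor hpu)⟩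
  have hNx : (N:ℝ) ≤ Real.sqrt x := Nat.floor_le (Real.sqrt_nonneg _)
  have a1 : (q₁:ℝ) ≤ N := by exact_mod_cast hq₁
  have a2 : (q₂:ℝ) ≤ N := by exact_mod_cast hq₂
  push_cast
  calc (q₁:ℝ) * q₂ ≤ Real.sqrt x * Real.sqrt x := by gcongr <;> linarith
    _ = x := Real.mul_self_sqrt (by linarith)

end PartNoj

open Filter

lemma vM_primes {δ : ℝ} (hδ : 0 < δ) (hδ1 : δ ≤ 1) :
    Summable (fun p : Nat.Primes => ArithmeticFunction.vonMangoldt (p:ℕ) * ((p:ℕ):ℝ)^(-(1+δ))) ∧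
    ∑' p : Nat.Primes, ArithmeticFunction.vonMangoldt (p:ℕ) * ((p:ℕ):ℝ)^(-(1+δ)) ≤ 12 / δ := by
  have hs := vM_summable hδ
  have hle := vM_sum_le hδ hδ1
  refine ⟨hs.comp_injective (i := fun p : Nat.Primes => (p:ℕ)) Subtype.val_injective, ?_⟩
  refine le_trans ?_ hle
  exact tsum_comp_le_tsum_of_inj hs (fun n =>
      mul_nonneg ArithmeticFunction.vonMangoldt_nonneg (Real.rpow_nonneg (Nat.cast_nonneg _) _))
      (i := fun p : Nat.Primes => (p:ℕ)) Subtype.val_injective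

lemma PrimeS_lower {q : ℕ} (χ : DirichletCharacter ℂ q) {δ y : ℝ} (hδ : 0 < δ) (hδ1 : δ ≤ 1) (hy : 1 < y)
    (hχ : ∀ p : ℕ, p.Prime → (p:ℝ) ≤ y → χ p = 1) :
    PrimeS (1 : DirichletCharacter ℂ 1) (1+δ) - PrimeS χ (1+δ) ≤ 2 / Real.log y * (12 / δ) := by
  have hly := Real.log_pos hy
  have s1 := PrimeS_summable (1 : DirichletCharacter ℂ 1) (σ := 1+δ) (by linarith)
  have s2 := PrimeS_summable χ (σ := 1+δ) (by linarith)
  obtain ⟨s3, h3⟩ := vM_primes hδ hδ1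
  rw [PrimeS, PrimeS, ← s1.tsum_sub s2]
  refine ((s1.sub s2).tsum_le_tsum ?_ (s3.mul_left (2 / Real.log y))).trans ?_
  · intro p
    have h1 : (1 : DirichletCharacter ℂ 1) (p:ℕ) = 1 := MulChar.one_apply (isUnit_of_subsingleton _)
    have hpow : 0 ≤ ((p:ℕ):ℝ)^(-(1+δ)) := Real.rpow_nonneg (Nat.cast_nonneg _) _
    rw [h1, Complex.one_re, ArithmeticFunction.vonMangoldt_apply_prime p.2, ← sub_mul, ← mul_assoc]
    apply mul_le_mul_of_nonneg_right _ hpow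
    by_cases hp : ((p:ℕ):ℝ) ≤ y
    · rw [hχ p p.2 hp, Complex.one_re, sub_self]
      have := Real.log_natCast_nonneg (p:ℕ)
      positivity
    · push Not at hp
      have h2 := (abs_le.mp (re_char_le χ ((p:ℕ) : ZMod q))).1
      have h4 : Real.log y ≤ Real.log (p:ℕ) := Real.log_le_log (by linarith) hp.le
      have h5 : 2 ≤ 2 / Real.log y * Real.log (p:ℕ) := by
        rw [div_mul_eq_mul_div, le_div_iff₀ hly]; linarith
      linarith
  · rw [tsum_mul_left]
    exact mul_le_mul_of_nonneg_left h3 (div_nonneg zero_le_two hly.le)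

lemma lower_bound (hGRH : GRH) : ∃ K : ℝ, 0 < K ∧ ∀ᶠ x : ℝ in atTop,
    ∃ r ∈ {r : ℝ | ∃ d : ℕ, (d : ℝ) ≤ x ∧ IsFundamentalDiscriminant d ∧
            ∃ χ : DirichletCharacter ℂ d, χ.IsPrimitive ∧ MulChar.IsQuadratic χ ∧
              HasCurlyL χ r}, Real.log (Real.log (Real.log x)) - K ≤ r := by
  obtain ⟨C, hC, h⟩ := curlyL_near hGRH
  refine ⟨C + 3 + 48, by linarith, ?_⟩
  filter_upwards [tendsto_delta.eventually PrimeS_zeta, tendsto_delta.eventually (Ioc_mem_nhdsGT one_pos),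
    Real.tendsto_log_atTop.eventually_gt_atTop 1, eventually_gt_atTop 1, exists_good] with x hx1 hx2 hx3 hx4 hg
  obtain ⟨d, hd0, hdx, hfd, χ, hp, hq, hχ, hv⟩ := hg
  have : NeZero d := ⟨hd0.ne'⟩
  obtain ⟨r, hr⟩ := curlyL_exists χ hχ
  refine ⟨r, ⟨d, hdx, hfd, χ, hp, hq, hr⟩, ?_⟩
  have hlog : 0 < Real.log x := by linarith
  have h1 := h _ hx2.1 hx2.2 d χ hχ (by
    rw [one_div_one_div, Real.exp_log hlog]
    exact Real.log_le_log (by exact_mod_cast hd0) hdx) r hr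
  have h2 := PrimeS_lower χ hx2.1 hx2.2 (y := Real.sqrt (Real.log x))
    (by rw [Real.lt_sqrt (by norm_num)]; linarith) hv
  have hll : 0 < Real.log (Real.log x) := Real.log_pos hx3
  have e : 2 / Real.log (Real.sqrt (Real.log x)) * (12 / (1 / Real.log (Real.log x))) = 48 := by
    rw [Real.log_sqrt hlog.le]; field_simp; norm_num
  rw [e] at h2
  rw [one_div_one_div] at hx1
  rw [abs_le] at h1 hx1
  linarith [h1.1, hx1.1]

/-- assuming GRH, the maximum of `𝓛_{χ_d}` over fundamental discriminants
`d ≤ x` equals `log log log x + O(1)`. -/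
theorem statement_18 (hGRH : GRH) :
    ∃ K > (0:ℝ), ∀ᶠ x : ℝ in atTop,
      |sSup {r : ℝ | ∃ d : ℕ, (d : ℝ) ≤ x ∧ IsFundamentalDiscriminant d ∧
            ∃ χ : DirichletCharacter ℂ d, χ.IsPrimitive ∧ MulChar.IsQuadratic χ ∧
              HasCurlyL χ r} -
          Real.log (Real.log (Real.log x))| ≤ K := by
  obtain ⟨K₁, hK₁, h₁⟩ := upper_bound hGRH
  obtain ⟨K₂, hK₂, h₂⟩ := lower_bound hGRH
  refine ⟨K₁ + K₂, by linarith, ?_⟩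
  filter_upwards [h₁, h₂] with x hu hl
  obtain ⟨r, hr, hrl⟩ := hl
  have b : BddAbove {r : ℝ | ∃ d : ℕ, (d : ℝ) ≤ x ∧ IsFundamentalDiscriminant d ∧
            ∃ χ : DirichletCharacter ℂ d, χ.IsPrimitive ∧ MulChar.IsQuadratic χ ∧
              HasCurlyL χ r} := ⟨_, fun r hr => hu r hr⟩
  have l1 := le_csSup b hr
  have l2 : sSup {r : ℝ | ∃ d : ℕ, (d : ℝ) ≤ x ∧ IsFundamentalDiscriminant d ∧
            ∃ χ : DirichletCharacter ℂ d, χ.IsPrimitive ∧ MulChar.IsQuadratic χ ∧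
              HasCurlyL χ r} ≤ _ := csSup_le ⟨r, hr⟩ hu
  rw [abs_le]
  constructor <;> linarith
end

section
/- Assume the Generalized Riemann Hypothesis for Dirichlet L-functions. Then for any non-principal primitive Dirichlet character χ of modulus q one has |L(1, χ)| ≤ (2e^γ + o(1))·log log q as q → ∞, where γ is the Euler–Mascheroni constant. -/
open Filter

namespace Litt
open ArithmeticFunction Finset

lemma sum_vM_floor (N : ℕ) :
    ∑ n ∈ Ioc 0 N, vonMangoldt n * ((N / n : ℕ) : ℝ) = ∑ n ∈ Ioc 0 N, Real.log n := by
  rw [← sum_Ioc_mul_zeta_eq_sum, vonMangoldt_mul_zeta]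
  simp [ArithmeticFunction.log_apply]

lemma sum_log_le (N : ℕ) : ∑ n ∈ Ioc 0 N, Real.log n ≤ N * Real.log N := by
  calc ∑ n ∈ Ioc 0 N, Real.log n ≤ ∑ n ∈ Ioc 0 N, Real.log N := by
        apply Finset.sum_le_sum
        intro n hn
        rw [Finset.mem_Ioc] at hn
        apply Real.log_le_log (by exact_mod_cast hn.1) (by exact_mod_cast hn.2)
    _ = _ := by simp

lemma sum_log_ge (N : ℕ) : N * Real.log N - N ≤ ∑ n ∈ Ioc 0 N, Real.log n := by
  induction N with
  | zero => simp
  | succ N ih =>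
    rw [← Finset.insert_Ioc_right_eq_Ioc_add_one (by omega), Finset.sum_insert (by simp)]
    rcases Nat.eq_zero_or_pos N with h | h
    · subst h; simp
    have hN : (0:ℝ) < N := by exact_mod_cast h
    have : Real.log (N+1) - Real.log N ≤ 1 / N := by
      rw [← Real.log_div (by positivity) (by positivity)]
      have := Real.log_le_sub_one_of_pos (show (0:ℝ) < (N+1)/N by positivity)
      have e : ((N:ℝ)+1)/N - 1 = 1/N := by field_simp; ring
      linarith
    have h2 : N * (Real.log (N+1) - Real.log N) ≤ 1 := by
      calc _ ≤ N * (1/N:ℝ) := by gcongr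
        _ = 1 := by field_simp
    push_cast
    nlinarith

/-- Mertens first theorem. -/
lemma mertens1_lower (N : ℕ) (hN : 1 ≤ N) :
    Real.log N - 1 ≤ ∑ n ∈ Ioc 0 N, vonMangoldt n / n := by
  have h0 : (0:ℝ) < N := by exact_mod_cast hN
  have h1 : ∑ n ∈ Ioc 0 N, Real.log n ≤ N * ∑ n ∈ Ioc 0 N, vonMangoldt n / n := by
    rw [← sum_vM_floor, Finset.mul_sum]
    apply Finset.sum_le_sum
    intro n hn
    have : ((N / n : ℕ) : ℝ) ≤ N / n := Nat.cast_div_le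
    calc _ ≤ vonMangoldt n * (N / n : ℝ) := by
          gcongr
      _ = _ := by ring
  have h2 := sum_log_ge N
  have : N * (Real.log N - 1) ≤ N * ∑ n ∈ Ioc 0 N, vonMangoldt n / n := by linarith
  exact le_of_mul_le_mul_left this h0

lemma psi_nat (N : ℕ) : ∑ n ∈ Ioc 0 N, vonMangoldt n ≤ 6 * N := by
  have := Chebyshev.psi_le_const_mul_self (x := N) (by positivity)
  simp only [Chebyshev.psi, Nat.floor_natCast] at this
  have h4 : Real.log 4 ≤ 2 := by
    have : Real.log 4 = 2 * Real.log 2 := by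
      rw [show (4:ℝ) = 2^2 by norm_num, Real.log_pow]; norm_num
    have := Real.log_two_lt_d9
    linarith
  refine this.trans ?_
  gcongr
  linarith

lemma mertens1_upper (N : ℕ) (hN : 1 ≤ N) :
    ∑ n ∈ Ioc 0 N, vonMangoldt n / n ≤ Real.log N + 6 := by
  have h0 : (0:ℝ) < N := by exact_mod_cast hN
  have h1 : N * ∑ n ∈ Ioc 0 N, vonMangoldt n / n ≤
      ∑ n ∈ Ioc 0 N, Real.log n + ∑ n ∈ Ioc 0 N, vonMangoldt n := by
    rw [← sum_vM_floor, Finset.mul_sum, ← Finset.sum_add_distrib]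
    apply Finset.sum_le_sum
    intro n hn
    have : (N / n : ℝ) ≤ ((N / n : ℕ) : ℝ) + 1 := by
      rw [← Nat.floor_div_eq_div (K := ℝ)]
      exact (Nat.lt_floor_add_one _).le
    calc _ = vonMangoldt n * (N / n : ℝ) := by ring
      _ ≤ vonMangoldt n * (((N / n : ℕ) : ℝ) + 1) := by
          gcongr
      _ = _ := by ring
  have h2 := sum_log_le N
  have h3 := psi_nat N
  have : N * ∑ n ∈ Ioc 0 N, vonMangoldt n / n ≤ N * (Real.log N + 6) := by linarith
  exact le_of_mul_le_mul_left this h0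

/-- coefficient Λ(n)/(n log n) -/
noncomputable def av (n : ℕ) : ℝ := vonMangoldt n / (n * Real.log n)

noncomputable def Fv (N : ℕ) : ℝ := ∑ n ∈ range (N+1), av n

lemma av_nonneg (n : ℕ) : 0 ≤ av n := by
  unfold av
  have : 0 ≤ Real.log n := Real.log_natCast_nonneg n
  have := vonMangoldt_nonneg (n := n)
  positivity

lemma av_zero : av 0 = 0 := by simp [av]
lemma av_one : av 1 = 0 := by simp [av]

lemma sum_w_upper (n : ℕ) :
    ∑ i ∈ range n, Real.log (i+2) * (Real.log (Real.log (i+3)) - Real.log (Real.log (i+2)))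
      ≤ Real.log (n+2) - Real.log 2 := by
  induction n with
  | zero => simp
  | succ n ih =>
    rw [Finset.sum_range_succ]
    have ha : 0 < Real.log ((n:ℝ)+2) := Real.log_pos (by linarith [n.cast_nonneg (α := ℝ)])
    have hb : 0 < Real.log ((n:ℝ)+3) := Real.log_pos (by linarith [n.cast_nonneg (α := ℝ)])
    have h := Real.log_le_sub_one_of_pos (div_pos hb ha)
    rw [Real.log_div hb.ne' ha.ne'] at h
    have : Real.log ((n:ℝ)+2) * (Real.log (Real.log (n+3)) - Real.log (Real.log (n+2))) ≤
       Real.log ((n:ℝ)+3) - Real.log (n+2) := by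
      calc _ ≤ Real.log ((n:ℝ)+2) * (Real.log ((n:ℝ)+3) / Real.log ((n:ℝ)+2) - 1) := by gcongr
        _ = _ := by field_simp
    push_cast
    rw [show (n:ℝ)+1+2 = n+3 by ring]
    linarith

lemma log_three_ge : (1:ℝ) ≤ Real.log 3 := by
  rw [Real.le_log_iff_exp_le (by norm_num)]
  have := Real.exp_one_lt_d9
  linarith

lemma sum_w_lower (n : ℕ) : Real.log (n+2) - Real.log 2 - 1 + 1/((n:ℝ)+1) ≤
    ∑ i ∈ range n, Real.log (i+2) * (Real.log (Real.log (i+3)) - Real.log (Real.log (i+2))) := by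
  induction n with
  | zero => simp
  | succ n ih =>
    rw [Finset.sum_range_succ]
    have hn : (0:ℝ) ≤ n := n.cast_nonneg
    have ha : 0 < Real.log ((n:ℝ)+2) := Real.log_pos (by linarith)
    have hb : 1 ≤ Real.log ((n:ℝ)+3) := log_three_ge.trans (Real.log_le_log (by norm_num) (by linarith))
    have hb' : 0 < Real.log ((n:ℝ)+3) := by linarith
    have h := Real.log_le_sub_one_of_pos (div_pos ha hb')
    rw [Real.log_div ha.ne' hb'.ne'] at h
    have h1 : Real.log ((n:ℝ)+3) - Real.log (n+2) ≤ 1 / ((n:ℝ)+2) := by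
      rw [← Real.log_div (by positivity) (by positivity)]
      have := Real.log_le_sub_one_of_pos (show (0:ℝ) < (n+3)/(n+2) by positivity)
      have e : ((n:ℝ)+3)/(n+2) - 1 = 1/((n:ℝ)+2) := by field_simp; ring
      linarith
    have h10 : 0 ≤ Real.log ((n:ℝ)+3) - Real.log (n+2) := by
      have := Real.log_le_log (show (0:ℝ) < n+2 by linarith) (show (n:ℝ)+2 ≤ n+3 by linarith)
      linarith
    have h2 : (Real.log ((n:ℝ)+3) - Real.log (n+2)) - (1 / ((n:ℝ)+2))^2 ≤
      Real.log ((n:ℝ)+2) * (Real.log (Real.log (n+3)) - Real.log (Real.log (n+2))) := by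
      set a := Real.log ((n:ℝ)+2)
      set b := Real.log ((n:ℝ)+3)
      calc (b - a) - (1 / ((n:ℝ)+2))^2 ≤ (b-a) - (b-a)^2 := by gcongr
        _ ≤ (b-a) - (b-a)^2 / b := by
            have : (b-a)^2/b ≤ (b-a)^2 := div_le_self (by positivity) hb
            linarith
        _ = a * (1 - a/b) := by field_simp; ring
        _ ≤ _ := mul_le_mul_of_nonneg_left (by linarith) ha.le
    have h3 : (1 / ((n:ℝ)+2))^2 ≤ 1/((n:ℝ)+1) - 1/((n:ℝ)+2) := by
      rw [div_sub_div _ _ (by positivity) (by positivity), div_pow, div_le_div_iff₀ (by positivity) (by positivity)]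
      nlinarith
    push_cast
    rw [show (n:ℝ)+1+2 = n+3 by ring, show (n:ℝ)+1+1 = n+2 by ring]
    linarith

lemma sum_shift (f : ℕ → ℝ) (h1 : f 1 = 0) (n : ℕ) :
    ∑ i ∈ range n, f (i+2) = ∑ k ∈ Ioc 0 (n+1), f k := by
  induction n with
  | zero => simp [h1]
  | succ n ih =>
    rw [Finset.sum_range_succ, ih, ← Finset.insert_Ioc_right_eq_Ioc_add_one (b := n+1) (by omega),
      Finset.sum_insert (by simp), add_comm]
    rfl

lemma sum_range_Ioc (f : ℕ → ℝ) (h0 : f 0 = 0) (n : ℕ) :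
    ∑ i ∈ range (n+1), f i = ∑ k ∈ Ioc 0 n, f k := by
  induction n with
  | zero => simp [h0]
  | succ n ih =>
    rw [Finset.sum_range_succ, ih, ← Finset.insert_Ioc_right_eq_Ioc_add_one (b := n) (by omega),
      Finset.sum_insert (by simp), add_comm]

lemma exists_lim : ∃ c : ℝ, Tendsto (fun N : ℕ => Fv N - Real.log (Real.log (N+1))) atTop (nhds c) := by
  have key : CauchySeq (fun n : ℕ => ∑ i ∈ range n, (1 / Real.log ((i:ℝ)+2)) •
      (vonMangoldt (i+2) / ((i+2 : ℕ) : ℝ) -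
      Real.log (i+2) * (Real.log (Real.log (i+3)) - Real.log (Real.log (i+2))))) := by
    apply Antitone.cauchySeq_series_mul_of_tendsto_zero_of_bounded (b := 10)
    · intro i j hij
      have : (i:ℝ) ≤ j := by exact_mod_cast hij
      have hi : (0:ℝ) ≤ i := i.cast_nonneg
      apply one_div_le_one_div_of_le
      · exact Real.log_pos (by linarith)
      · apply Real.log_le_log <;> linarith
    · have : Tendsto (fun i : ℕ => Real.log ((i:ℝ)+2)) atTop atTop :=
        Real.tendsto_log_atTop.comp (tendsto_atTop_add_const_right _ _ tendsto_natCast_atTop_atTop)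
      simp only [one_div]
      exact this.inv_tendsto_atTop
    · intro n
      rw [Finset.sum_sub_distrib, sum_shift (fun k => vonMangoldt k / (k:ℝ)) (by simp)]
      have h1 := mertens1_lower (n+1) (by omega)
      have h2 := mertens1_upper (n+1) (by omega)
      have h3 := sum_w_lower n
      have h4 := sum_w_upper n
      have hl2 := Real.log_two_lt_d9
      have hl2' := Real.log_two_gt_d9
      have hn : (0:ℝ) ≤ n := n.cast_nonneg
      have h5 : Real.log ((n+1 : ℕ) : ℝ) ≤ Real.log ((n:ℝ)+2) := by
        apply Real.log_le_log <;> push_cast <;> linarith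
      have h6 : Real.log ((n:ℝ)+2) ≤ Real.log ((n+1 : ℕ) : ℝ) + Real.log 2 := by
        rw [← Real.log_mul (by positivity) (by positivity)]
        apply Real.log_le_log <;> push_cast <;> linarith
      have h7 : 0 ≤ 1/((n:ℝ)+1) := by positivity
      rw [Real.norm_eq_abs, abs_le]
      constructor <;> linarith
  obtain ⟨c, hc⟩ := cauchySeq_tendsto_of_complete key
  refine ⟨c - Real.log (Real.log 2), ?_⟩
  rw [← tendsto_add_atTop_iff_nat 1]
  refine (hc.sub_const (Real.log (Real.log 2))).congr ?_
  intro n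
  have e1 : ∀ i : ℕ, (1 / Real.log ((i:ℝ)+2)) •
      (vonMangoldt (i+2) / ((i+2 : ℕ) : ℝ) -
      Real.log (i+2) * (Real.log (Real.log (i+3)) - Real.log (Real.log (i+2))))
      = av (i+2) - (Real.log (Real.log ((i+1:ℕ)+2)) - Real.log (Real.log (i+2))) := by
    intro i
    have hi : (0:ℝ) ≤ i := i.cast_nonneg
    have : 0 < Real.log ((i:ℝ)+2) := Real.log_pos (by linarith)
    unfold av
    push_cast
    rw [smul_eq_mul, show (i:ℝ)+1+2 = i + 3 by ring]
    field_simp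
  rw [Finset.sum_congr rfl (fun i _ => e1 i), Finset.sum_sub_distrib,
    Finset.sum_range_sub (fun i : ℕ => Real.log (Real.log ((i:ℝ)+2))), sum_shift av av_one]
  unfold Fv
  rw [sum_range_Ioc av av_zero]
  push_cast
  rw [show (n:ℝ)+1+1 = n+2 by ring]
  simp
  ring

end Litt


namespace Litt
open ArithmeticFunction Finset MeasureTheory

lemma av_le (n : ℕ) : av n ≤ 1 / n := by
  unfold av
  rcases Nat.lt_or_ge n 2 with h | h
  · interval_cases n <;> simp
  have h1 : (1:ℝ) < n := by exact_mod_cast h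
  have h2 := Real.log_pos h1
  have h3 := vonMangoldt_le_log (n := n)
  rw [div_le_div_iff₀ (by positivity) (by positivity)]
  nlinarith

lemma summable_av {δ : ℝ} (hδ : 0 < δ) : Summable (fun n : ℕ => av n * Real.exp (-(δ * Real.log n))) := by
  have h := Real.summable_one_div_nat_rpow.mpr (show 1 < 1 + δ by linarith)
  refine Summable.of_nonneg_of_le (fun n => mul_nonneg (av_nonneg n) (Real.exp_pos _).le) ?_ h
  intro n
  rcases Nat.eq_zero_or_pos n with h0 | h0
  · subst h0
    rw [av_zero]; simp; positivity
  have h1 : (0:ℝ) < n := by exact_mod_cast h0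
  rw [Real.rpow_def_of_pos h1, one_div, ← Real.exp_neg]
  calc av n * Real.exp (-(δ * Real.log n)) ≤ (1/n) * Real.exp (-(δ * Real.log n)) := by
        gcongr; exact av_le n
    _ = Real.exp (-Real.log n) * Real.exp (-(δ * Real.log n)) := by
        rw [Real.exp_neg (Real.log n), Real.exp_log h1, one_div]
    _ = _ := by rw [← Real.exp_add]; congr 1; ring

lemma logzeta {δ : ℝ} (hδ : 0 < δ) : Real.log (riemannZeta ((1 + δ : ℝ) : ℂ)).re =
    ∑' n : ℕ, av n * Real.exp (-(δ * Real.log n)) := by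
  rw [log_riemannZeta_eq (by linarith)]
  congr 1
  ext n
  rcases Nat.eq_zero_or_pos n with h0 | h0
  · subst h0
    simp [av_zero]
  have h1 : (0:ℝ) < n := by exact_mod_cast h0
  unfold av
  rw [Real.rpow_add h1, Real.rpow_one, Real.rpow_def_of_pos h1, Real.exp_neg]
  have := Real.exp_pos (Real.log n * δ)
  rw [mul_comm δ]
  rw [div_mul_eq_mul_div, ← div_eq_mul_inv, div_div]
  congr 1; ring

lemma exp_int (c : ℝ) : IntegrableOn (fun v : ℝ => Real.exp (-v)) (Set.Ioi c) :=
  integrableOn_exp_neg_Ioi c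

lemma laplace {δ : ℝ} (hδ : 0 < δ) :
    ∑' n : ℕ, av n * Real.exp (-(δ * Real.log n)) =
     ∫ v in Set.Ioi (0:ℝ), Fv ⌊Real.exp (v/δ)⌋₊ * Real.exp (-v) := by
  set G : ℕ → ℝ → ℝ := fun n v => av n * (Set.Ici (δ * Real.log n)).indicator (fun v => Real.exp (-v)) v
  have hnn : ∀ n : ℕ, 0 ≤ δ * Real.log n := fun n => mul_nonneg hδ.le (Real.log_natCast_nonneg n)
  have hGnn : ∀ n v, 0 ≤ G n v := fun n v => mul_nonneg (av_nonneg n)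
    (Set.indicator_nonneg (fun _ _ => (Real.exp_pos _).le) _)
  have hInteg : ∀ n, Integrable (G n) (volume.restrict (Set.Ioi 0)) := by
    intro n
    apply Integrable.const_mul
    exact (exp_int 0).integrable.indicator measurableSet_Ici
  have hval : ∀ n, ∫ v in Set.Ioi (0:ℝ), G n v = av n * Real.exp (-(δ * Real.log n)) := by
    intro n
    simp only [G]
    rw [integral_const_mul]
    by_cases hn : av n = 0
    · simp [hn]
    congr 1
    rw [setIntegral_indicator measurableSet_Ici, ← integral_exp_neg_Ioi]
    rw [← integral_Ici_eq_integral_Ioi]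
    congr 2
    apply Set.inter_eq_right.mpr
    intro v hv
    have h2 : 2 ≤ n := by
      by_contra h
      push Not at h
      interval_cases n
      · exact hn av_zero
      · exact hn av_one
    have : 0 < δ * Real.log n := mul_pos hδ (Real.log_pos (by exact_mod_cast h2))
    exact lt_of_lt_of_le this hv
  have hs := hasSum_integral_of_summable_integral_norm hInteg (by
    have : (fun n => ∫ v in Set.Ioi (0:ℝ), ‖G n v‖) = fun n : ℕ => av n * Real.exp (-(δ * Real.log n)) := by
      ext n
      rw [← hval n]
      congr 1
      ext v
      exact Real.norm_of_nonneg (hGnn n v)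
    rw [this]
    exact summable_av hδ)
  simp only [hval] at hs
  rw [hs.tsum_eq]
  apply setIntegral_congr_fun measurableSet_Ioi
  intro v hv
  simp only
  rw [tsum_eq_sum (s := range (⌊Real.exp (v/δ)⌋₊+1))]
  · unfold Fv
    rw [Finset.sum_mul]
    apply Finset.sum_congr rfl
    intro n hn
    simp only [G]
    by_cases hn0 : n = 0
    · subst hn0; simp [av_zero]
    congr 1
    apply Set.indicator_of_mem
    rw [Finset.mem_range, Nat.lt_succ_iff, Nat.le_floor_iff (Real.exp_pos _).le] at hn
    have h1 : (0:ℝ) < n := by exact_mod_cast Nat.pos_of_ne_zero hn0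
    have := (Real.log_le_iff_le_exp h1).mpr hn
    rw [Set.mem_Ici]
    rw [le_div_iff₀ hδ] at this
    linarith
  · intro n hn
    simp only [G]
    rw [Set.indicator_of_notMem, mul_zero]
    rw [Finset.mem_range, Nat.lt_succ_iff, Nat.le_floor_iff (Real.exp_pos _).le, not_le] at hn
    have := (Real.lt_log_iff_exp_lt ((Real.exp_pos _).trans hn)).mpr hn
    rw [Set.mem_Ici, not_le]
    rw [div_lt_iff₀ hδ] at this
    linarith

lemma log_exp_integrable_and :
    IntegrableOn (fun v : ℝ => Real.log v * Real.exp (-v)) (Set.Ioi 0) ∧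
    ∫ v in Set.Ioi (0:ℝ), Real.log v * Real.exp (-v) = - Real.eulerMascheroniConstant := by
  have h := mellin_hasDerivAt_of_isBigO_rpow (E := ℂ) (f := fun t : ℝ => (Real.exp (-t) : ℂ)) (s := 1)
    (a := 2) (b := 0) ?_ ?_ (by norm_num) ?_ (by norm_num)
  · obtain ⟨h1, h2⟩ := h
    have e : ∀ t ∈ Set.Ioi (0:ℝ), (t:ℂ) ^ ((1:ℂ)-1) • (Real.log t • (Real.exp (-t) : ℂ)) =
        ((Real.log t * Real.exp (-t) : ℝ) : ℂ) := by
      intro t ht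
      simp
    have h1' : IntegrableOn (fun t : ℝ => ((Real.log t * Real.exp (-t) : ℝ) : ℂ)) (Set.Ioi 0) := by
      refine IntegrableOn.congr_fun h1 ?_ measurableSet_Ioi
      intro t ht
      exact e t ht
    refine ⟨?_, ?_⟩
    · have := h1'.re
      exact this
    · have h3 : HasDerivAt Complex.Gamma (mellin (fun t => Real.log t • (Real.exp (-t) : ℂ)) 1) 1 := by
        rw [← Complex.GammaIntegral_eq_mellin] at h2
        refine h2.congr_of_eventuallyEq ?_
        have : {s : ℂ | 0 < s.re} ∈ nhds (1:ℂ) :=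
          (isOpen_lt continuous_const Complex.continuous_re).mem_nhds (by simp)
        filter_upwards [this] with s hs
        exact Complex.Gamma_eq_integral hs
      have h4 := h3.unique Complex.hasDerivAt_Gamma_one
      unfold mellin at h4
      rw [setIntegral_congr_fun measurableSet_Ioi e, integral_complex_ofReal] at h4
      exact_mod_cast h4
  · refine (Continuous.continuousOn ?_).locallyIntegrableOn measurableSet_Ioi
    exact Complex.continuous_ofReal.comp (Real.continuous_exp.comp continuous_neg)
  · rw [← Asymptotics.isBigO_norm_left]
    simp_rw [Complex.norm_real, Asymptotics.isBigO_norm_left]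
    simpa only [neg_one_mul] using (isLittleO_exp_neg_mul_rpow_atTop zero_lt_one _).isBigO
  · simp_rw [neg_zero, Real.rpow_zero]
    refine Asymptotics.isBigO_const_of_tendsto (?_ : Tendsto _ _ (nhds (1 : ℂ))) one_ne_zero
    rw [(by simp : (1 : ℂ) = Real.exp (-0))]
    exact (Complex.continuous_ofReal.comp (Real.continuous_exp.comp continuous_neg)).continuousWithinAt

/-- comparison of log log (⌊e^u⌋+1) and log u. -/
lemma loglog_floor {u : ℝ} (hu : 1 ≤ u) :
    0 ≤ Real.log (Real.log ((⌊Real.exp u⌋₊ : ℝ) + 1)) - Real.log u ∧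
    Real.log (Real.log ((⌊Real.exp u⌋₊ : ℝ) + 1)) - Real.log u ≤ 1 / u := by
  have h1 : Real.exp u ≤ (⌊Real.exp u⌋₊ : ℝ) + 1 := (Nat.lt_floor_add_one _).le
  have h2 : (⌊Real.exp u⌋₊ : ℝ) ≤ Real.exp u := Nat.floor_le (Real.exp_pos _).le
  have h3 : (⌊Real.exp u⌋₊ : ℝ) + 1 ≤ Real.exp (u + 1) := by
    have h5 : 1 ≤ Real.exp u := Real.one_le_exp (by linarith)
    have h6 : 2 ≤ Real.exp 1 := by have := Real.exp_one_gt_d9; linarith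
    rw [Real.exp_add]
    nlinarith
  have h4 : u ≤ Real.log ((⌊Real.exp u⌋₊ : ℝ) + 1) := by
    rw [Real.le_log_iff_exp_le (by positivity)]; exact h1
  have h5 : Real.log ((⌊Real.exp u⌋₊ : ℝ) + 1) ≤ u + 1 := by
    rw [Real.log_le_iff_le_exp (by positivity)]; exact h3
  have hu0 : 0 < u := by linarith
  constructor
  · have := Real.log_le_log hu0 h4
    linarith
  · have := Real.log_le_log (by linarith) h5
    have h6 := Real.log_le_sub_one_of_pos (show 0 < (u+1)/u by positivity)
    rw [Real.log_div (by positivity) (by positivity)] at h6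
    have e : (u+1)/u - 1 = 1/u := by field_simp; ring
    linarith

lemma phi_tendsto {c : ℝ}
    (hc : Tendsto (fun N : ℕ => Fv N - Real.log (Real.log (N+1))) atTop (nhds c)) :
    Tendsto (fun u : ℝ => Fv ⌊Real.exp u⌋₊ - Real.log u) atTop (nhds c) := by
  have h1 : Tendsto (fun u : ℝ => ⌊Real.exp u⌋₊) atTop atTop :=
    tendsto_nat_floor_atTop.comp Real.tendsto_exp_atTop
  have h2 := hc.comp h1
  have h3 : Tendsto (fun u : ℝ => Real.log (Real.log ((⌊Real.exp u⌋₊ : ℝ) + 1)) - Real.log u) atTop (nhds 0) := by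
    apply squeeze_zero' (g := fun u : ℝ => 1 / u)
    · filter_upwards [eventually_ge_atTop 1] with u hu using (loglog_floor hu).1
    · filter_upwards [eventually_ge_atTop 1] with u hu using (loglog_floor hu).2
    · simpa using tendsto_inv_atTop_zero (𝕜 := ℝ)
  have := h2.add h3
  rw [add_zero] at this
  refine this.congr ?_
  intro u
  simp only [Function.comp]
  ring

lemma Fv_mono : Monotone Fv := by
  intro a b hab
  unfold Fv
  apply Finset.sum_le_sum_of_subset_of_nonneg
  · apply Finset.range_mono; omega
  · intro i _ _; exact av_nonneg i

lemma Fv_nonneg (n : ℕ) : 0 ≤ Fv n := Finset.sum_nonneg fun i _ => av_nonneg i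

lemma phi_bound {c : ℝ}
    (hc : Tendsto (fun N : ℕ => Fv N - Real.log (Real.log (N+1))) atTop (nhds c)) :
    ∃ B : ℝ, 0 ≤ B ∧ (∀ u : ℝ, 1 ≤ u → |Fv ⌊Real.exp u⌋₊ - Real.log u| ≤ B) ∧
      (∀ u : ℝ, u ≤ 1 → |Fv ⌊Real.exp u⌋₊| ≤ B) := by
  obtain ⟨B, hB⟩ := (Metric.isBounded_range_of_tendsto _ hc).exists_norm_le
  have hB' : ∀ N : ℕ, |Fv N - Real.log (Real.log (N+1))| ≤ B := fun N => hB _ ⟨N, rfl⟩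
  have hB0 : 0 ≤ B := (abs_nonneg _).trans (hB' 0)
  refine ⟨B + 1 + Fv ⌊Real.exp 1⌋₊, ?_, ?_, ?_⟩
  · have := Fv_nonneg ⌊Real.exp 1⌋₊
    linarith
  · intro u hu
    have h1 := hB' ⌊Real.exp u⌋₊
    have h2 := loglog_floor hu
    have h3 : 1 / u ≤ 1 := by rw [div_le_one (by linarith)]; exact hu
    have h4 := Fv_nonneg ⌊Real.exp 1⌋₊
    rw [abs_le] at h1 ⊢
    constructor <;> linarith
  · intro u hu
    rw [abs_of_nonneg (Fv_nonneg _)]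
    have : Fv ⌊Real.exp u⌋₊ ≤ Fv ⌊Real.exp 1⌋₊ := by
      apply Fv_mono
      apply Nat.floor_mono
      exact Real.exp_le_exp.mpr hu
    linarith

lemma logzeta_tendsto :
    Tendsto (fun δ : ℝ => Real.log (riemannZeta ((1 + δ : ℝ) : ℂ)).re + Real.log δ)
      (nhdsWithin 0 (Set.Ioi 0)) (nhds 0) := by
  have h1 : Tendsto (fun δ : ℝ => ((1 + δ : ℝ) : ℂ)) (nhdsWithin 0 (Set.Ioi 0)) (nhdsWithin 1 {1}ᶜ) := by
    apply tendsto_nhdsWithin_of_tendsto_nhds_of_eventually_within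
    · have : Continuous (fun δ : ℝ => ((1 + δ : ℝ) : ℂ)) := by fun_prop
      have h := this.tendsto 0
      simp only [add_zero, Complex.ofReal_one] at h
      exact h.mono_left nhdsWithin_le_nhds
    · filter_upwards [self_mem_nhdsWithin] with δ hδ
      simp only [Set.mem_compl_iff, Set.mem_singleton_iff]
      intro h
      have : 1 + δ = 1 := by exact_mod_cast h
      have h' : 0 < δ := hδ
      linarith
  have h2 := riemannZeta_residue_one.comp h1
  have h3 := (Complex.continuous_re.tendsto _).comp h2
  have h4 := (Real.continuousAt_log (show (1:ℂ).re ≠ 0 by simp)).tendsto.comp h3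
  simp only [Complex.one_re, Real.log_one] at h4
  refine h4.congr' ?_
  have h5 : ∀ᶠ δ : ℝ in nhdsWithin 0 (Set.Ioi 0), 0 < ((Complex.re ∘ (fun s ↦ (s - 1) * riemannZeta s) ∘ fun δ : ℝ => ((1 + δ : ℝ) : ℂ)) δ) := by
    have := h3.eventually (lt_mem_nhds (show (0:ℝ) < (1:ℂ).re by simp))
    exact this
  filter_upwards [self_mem_nhdsWithin, h5] with δ hδ h5
  have hδ' : 0 < δ := hδ
  have e : (Complex.re ∘ (fun s ↦ (s - 1) * riemannZeta s) ∘ fun δ : ℝ => ((1 + δ : ℝ) : ℂ)) δ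
      = δ * (riemannZeta ((1 + δ : ℝ) : ℂ)).re := by
    simp only [Function.comp]
    rw [show (((1 + δ : ℝ) : ℂ) - 1) = ((δ:ℝ) : ℂ) by push_cast; ring, Complex.re_ofReal_mul]
  rw [e] at h5
  have h6 : 0 < (riemannZeta ((1 + δ : ℝ) : ℂ)).re := by
    by_contra hh
    push Not at hh
    nlinarith
  simp only [Function.comp] at e ⊢
  rw [e, Real.log_mul hδ'.ne' h6.ne']
  ring

/-- Mertens third theorem, in the form of sums over prime powers. -/
theorem mertens3 :
    Tendsto (fun u : ℝ => Fv ⌊Real.exp u⌋₊ - Real.log u) atTop (nhds Real.eulerMascheroniConstant) := by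
  obtain ⟨c, hc⟩ := exists_lim
  have hphi := phi_tendsto hc
  obtain ⟨B, hB0, hB1, hB2⟩ := phi_bound hc
  obtain ⟨hli, hlv⟩ := log_exp_integrable_and
  have hlim : Tendsto (fun δ : ℝ => ∫ v in Set.Ioi (0:ℝ), (Fv ⌊Real.exp (v/δ)⌋₊ + Real.log δ) * Real.exp (-v))
      (nhdsWithin 0 (Set.Ioi 0)) (nhds (∫ v in Set.Ioi (0:ℝ), (Real.log v + c) * Real.exp (-v))) := by
    apply tendsto_integral_filter_of_dominated_convergence (fun v => B * Real.exp (-v) + ‖Real.log v * Real.exp (-v)‖)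
    · filter_upwards with δ
      apply Measurable.aestronglyMeasurable
      apply Measurable.mul _ (by fun_prop)
      apply Measurable.add_const
      apply (measurable_of_countable Fv).comp
      apply Nat.measurable_floor.comp
      fun_prop
    · have : Set.Ioo (0:ℝ) 1 ∈ nhdsWithin (0:ℝ) (Set.Ioi 0) := Ioo_mem_nhdsGT (by norm_num)
      filter_upwards [this] with δ hδ
      rw [ae_restrict_iff' measurableSet_Ioi]
      filter_upwards with v hv
      have hv' : 0 < v := hv
      rw [norm_mul, norm_mul, Real.norm_of_nonneg (Real.exp_pos _).le, ← add_mul]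
      gcongr
      rw [Real.norm_eq_abs, Real.norm_eq_abs]
      rcases le_total 1 (v/δ) with h | h
      · have h1 := hB1 _ h
        have : Fv ⌊Real.exp (v/δ)⌋₊ + Real.log δ = (Fv ⌊Real.exp (v/δ)⌋₊ - Real.log (v/δ)) + Real.log v := by
          rw [Real.log_div hv'.ne' hδ.1.ne']; ring
        rw [this]
        exact (abs_add_le _ _).trans (by gcongr)
      · refine (abs_add_le _ _).trans (add_le_add (hB2 _ h) ?_)
        rw [div_le_one hδ.1] at h
        rw [abs_of_nonpos (Real.log_nonpos hδ.1.le hδ.2.le),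
          abs_of_nonpos (Real.log_nonpos hv'.le (h.trans hδ.2.le))]
        have := Real.log_le_log hv' h
        linarith
    · exact ((exp_int 0).integrable.const_mul B).add hli.integrable.norm
    · rw [ae_restrict_iff' measurableSet_Ioi]
      filter_upwards with v hv
      have hv' : 0 < v := hv
      apply Tendsto.mul_const
      have h1 : Tendsto (fun δ : ℝ => v / δ) (nhdsWithin 0 (Set.Ioi 0)) atTop := by
        simp only [div_eq_mul_inv]
        exact tendsto_inv_nhdsGT_zero.const_mul_atTop hv'
      have h2 := (hphi.comp h1).const_add (Real.log v)
      refine h2.congr' ?_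
      filter_upwards [self_mem_nhdsWithin] with δ hδ
      have hδ' : 0 < δ := hδ
      simp only [Function.comp]
      rw [Real.log_div hv'.ne' hδ'.ne']
      ring
  have hval : ∫ v in Set.Ioi (0:ℝ), (Real.log v + c) * Real.exp (-v) = c - Real.eulerMascheroniConstant := by
    simp only [add_mul]
    rw [integral_add hli.integrable ((exp_int 0).integrable.const_mul c), hlv, integral_const_mul,
      integral_exp_neg_Ioi_zero]
    ring
  have hlim2 : Tendsto (fun δ : ℝ => ∫ v in Set.Ioi (0:ℝ), (Fv ⌊Real.exp (v/δ)⌋₊ + Real.log δ) * Real.exp (-v))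
      (nhdsWithin 0 (Set.Ioi 0)) (nhds 0) := by
    refine logzeta_tendsto.congr' ?_
    have : Set.Ioo (0:ℝ) 1 ∈ nhdsWithin (0:ℝ) (Set.Ioi 0) := Ioo_mem_nhdsGT (by norm_num)
    filter_upwards [this] with δ hδ
    rw [logzeta hδ.1, laplace hδ.1]
    simp only [add_mul]
    rw [integral_add _ ((exp_int 0).integrable.const_mul _), integral_const_mul,
      integral_exp_neg_Ioi_zero, mul_one]
    have hb : Integrable (fun v => (B + |Real.log δ|) * Real.exp (-v) + ‖Real.log v * Real.exp (-v)‖) (volume.restrict (Set.Ioi (0:ℝ))) :=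
      ((exp_int 0).integrable.const_mul _).add hli.integrable.norm
    refine hb.mono' ?_ ?_
    · apply Measurable.aestronglyMeasurable
      apply Measurable.mul _ (by fun_prop)
      apply (measurable_of_countable Fv).comp
      apply Nat.measurable_floor.comp
      fun_prop
    · rw [ae_restrict_iff' measurableSet_Ioi]
      filter_upwards with v hv
      have hv' : 0 < v := hv
      rw [norm_mul, norm_mul, Real.norm_of_nonneg (Real.exp_pos _).le, ← add_mul]
      gcongr
      rw [Real.norm_eq_abs, Real.norm_eq_abs]
      rcases le_total 1 (v/δ) with h | h
      · have h1 := hB1 _ h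
        rw [Real.log_div hv'.ne' hδ.1.ne'] at h1
        have h2 := abs_add_le (Fv ⌊Real.exp (v/δ)⌋₊ - (Real.log v - Real.log δ)) (Real.log v - Real.log δ)
        have h3 := abs_sub (Real.log v) (Real.log δ)
        rw [sub_add_cancel] at h2
        linarith
      · have := hB2 _ h
        have := abs_nonneg (Real.log δ)
        have := abs_nonneg (Real.log v)
        linarith
  have := tendsto_nhds_unique hlim hlim2
  rw [hval] at this
  have : c = Real.eulerMascheroniConstant := by linarith
  rw [← this]
  exact hphi

end Litt

namespace Litt
open Finset MeasureTheory

lemma sum_char_period {q : ℕ} [NeZero q] {χ : DirichletCharacter ℂ q} (hχ : χ ≠ 1) :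
    ∑ k ∈ range q, χ (k : ZMod q) = 0 := by
  have h := MulChar.sum_eq_zero_of_ne_one hχ
  rw [← h]
  refine Finset.sum_bij (fun k _ => (k : ZMod q)) (fun _ _ => mem_univ _) ?_ ?_ (fun _ _ => rfl)
  · intro a ha b hb hab
    have := congrArg ZMod.val hab
    rwa [ZMod.val_cast_of_lt (mem_range.1 ha), ZMod.val_cast_of_lt (mem_range.1 hb)] at this
  · intro b _
    exact ⟨b.val, mem_range.2 (ZMod.val_lt b), by simp⟩

lemma sum_char_range {q : ℕ} [NeZero q] {χ : DirichletCharacter ℂ q} (hχ : χ ≠ 1) (n : ℕ) :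
    ‖∑ k ∈ range n, χ (k : ZMod q)‖ ≤ q := by
  induction n using Nat.strong_induction_on with
  | _ n ih =>
    rcases lt_or_ge n q with h | h
    · calc ‖∑ k ∈ range n, χ (k : ZMod q)‖ ≤ ∑ k ∈ range n, ‖χ (k : ZMod q)‖ := norm_sum_le _ _
        _ ≤ ∑ k ∈ range n, (1:ℝ) := sum_le_sum fun k _ => χ.norm_le_one _
        _ ≤ q := by simp; exact_mod_cast h.le
    · obtain ⟨m, rfl⟩ := Nat.exists_eq_add_of_le h
      rw [sum_range_add, sum_char_period hχ, zero_add]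
      have := ih m (by have := NeZero.pos q; omega)
      simpa using this

lemma sum_char_Icc {q : ℕ} [NeZero q] {χ : DirichletCharacter ℂ q} (hχ : χ ≠ 1) (n : ℕ) :
    ‖∑ k ∈ Icc 1 n, χ (k : ZMod q)‖ ≤ 2 * q := by
  have h : ∑ k ∈ Icc 1 n, χ (k : ZMod q) = ∑ k ∈ range (n+1), χ (k : ZMod q) - χ ((0:ℕ) : ZMod q) := by
    rw [Finset.sum_range_succ', add_sub_cancel_right, Finset.range_eq_Ico,
      Finset.sum_Ico_add' (fun k : ℕ => χ (k : ZMod q)) 0 n 1]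
    rfl
  rw [h]
  have h1 : (1:ℝ) ≤ q := by exact_mod_cast NeZero.pos q
  calc _ ≤ ‖∑ k ∈ range (n+1), χ (k : ZMod q)‖ + ‖χ ((0:ℕ) : ZMod q)‖ := norm_sub_le _ _
    _ ≤ q + 1 := add_le_add (sum_char_range hχ _) (χ.norm_le_one _)
    _ ≤ _ := by linarith

/-- indicator of the partial sums -/
noncomputable def PS {q : ℕ} (χ : DirichletCharacter ℂ q) (t : ℝ) : ℂ :=
  (Set.Ioi (1:ℝ)).indicator (fun t => ∑ k ∈ Icc 1 ⌊t⌋₊, χ (k : ZMod q)) t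

lemma PS_meas {q : ℕ} (χ : DirichletCharacter ℂ q) : Measurable (PS χ) := by
  refine Measurable.indicator ?_ measurableSet_Ioi
  exact (measurable_from_nat (f := fun n : ℕ => ∑ k ∈ Icc 1 n, χ (k : ZMod q))).comp
    Nat.measurable_floor

lemma PS_bound {q : ℕ} [NeZero q] {χ : DirichletCharacter ℂ q} (hχ : χ ≠ 1) (t : ℝ) :
    ‖PS χ t‖ ≤ 2 * q := by
  unfold PS
  refine (norm_indicator_le_norm_self _ _).trans (sum_char_Icc hχ _)

lemma mellin_PS {q : ℕ} (χ : DirichletCharacter ℂ q) (s : ℂ) :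
    mellin (PS χ) (-s) = ∫ t in Set.Ioi (1 : ℝ), (∑ k ∈ Icc 1 ⌊t⌋₊, χ (k : ZMod q)) * (t:ℂ) ^ (-(s + 1)) := by
  unfold mellin
  rw [← integral_indicator measurableSet_Ioi, ← integral_indicator measurableSet_Ioi]
  congr 1
  ext t
  by_cases h1 : 1 < t
  · have h0 : 0 < t := by linarith
    simp only [Set.indicator, Set.mem_Ioi, h1, h0, if_true, PS, smul_eq_mul]
    rw [mul_comm]; congr 2; ring
  · simp [Set.indicator, h1, PS]

lemma mellin_PS_diff {q : ℕ} [NeZero q] {χ : DirichletCharacter ℂ q} (hχ : χ ≠ 1) {s : ℂ}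
    (hs : s.re < 0) : DifferentiableAt ℂ (mellin (PS χ)) s := by
  refine mellin_differentiableAt_of_isBigO_rpow (a := 0) (b := s.re - 1) ?_ ?_ hs ?_ (by linarith)
  · refine LocallyIntegrable.locallyIntegrableOn ?_ _
    have : LocallyIntegrable (fun _ : ℝ => (2 * q : ℝ)) := locallyIntegrable_const _
    refine this.mono (PS_meas χ).aestronglyMeasurable (Eventually.of_forall fun t => ?_)
    refine (PS_bound hχ t).trans (le_abs_self _)
  · simp only [neg_zero, Real.rpow_zero]
    exact Asymptotics.IsBigO.of_bound (2*q) (Eventually.of_forall fun t => by simpa using PS_bound hχ t)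
  · refine Asymptotics.IsBigO.of_bound 0 ?_
    have : ∀ᶠ t : ℝ in nhdsWithin 0 (Set.Ioi 0), t < 1 :=
      eventually_nhdsWithin_of_eventually_nhds (eventually_lt_nhds one_pos)
    filter_upwards [this] with t ht
    simp [PS, Set.indicator, not_lt.2 ht.le]

lemma L_eq {q : ℕ} [NeZero q] {χ : DirichletCharacter ℂ q} (hχ : χ ≠ 1) {s : ℂ}
    (hs : 0 < s.re) : DirichletCharacter.LFunction χ s = s * mellin (PS χ) (-s) := by
  have hopen : IsOpen {s : ℂ | 0 < s.re} := isOpen_lt continuous_const Complex.continuous_re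
  have hf : AnalyticOnNhd ℂ (DirichletCharacter.LFunction χ) {s : ℂ | 0 < s.re} :=
    (DirichletCharacter.differentiable_LFunction hχ).differentiableOn.analyticOnNhd hopen
  have hg : AnalyticOnNhd ℂ (fun s => s * mellin (PS χ) (-s)) {s : ℂ | 0 < s.re} := by
    refine DifferentiableOn.analyticOnNhd (fun s hs => ?_) hopen
    refine DifferentiableAt.differentiableWithinAt ?_
    refine differentiableAt_id.mul ?_
    exact (mellin_PS_diff hχ (s := -s) (by simpa using hs)).comp s differentiableAt_id.neg
  have hc : IsPreconnected {s : ℂ | 0 < s.re} := (convex_halfSpace_re_gt 0).isPreconnected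
  refine hf.eqOn_of_preconnected_of_eventuallyEq hg hc (z₀ := 2) (by simp) ?_ hs
  have : {s : ℂ | 1 < s.re} ∈ nhds (2:ℂ) :=
    (isOpen_lt continuous_const Complex.continuous_re).mem_nhds (by simp)
  filter_upwards [this] with z hz
  rw [DirichletCharacter.LFunction_eq_LSeries χ hz, mellin_PS]
  refine LSeries_eq_mul_integral (fun n : ℕ => χ (n : ZMod q)) (r := 0) le_rfl
    (by have : 1 < z.re := hz; linarith) ?_ ?_
  · exact DirichletCharacter.LSeriesSummable_of_one_lt_re χ hz
  · refine Asymptotics.IsBigO.of_bound (2*q) (Eventually.of_forall fun n => ?_)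
    simpa using sum_char_Icc hχ n

lemma L_bound {q : ℕ} [NeZero q] {χ : DirichletCharacter ℂ q} (hχ : χ ≠ 1) {s : ℂ}
    (hs : 1/2 ≤ s.re) : ‖DirichletCharacter.LFunction χ s‖ ≤ 4 * q * ‖s‖ := by
  have h0 : 0 < s.re := by linarith
  rw [L_eq hχ h0, mellin_PS, norm_mul, mul_comm]
  refine mul_le_mul_of_nonneg_right ?_ (norm_nonneg _)
  have hInteg : IntegrableOn (fun t : ℝ => (2*q:ℝ) * t ^ (-(s.re+1))) (Set.Ioi 1) :=
    (integrableOn_Ioi_rpow_of_lt (by linarith) one_pos).const_mul _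
  calc _ ≤ ∫ t in Set.Ioi (1:ℝ), (2*q:ℝ) * t ^ (-(s.re+1)) := by
        refine norm_integral_le_of_norm_le hInteg ?_
        refine (ae_restrict_iff' measurableSet_Ioi).2 (Eventually.of_forall fun t ht => ?_)
        have ht0 : 0 < t := lt_trans one_pos ht
        rw [norm_mul, Complex.norm_cpow_eq_rpow_re_of_pos ht0]
        refine mul_le_mul (sum_char_Icc hχ _) (le_of_eq ?_) (by positivity) (by positivity)
        simp
    _ = 2*q / s.re := by
        rw [integral_const_mul, integral_Ioi_rpow_of_lt (by linarith) one_pos]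
        have : -(s.re+1)+1 = -s.re := by ring
        rw [this, Real.one_rpow, neg_div_neg_eq, mul_one_div]
    _ ≤ 4 * q := by
        rw [div_le_iff₀ h0]
        have : (0:ℝ) ≤ q := by positivity
        nlinarith

end Litt

namespace Litt
open Finset

lemma exists_holo_log {U : Set ℂ} (hU : IsOpen U) (hc : Convex ℝ U) (hne : U.Nonempty) {g : ℂ → ℂ}
    (hg : DifferentiableOn ℂ g U) (h0 : ∀ z ∈ U, g z ≠ 0) :
    ∃ f : ℂ → ℂ, DifferentiableOn ℂ f U ∧ ∀ z ∈ U, Complex.exp (f z) = g z := by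
  have hsc : IsSimplyConnected U := by
    have := hc.contractibleSpace hne
    unfold IsSimplyConnected
    infer_instance
  obtain ⟨f, hf, hfe⟩ := Complex.exists_continuousOn_eqOn_exp_comp hsc hU hg.continuousOn
    (by rintro ⟨z, hz, h⟩; exact h0 z hz h)
  have hfe' : ∀ z ∈ U, Complex.exp (f z) = g z := fun z hz => hfe hz
  refine ⟨f, fun a ha => ?_, hfe'⟩
  refine DifferentiableAt.differentiableWithinAt ?_
  have hga : g a ≠ 0 := h0 a ha
  have hUa := hU.mem_nhds ha
  have hgd : DifferentiableAt ℂ g a := hg.differentiableAt hUa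
  have hcont : ContinuousAt f a := hf.continuousAt hUa
  have hd : DifferentiableAt ℂ (fun z => f a + Complex.log (g z / g a)) a := by
    refine (differentiableAt_const _).add ?_
    refine DifferentiableAt.clog (hgd.div_const _) ?_
    rw [div_self hga]; exact Complex.one_mem_slitPlane
  refine hd.congr_of_eventuallyEq ?_
  have h1 : Tendsto (fun z => |(f z - f a).im|) (nhds a) (nhds 0) := by
    have : ContinuousAt (fun z => |(f z - f a).im|) a :=
      (Complex.continuous_im.continuousAt.comp (hcont.sub continuousAt_const)).abs
    have h := this.tendsto
    simpa using h
  filter_upwards [hUa, h1.eventually (eventually_lt_nhds Real.pi_pos)] with z hz hz1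
  rw [← hfe' z hz, ← hfe' a ha, ← Complex.exp_sub, Complex.log_exp (abs_lt.1 hz1).1 (abs_lt.1 hz1).2.le]
  ring

/-- Dirichlet coefficients of log L -/
noncomputable def ac {q : ℕ} (χ : DirichletCharacter ℂ q) (n : ℕ) : ℂ :=
  χ (n : ZMod q) * (ArithmeticFunction.vonMangoldt n : ℂ) / (Real.log n : ℂ)

lemma lamlog_le (n : ℕ) : ArithmeticFunction.vonMangoldt n / Real.log n ≤ 1 := by
  have h := ArithmeticFunction.vonMangoldt_le_log (n := n)
  exact div_le_one_of_le₀ h (Real.log_natCast_nonneg n)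

lemma ac_norm_le' {q : ℕ} (χ : DirichletCharacter ℂ q) (n : ℕ) :
    ‖ac χ n‖ ≤ ArithmeticFunction.vonMangoldt n / Real.log n := by
  unfold ac
  rw [norm_div, norm_mul, Complex.norm_real, Complex.norm_real,
    Real.norm_of_nonneg ArithmeticFunction.vonMangoldt_nonneg,
    Real.norm_of_nonneg (Real.log_natCast_nonneg n)]
  refine div_le_div_of_nonneg_right ?_ (Real.log_natCast_nonneg n)
  refine mul_le_of_le_one_left ArithmeticFunction.vonMangoldt_nonneg (χ.norm_le_one _)

lemma ac_norm_le {q : ℕ} (χ : DirichletCharacter ℂ q) (n : ℕ) : ‖ac χ n‖ ≤ 1 :=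
  (ac_norm_le' χ n).trans (lamlog_le n)

lemma ac_summable {q : ℕ} (χ : DirichletCharacter ℂ q) {s : ℂ} (hs : 1 < s.re) :
    LSeriesSummable (ac χ) s :=
  LSeriesSummable_of_bounded_of_one_lt_re (m := 1) (fun n _ => ac_norm_le χ n) hs

lemma ac_diff {q : ℕ} (χ : DirichletCharacter ℂ q) :
    DifferentiableOn ℂ (LSeries (ac χ)) {s | 1 < s.re} := by
  intro s hs
  refine DifferentiableAt.differentiableWithinAt ?_
  have h : LSeries.abscissaOfAbsConv (ac χ) ≤ 1 :=
    LSeries.abscissaOfAbsConv_le_of_le_const ⟨1, fun n _ => ac_norm_le χ n⟩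
  refine (LSeries_hasDerivAt (lt_of_le_of_lt h ?_)).differentiableAt
  exact_mod_cast hs

lemma exists_log {q : ℕ} [NeZero q] {χ : DirichletCharacter ℂ q} (hχ : χ ≠ 1)
    (hz : ∀ s : ℂ, 1/2 < s.re → DirichletCharacter.LFunction χ s ≠ 0) :
    ∃ l : ℂ → ℂ, DifferentiableOn ℂ l {s | 1/2 < s.re} ∧
      (∀ s : ℂ, 1/2 < s.re → Complex.exp (l s) = DirichletCharacter.LFunction χ s) ∧
      (∀ s : ℂ, 1 < s.re → l s = LSeries (ac χ) s) := by
  obtain ⟨f, hf, hfe⟩ := exists_holo_log (U := {s : ℂ | 1/2 < s.re})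
    (isOpen_lt continuous_const Complex.continuous_re) (convex_halfSpace_re_gt (1/2))
    ⟨1, by norm_num⟩
    (DirichletCharacter.differentiable_LFunction hχ).differentiableOn hz
  have hV : IsOpen {s : ℂ | 1 < s.re} := isOpen_lt continuous_const Complex.continuous_re
  have hVc : IsPreconnected {s : ℂ | 1 < s.re} := (convex_halfSpace_re_gt 1).isPreconnected
  have hexp : ∀ s : ℂ, 1 < s.re → Complex.exp (f s - LSeries (ac χ) s) = 1 := by
    intro s hs
    rw [Complex.exp_sub, hfe s (by simp only [Set.mem_ofPred_eq]; linarith)]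
    have := DirichletCharacter.LSeries_eq_exp_LSeries χ hs
    unfold ac
    rw [this, DirichletCharacter.LFunction_eq_LSeries χ hs, div_self]
    rw [← DirichletCharacter.LFunction_eq_LSeries χ hs]
    exact hz s (by linarith)
  have hd : DifferentiableOn ℂ (fun s => f s - LSeries (ac χ) s) {s : ℂ | 1 < s.re} := by
    refine DifferentiableOn.sub (hf.mono fun s hs => ?_) (ac_diff χ)
    have : 1 < s.re := hs
    simp only [Set.mem_ofPred_eq]; linarith
  have hder : Set.EqOn (deriv (fun s => f s - LSeries (ac χ) s)) 0 {s : ℂ | 1 < s.re} := by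
    intro s hs
    have h1 := (hd.differentiableAt (hV.mem_nhds hs)).hasDerivAt.cexp
    have h2 : HasDerivAt (fun s => Complex.exp (f s - LSeries (ac χ) s)) 0 s := by
      refine (hasDerivAt_const s (1:ℂ)).congr_of_eventuallyEq ?_
      filter_upwards [hV.mem_nhds hs] with z hz
      exact hexp z hz
    have h3 := h1.unique h2
    rcases mul_eq_zero.1 h3 with h | h
    · exact absurd h (Complex.exp_ne_zero _)
    · exact h
  have hcst : ∀ s : ℂ, 1 < s.re → f s - LSeries (ac χ) s = f 2 - LSeries (ac χ) 2 := by
    intro s hs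
    exact hV.is_const_of_deriv_eq_zero hVc hd hder hs (by simp)
  refine ⟨fun s => f s - (f 2 - LSeries (ac χ) 2), hf.sub_const _, ?_, ?_⟩
  · intro s hs
    rw [Complex.exp_sub, hexp 2 (by simp), div_one]
    exact hfe s hs
  · intro s hs
    have := hcst s hs
    rw [← this]; ring

lemma LS_norm_two {q : ℕ} (χ : DirichletCharacter ℂ q) {s : ℂ} (hs : s.re = 2) :
    ‖LSeries (ac χ) s‖ ≤ 2 := by
  have hb : ∀ n, ‖LSeries.term (ac χ) s n‖ ≤ 1 / (n:ℝ)^2 := by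
    intro n
    rw [LSeries.norm_term_eq]
    split_ifs with h
    · positivity
    · rw [hs]
      norm_cast
      exact div_le_div_of_nonneg_right (ac_norm_le χ n) (by positivity)
  have hsum : HasSum (fun n : ℕ => 1 / (n:ℝ)^2) (Real.pi^2/6) := hasSum_zeta_two
  have h := tsum_of_norm_bounded hsum hb
  refine h.trans ?_
  have := Real.pi_lt_d2
  have := Real.pi_pos
  nlinarith

lemma log_bound {q : ℕ} [NeZero q] {χ : DirichletCharacter ℂ q} (hχ : χ ≠ 1) (hq : 3 ≤ q)
    {l : ℂ → ℂ} (hl : DifferentiableOn ℂ l {s | 1/2 < s.re})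
    (hle : ∀ s : ℂ, 1/2 < s.re → Complex.exp (l s) = DirichletCharacter.LFunction χ s)
    (hls : ∀ s : ℂ, 1 < s.re → l s = LSeries (ac χ) s)
    {δ : ℝ} (hδ : 0 < δ) (hδ1 : δ ≤ 1/8) {s : ℂ} (hs1 : 1/2 + δ ≤ s.re) (hs2 : s.re ≤ 2) :
    ‖l s‖ ≤ 138 / δ * Real.log q * ‖s + 1‖ := by
  set c : ℂ := ⟨2, s.im⟩ with hc
  set R : ℝ := 3/2 - δ/2 with hR
  have hR0 : 0 < R := by rw [hR]; linarith
  have hq' : (3:ℝ) ≤ q := by exact_mod_cast hq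
  set M : ℝ := Real.log (4 * q * (4 + |s.im|)) with hM
  have habs := abs_nonneg s.im
  have hM0 : 0 < M := Real.log_pos (by nlinarith)
  have hin : ∀ z ∈ Metric.ball (0:ℂ) R, 1/2 < (c + z).re ∧ ‖c + z‖ ≤ 4 + |s.im| := by
    intro z hz
    have hz' : ‖z‖ < R := by simpa using hz
    have h1 := (abs_le.1 (Complex.abs_re_le_norm z)).1
    constructor
    · simp only [Complex.add_re, hc]
      rw [hR] at hz'; linarith
    · have h2 : ‖c‖ ≤ |(2:ℝ)| + |s.im| := Complex.norm_le_abs_re_add_abs_im c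
      have h3 := norm_add_le c z
      rw [abs_of_pos (by norm_num : (0:ℝ)<2)] at h2
      rw [hR] at hz'; linarith
  have key := Complex.borelCaratheodory (f := fun z => l (c + z)) (M := M) (R := R) (z := s - c) hM0
    (by
      intro z hz
      refine DifferentiableAt.differentiableWithinAt ?_
      have hd : DifferentiableAt ℂ l (c + z) := hl.differentiableAt
        ((isOpen_lt continuous_const Complex.continuous_re).mem_nhds (hin z hz).1)
      exact hd.comp z (differentiableAt_id.const_add c))
    (by
      intro z hz
      obtain ⟨h1, h2⟩ := hin z hz
      simp only [Set.mem_ofPred_eq]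
      have h3 := congrArg norm (hle _ h1)
      rw [Complex.norm_exp] at h3
      have h4 := L_bound hχ h1.le
      have h5 : (l (c+z)).re = Real.log ‖DirichletCharacter.LFunction χ (c+z)‖ := by
        rw [← h3, Real.log_exp]
      rw [h5, hM]
      refine Real.log_le_log (by rw [← h3]; exact Real.exp_pos _) (h4.trans ?_)
      gcongr) hR0
  have hsc : s - c = ((s.re - 2 : ℝ) : ℂ) := by
    apply Complex.ext <;> simp [hc]
  have hnorm : ‖s - c‖ = 2 - s.re := by
    rw [hsc, Complex.norm_real, Real.norm_eq_abs, abs_of_nonpos (by linarith)]; ring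
  have key2 := key (by simp only [Metric.mem_ball, dist_zero_right, hnorm, hR]; linarith)
  simp only [add_sub_cancel, add_zero, hnorm] at key2
  have hlc : ‖l c‖ ≤ 2 := by
    rw [hls c (by simp [hc])]
    exact LS_norm_two χ (by simp [hc])
  have hden : δ / 2 ≤ R - (2 - s.re) := by rw [hR]; linarith
  have hlogq : 1 ≤ Real.log q := by
    have := log_three_ge
    have h2 := Real.log_le_log (by norm_num) hq'
    linarith
  have hn1 : 1 ≤ ‖s + 1‖ := by
    have h := Complex.abs_re_le_norm (s+1)
    have h2 := le_abs_self (s+1).re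
    simp only [Complex.add_re, Complex.one_re] at h h2
    linarith
  have hn2 : |s.im| ≤ ‖s + 1‖ := by
    have h := Complex.abs_im_le_norm (s+1)
    simpa using h
  have hMle : M ≤ Real.log q + 16 + 4 * |s.im| := by
    rw [hM, show 4 * (q:ℝ) * (4 + |s.im|) = q * (16 + 4 * |s.im|) by ring,
      Real.log_mul (by positivity) (by positivity)]
    have := Real.log_le_self (x := 16 + 4 * |s.im|) (by positivity)
    linarith
  have hden0 : 0 < R - (2 - s.re) := by linarith
  have e1 : 2 * M * (2 - s.re) / (R - (2 - s.re)) + ‖l c‖ * (R + (2 - s.re)) / (R - (2 - s.re))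
      ≤ (3 * M + 6) / (δ / 2) := by
    rw [← add_div]
    have h1 : 2 * M * (2 - s.re) ≤ 3 * M := by nlinarith
    have h2 : ‖l c‖ * (R + (2 - s.re)) ≤ 2 * 3 := by
      refine mul_le_mul hlc (by rw [hR]; linarith) (by linarith) (by norm_num)
    refine div_le_div₀ (by linarith) (by linarith) (by linarith) hden
  refine key2.trans (e1.trans ?_)
  rw [div_le_iff₀ (by linarith)]
  have : 138 / δ * Real.log q * ‖s + 1‖ * (δ / 2) = 69 * (Real.log q * ‖s+1‖) := by
    field_simp; norm_num
  rw [this]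
  have i1 : Real.log q ≤ Real.log q * ‖s+1‖ := by nlinarith
  have i2 : ‖s+1‖ ≤ Real.log q * ‖s+1‖ := by nlinarith
  linarith

end Litt

namespace Litt
open Finset ArithmeticFunction

lemma abel (g : ℕ → ℝ) (hg0 : ∀ n, 0 ≤ g n) (hg : ∀ n, 1 ≤ n → g (n+1) ≤ g n) (N : ℕ) :
    ∑ n ∈ Ioc 0 N, vonMangoldt n * g n ≤ 6 * ∑ n ∈ Ioc 0 N, g n := by
  have key : ∀ N : ℕ, ∑ n ∈ Ioc 0 N, (vonMangoldt n - 6) * g n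
      ≤ (∑ n ∈ Ioc 0 N, vonMangoldt n - 6 * N) * g N := by
    intro N
    induction N with
    | zero => simp
    | succ N ih =>
      rw [Finset.sum_Ioc_succ_top (Nat.zero_le _), Finset.sum_Ioc_succ_top (Nat.zero_le _)]
      have h1 := psi_nat N
      rcases Nat.eq_zero_or_pos N with h | h
      · subst h; simp
      · have h2 := hg N h
        push_cast
        nlinarith
  have h := key N
  have h1 := psi_nat N
  have h2 := hg0 N
  have h3 : ∑ n ∈ Ioc 0 N, (vonMangoldt n - 6) * g n =
    ∑ n ∈ Ioc 0 N, vonMangoldt n * g n - 6 * ∑ n ∈ Ioc 0 N, g n := by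
    rw [mul_sum, ← sum_sub_distrib]
    exact sum_congr rfl fun _ _ => by ring
  nlinarith

lemma sum_rpow_le {τ : ℝ} (h0 : 0 < τ) (h1 : τ < 1) (N : ℕ) :
    ∑ n ∈ Ioc 0 N, (n:ℝ) ^ (-τ) ≤ (N:ℝ)^(1-τ) / (1-τ) := by
  have h1' : 0 < 1 - τ := by linarith
  induction N with
  | zero => simp [Real.zero_rpow h1'.ne']
  | succ N ih =>
    rw [Finset.sum_Ioc_succ_top (Nat.zero_le _)]
    have hN : (0:ℝ) < (N:ℝ) + 1 := by positivity
    have hb := rpow_one_add_le_one_add_mul_self (s := -(1/((N:ℝ)+1))) (p := 1-τ)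
      (by rw [neg_le_neg_iff, div_le_one hN]; have : (0:ℝ) ≤ N := by positivity
          linarith) h1'.le (by linarith)
    have e : 1 + -(1/((N:ℝ)+1)) = N / (N+1) := by field_simp; ring
    rw [e, Real.div_rpow (by positivity) hN.le] at hb
    have hp : 0 < ((N:ℝ)+1)^(1-τ) := Real.rpow_pos_of_pos hN _
    rw [div_le_iff₀ hp] at hb
    have e2 : ((N:ℝ)+1)^(-τ) = ((N:ℝ)+1)^(1-τ) / (N+1) := by
      rw [eq_div_iff hN.ne', ← Real.rpow_add_one hN.ne']
      congr 1; ring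
    push_cast
    rw [e2]
    rw [le_div_iff₀ h1'] at ih ⊢
    have e3 : (1 + (1 - τ) * -(1 / ((N:ℝ) + 1))) * (N + 1) ^ (1 - τ) =
      ((N:ℝ)+1)^(1-τ) - ((N:ℝ) + 1) ^ (1 - τ) / (N + 1) * (1 - τ) := by ring
    rw [e3] at hb
    rw [add_mul]
    linarith

lemma sum_left {δ : ℝ} (hδ : 0 < δ) (hδ1 : δ ≤ 1/8) {N : ℕ} (hN : 2 ≤ N) :
    ∑ n ∈ Ioc 0 N, vonMangoldt n / Real.log n * (n:ℝ)^(-(1/2+δ)) ≤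
      432 * (N:ℝ)^(1/2-δ) / Real.log N := by
  have hN1 : (1:ℝ) < N := by exact_mod_cast hN
  have hN0 : (0:ℝ) < N := by linarith
  have hL : 0 < Real.log N := Real.log_pos hN1
  have hterm : ∀ n ∈ Ioc 0 N, vonMangoldt n / Real.log n * (n:ℝ)^(-(1/2+δ)) ≤
      (9 * (N:ℝ)^(1/4:ℝ) / Real.log N) * (vonMangoldt n * (n:ℝ)^(-(3/4+δ))) := by
    intro n hn
    rw [mem_Ioc] at hn
    rcases Nat.lt_or_ge n 2 with h | h
    · have : n = 1 := by omega
      subst this; simp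
    have hn2 : (2:ℝ) ≤ n := by exact_mod_cast h
    have hn0 : (0:ℝ) < n := by linarith
    have hln : 0 < Real.log n := Real.log_pos (by linarith)
    have hln2 : Real.log 2 ≤ Real.log n := Real.log_le_log (by norm_num) hn2
    have hl2 := Real.log_two_gt_d9
    have hnN : (n:ℝ) ≤ N := by exact_mod_cast hn.2
    set y : ℝ := N / n with hy
    have hy1 : 1 ≤ y := by rw [hy, le_div_iff₀ hn0]; linarith
    have hlogN : Real.log N = Real.log n + Real.log y := by
      rw [hy, Real.log_div hN0.ne' hn0.ne']; ring
    have hly := Real.log_le_rpow_div (x := y) (ε := 1/4) (by linarith) (by norm_num)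
    have hyp : 1 ≤ y ^ (1/4:ℝ) := Real.one_le_rpow hy1 (by norm_num)
    have hmain : Real.log N ≤ 9 * y^(1/4:ℝ) * Real.log n := by
      rw [hlogN]
      have : Real.log y ≤ 4 * y^(1/4:ℝ) := by linarith
      nlinarith
    have hy4 : y ^ (1/4:ℝ) * (n:ℝ)^(-(1/2+δ)) = (N:ℝ)^(1/4:ℝ) * (n:ℝ)^(-(3/4+δ)) := by
      rw [hy, Real.div_rpow hN0.le hn0.le, div_mul_eq_mul_div, mul_div_assoc, ← Real.rpow_sub hn0]
      congr 2; ring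
    have hP : 0 < (n:ℝ)^(-(1/2+δ)) := Real.rpow_pos_of_pos hn0 _
    have hinv : 1 / Real.log n ≤ 9 * y^(1/4:ℝ) / Real.log N := by
      rw [div_le_div_iff₀ hln hL]; linarith
    calc vonMangoldt n / Real.log n * (n:ℝ)^(-(1/2+δ))
        = (1 / Real.log n) * (vonMangoldt n * (n:ℝ)^(-(1/2+δ))) := by ring
      _ ≤ (9 * y^(1/4:ℝ) / Real.log N) * (vonMangoldt n * (n:ℝ)^(-(1/2+δ))) := by
          refine mul_le_mul_of_nonneg_right hinv (mul_nonneg vonMangoldt_nonneg hP.le)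
      _ = (9 / Real.log N) * vonMangoldt n * (y^(1/4:ℝ) * (n:ℝ)^(-(1/2+δ))) := by ring
      _ = _ := by rw [hy4]; ring
  have hτ := sum_rpow_le (τ := 3/4+δ) (by linarith) (by linarith) N
  have hab := abel (fun n => (n:ℝ)^(-(3/4+δ))) (fun n => by positivity) (fun n hn => by
    have : (0:ℝ) < n := by exact_mod_cast hn
    push_cast
    exact Real.rpow_le_rpow_of_nonpos this (by linarith) (by linarith)) N
  have h8 : (N:ℝ)^(1-(3/4+δ)) / (1-(3/4+δ)) ≤ 8 * (N:ℝ)^(1-(3/4+δ)) := by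
    rw [div_le_iff₀ (by linarith)]
    have : 0 < (N:ℝ)^(1-(3/4+δ)) := Real.rpow_pos_of_pos hN0 _
    nlinarith
  calc _ ≤ ∑ n ∈ Ioc 0 N, (9 * (N:ℝ)^(1/4:ℝ) / Real.log N) * (vonMangoldt n * (n:ℝ)^(-(3/4+δ))) :=
        sum_le_sum hterm
    _ = (9 * (N:ℝ)^(1/4:ℝ) / Real.log N) * ∑ n ∈ Ioc 0 N, vonMangoldt n * (n:ℝ)^(-(3/4+δ)) := by
        rw [mul_sum]
    _ ≤ (9 * (N:ℝ)^(1/4:ℝ) / Real.log N) * (48 * (N:ℝ)^(1-(3/4+δ))) := by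
        refine mul_le_mul_of_nonneg_left (by linarith) (by positivity)
    _ = 432 * ((N:ℝ)^(1/4:ℝ) * (N:ℝ)^(1-(3/4+δ))) / Real.log N := by ring
    _ = _ := by
        rw [← Real.rpow_add hN0]
        congr 3; ring

/-- partial Dirichlet polynomial -/
noncomputable def DN {q : ℕ} (χ : DirichletCharacter ℂ q) (N : ℕ) (s : ℂ) : ℂ :=
  ∑ n ∈ range (N+1), LSeries.term (ac χ) s n

lemma DN_diff {q : ℕ} (χ : DirichletCharacter ℂ q) (N : ℕ) : Differentiable ℂ (DN χ N) := by
  unfold DN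
  refine Differentiable.fun_sum fun n _ => ?_
  intro s
  exact (LSeries.hasDerivAt_term (ac χ) n s).differentiableAt

lemma DN_left {q : ℕ} (χ : DirichletCharacter ℂ q) {δ : ℝ} (hδ : 0 < δ) (hδ1 : δ ≤ 1/8) {N : ℕ}
    (hN : 2 ≤ N) {s : ℂ} (hs : 1/2 + δ ≤ s.re) :
    ‖DN χ N s‖ ≤ 432 * (N:ℝ)^(1/2-δ) / Real.log N := by
  refine le_trans ?_ (sum_left hδ hδ1 hN)
  unfold DN
  rw [← sum_range_Ioc (fun n : ℕ => vonMangoldt n / Real.log n * (n:ℝ)^(-(1/2+δ))) (by simp)]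
  refine (norm_sum_le _ _).trans (sum_le_sum fun n _ => ?_)
  rw [LSeries.norm_term_eq]
  split_ifs with h
  · subst h; simp
  · have h0 : (0:ℝ) < n := by exact_mod_cast Nat.pos_of_ne_zero h
    have h1 : (1:ℝ) ≤ n := by exact_mod_cast Nat.pos_of_ne_zero h
    rw [div_eq_mul_inv, ← Real.rpow_neg h0.le]
    refine mul_le_mul (ac_norm_le' χ n) ?_ (by positivity) ?_
    · exact Real.rpow_le_rpow_of_exponent_le h1 (by linarith)
    · exact div_nonneg vonMangoldt_nonneg (Real.log_natCast_nonneg n)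

lemma DN_one {q : ℕ} (χ : DirichletCharacter ℂ q) (N : ℕ) : ‖DN χ N 1‖ ≤ Fv N := by
  unfold DN Fv
  refine (norm_sum_le _ _).trans (sum_le_sum fun n _ => ?_)
  rw [LSeries.norm_term_eq]
  split_ifs with h
  · exact av_nonneg n
  · unfold av
    have := ac_norm_le' χ n
    rw [Complex.one_re, Real.rpow_one]
    calc _ ≤ vonMangoldt n / Real.log n / n := div_le_div_of_nonneg_right this (by positivity)
      _ = _ := by rw [div_div, mul_comm]

lemma tail_two (N : ℕ) (hN : 1 ≤ N) : ∑' n : ℕ, 1 / ((n + (N+1) : ℕ) : ℝ)^2 ≤ 1 / (N:ℝ) := by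
  have hs : Summable (fun n : ℕ => 1 / ((n:ℕ) : ℝ)^2) := Real.summable_one_div_nat_pow.2 (by norm_num)
  have hs' := (summable_nat_add_iff (N+1)).2 hs
  refine hs'.tsum_le_of_sum_range_le fun m => ?_
  have : ∀ m : ℕ, ∑ i ∈ range m, 1 / ((i + (N+1) : ℕ) : ℝ)^2 ≤ 1 / (N:ℝ) - 1 / ((N:ℝ) + m) := by
    intro m
    have hN' : (1:ℝ) ≤ N := by exact_mod_cast hN
    induction m with
    | zero => simp
    | succ m ih =>
      rw [sum_range_succ]
      have : 1 / ((m + (N+1) : ℕ) : ℝ)^2 ≤ 1 / ((N:ℝ) + m) - 1 / (N + (m+1:ℕ)) := by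
        push_cast
        have hm : (0:ℝ) < N + m := by positivity
        rw [div_sub_div _ _ (by positivity) (by positivity), div_le_div_iff₀ (by positivity) (by positivity)]
        nlinarith
      linarith
  refine (this m).trans ?_
  have : (0:ℝ) ≤ 1 / (N + m) := by positivity
  linarith

lemma DN_right {q : ℕ} (χ : DirichletCharacter ℂ q) {N : ℕ} (hN : 1 ≤ N) {s : ℂ} (hs : s.re = 2) :
    ‖LSeries (ac χ) s - DN χ N s‖ ≤ 1 / (N:ℝ) := by
  have hsum : Summable (LSeries.term (ac χ) s) := ac_summable χ (by rw [hs]; norm_num)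
  have h := hsum.sum_add_tsum_nat_add (N+1)
  have e : LSeries (ac χ) s - DN χ N s = ∑' n : ℕ, LSeries.term (ac χ) s (n + (N+1)) := by
    unfold LSeries DN
    rw [← h]; ring
  rw [e]
  have hs2 : Summable (fun n : ℕ => 1 / ((n:ℕ) : ℝ)^2) := Real.summable_one_div_nat_pow.2 (by norm_num)
  have hs' := (summable_nat_add_iff (N+1)).2 hs2
  refine (tsum_of_norm_bounded hs'.hasSum fun n => ?_).trans (tail_two N hN)
  rw [LSeries.norm_term_eq]
  rw [if_neg (by omega), hs]
  norm_cast
  exact div_le_div_of_nonneg_right (ac_norm_le χ _) (by positivity)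

end Litt

namespace Litt
open Finset

lemma three_lines {q : ℕ} [NeZero q] {χ : DirichletCharacter ℂ q} (hχ : χ ≠ 1) (hq : 3 ≤ q)
    {l : ℂ → ℂ} (hl : DifferentiableOn ℂ l {s | 1/2 < s.re})
    (hle : ∀ s : ℂ, 1/2 < s.re → Complex.exp (l s) = DirichletCharacter.LFunction χ s)
    (hls : ∀ s : ℂ, 1 < s.re → l s = LSeries (ac χ) s)
    {δ : ℝ} (hδ : 0 < δ) (hδ1 : δ ≤ 1/8) {N : ℕ} (hN : 3 ≤ N) {P : ℝ} (hP : 1 ≤ P)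
    (hA : 138 / δ * Real.log q + 432 * (N:ℝ)^(1/2-δ) / Real.log N
      ≤ P * ((N:ℝ)^(1/2-δ) / Real.log N)) :
    ‖l 1 - DN χ N 1‖ ≤ 2 * P * (Real.log N) ^ (-(1/2) : ℝ) := by
  set A : ℝ := P * ((N:ℝ)^(1/2-δ) / Real.log N) with hAdef
  have hN3 : (3:ℝ) ≤ N := by exact_mod_cast hN
  have hN0 : (0:ℝ) < N := by linarith
  have hlogN : 1 ≤ Real.log N := log_three_ge.trans (Real.log_le_log (by norm_num) hN3)
  have hlogN0 : 0 < Real.log N := by linarith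
  set H : ℂ → ℂ := fun s => (s+1)⁻¹ * (l s - DN χ N s) with hH
  have hn1 : ∀ s : ℂ, 1/2 + δ ≤ s.re → 1 ≤ ‖s + 1‖ := by
    intro s hs
    have h := Complex.abs_re_le_norm (s+1)
    have h2 := le_abs_self (s+1).re
    simp only [Complex.add_re, Complex.one_re] at h h2
    linarith
  have hb1 : ∀ s : ℂ, 1/2 + δ ≤ s.re → s.re ≤ 2 → ‖H s‖ ≤ A := by
    intro s h1 h2
    refine le_trans ?_ hA
    have hn := hn1 s h1
    have hn0 : 0 < ‖s+1‖ := by linarith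
    simp only [hH, norm_mul, norm_inv]
    rw [inv_mul_le_iff₀ hn0]
    have i1 := log_bound hχ hq hl hle hls hδ hδ1 h1 h2
    have i2 := DN_left χ hδ hδ1 (by omega : 2 ≤ N) h1
    have i3 := norm_sub_le (l s) (DN χ N s)
    have i4 : 0 ≤ 432 * (N:ℝ)^(1/2-δ) / Real.log N := by positivity
    nlinarith
  have hb2 : ∀ s : ℂ, s.re = 2 → ‖H s‖ ≤ 1 / N := by
    intro s h2
    have hn := hn1 s (by linarith)
    have hn0 : 0 < ‖s+1‖ := by linarith
    simp only [hH, norm_mul, norm_inv]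
    rw [inv_mul_le_iff₀ hn0, hls s (by linarith)]
    have i := DN_right χ (by omega : 1 ≤ N) h2
    have : (0:ℝ) ≤ 1 / N := by positivity
    nlinarith
  have hdiff : ∀ s : ℂ, 1/2 + δ ≤ s.re → DifferentiableAt ℂ H s := by
    intro s h1
    have hne : s + 1 ≠ 0 := by
      have := hn1 s h1
      intro h; rw [h] at this; simp at this; linarith
    have hd : DifferentiableAt ℂ l s := hl.differentiableAt
        ((isOpen_lt continuous_const Complex.continuous_re).mem_nhds
          (by simp only [Set.mem_ofPred_eq]; linarith))
    exact ((differentiableAt_id.add_const (1:ℂ)).fun_inv hne).mul (hd.sub (DN_diff χ N s))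
  have hcl : closure (Complex.HadamardThreeLines.verticalStrip (1/2+δ) 2) ⊆
      Complex.HadamardThreeLines.verticalClosedStrip (1/2+δ) 2 := by
    refine closure_minimal ?_ ?_
    · exact Set.preimage_mono Set.Ioo_subset_Icc_self
    · exact isClosed_Icc.preimage Complex.continuous_re
  have hdc : DiffContOnCl ℂ H (Complex.HadamardThreeLines.verticalStrip (1/2+δ) 2) := by
    refine DifferentiableOn.diffContOnCl fun s hs => ?_
    exact (hdiff s (hcl hs).1).differentiableWithinAt
  have key := Complex.HadamardThreeLines.norm_le_interp_of_mem_verticalClosedStrip' (f := H) (z := 1)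
    (a := A) (b := 1 / N) (l := 1/2+δ) (u := 2) (by linarith)
    (by
      simp only [Complex.HadamardThreeLines.verticalClosedStrip, Set.mem_preimage, Complex.one_re,
        Set.mem_Icc]
      constructor <;> linarith) hdc
    (by
      refine ⟨A, ?_⟩
      rintro _ ⟨s, hs, rfl⟩
      exact hb1 s hs.1 hs.2)
    (by
      intro s hs
      have hs' : s.re = 1/2+δ := hs
      exact hb1 s hs'.ge (by linarith))
    (by
      intro s hs
      exact hb2 s hs)
  rw [Complex.one_re] at key
  set θ : ℝ := (1 - (1/2+δ)) / (2 - (1/2+δ)) with hθ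
  have hden : 0 < 2 - (1/2+δ) := by linarith
  have hθ0 : 0 ≤ θ := div_nonneg (by linarith) hden.le
  have hθ1 : θ ≤ 1/2 := by rw [hθ, div_le_iff₀ hden]; linarith
  have hθe : (1/2-δ) * (1-θ) = θ := by
    have h : θ * (2 - (1/2+δ)) = 1 - (1/2+δ) := div_mul_cancel₀ _ hden.ne'
    linear_combination -h
  have hX : 0 < (N:ℝ)^(1/2-δ) := Real.rpow_pos_of_pos hN0 _
  have hcalc : A ^ (1-θ) * (1/(N:ℝ))^θ ≤ P * (Real.log N) ^ (-(1/2) : ℝ) := by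
    rw [hAdef, Real.mul_rpow (by linarith) (by positivity), Real.div_rpow hX.le hlogN0.le,
      ← Real.rpow_mul hN0.le, hθe, one_div, Real.inv_rpow hN0.le]
    have hXp : 0 < (N:ℝ)^θ := Real.rpow_pos_of_pos hN0 _
    have e : P ^ (1-θ) * ((N:ℝ)^θ / Real.log N ^ (1-θ)) * ((N:ℝ)^θ)⁻¹ =
        P ^ (1-θ) * (Real.log N) ^ (-(1-θ)) := by
      rw [Real.rpow_neg hlogN0.le]
      field_simp
    rw [e]
    refine mul_le_mul ?_ ?_ (by positivity) (by linarith)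
    · calc P ^ (1-θ) ≤ P ^ (1:ℝ) := Real.rpow_le_rpow_of_exponent_le hP (by linarith)
        _ = P := Real.rpow_one P
    · exact Real.rpow_le_rpow_of_exponent_le hlogN (by linarith)
  have hfin := key.trans hcalc
  simp only [hH, norm_mul, norm_inv] at hfin
  have h2 : ‖(1:ℂ)+1‖ = 2 := by norm_num
  rw [h2, inv_mul_le_iff₀ (by norm_num)] at hfin
  linarith

lemma choose_N {δ : ℝ} (hδ : 0 < δ) (hδ1 : δ ≤ 1/8) {L u : ℝ} {N : ℕ} (hN : 3 ≤ N)
    (hu : Real.exp u < N + 1) (hL : L = Real.exp ((1/2-2*δ)*u)) :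
    138 / δ * L + 432 * (N:ℝ)^(1/2-δ) / Real.log N
      ≤ (276 / δ^2 + 432) * ((N:ℝ)^(1/2-δ) / Real.log N) := by
  have hN3 : (3:ℝ) ≤ N := by exact_mod_cast hN
  have hN0 : (0:ℝ) < N := by linarith
  have hlogN : 1 ≤ Real.log N := log_three_ge.trans (Real.log_le_log (by norm_num) hN3)
  have hlogN0 : 0 < Real.log N := by linarith
  have h1 : L ≤ 2 * (N:ℝ)^(1/2-2*δ) := by
    rw [hL, mul_comm, Real.exp_mul]
    calc Real.exp u ^ (1/2-2*δ) ≤ (2*N:ℝ)^(1/2-2*δ) :=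
          Real.rpow_le_rpow (Real.exp_pos _).le (by linarith) (by linarith)
      _ = 2^(1/2-2*δ) * (N:ℝ)^(1/2-2*δ) := Real.mul_rpow (by norm_num) hN0.le
      _ ≤ 2 * (N:ℝ)^(1/2-2*δ) := by
          gcongr
          calc (2:ℝ)^(1/2-2*δ) ≤ 2^(1:ℝ) :=
                Real.rpow_le_rpow_of_exponent_le (by norm_num) (by linarith)
            _ = 2 := Real.rpow_one 2
  have h2 := Real.log_le_rpow_div (x := (N:ℝ)) hN0.le hδ
  have h3 : L ≤ 2 / δ * ((N:ℝ)^(1/2-δ) / Real.log N) := by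
    rw [mul_div_assoc', le_div_iff₀ hlogN0]
    calc L * Real.log N ≤ (2 * (N:ℝ)^(1/2-2*δ)) * ((N:ℝ)^δ / δ) :=
          mul_le_mul h1 h2 hlogN0.le (by positivity)
      _ = 2 / δ * ((N:ℝ)^(1/2-2*δ) * (N:ℝ)^δ) := by ring
      _ = _ := by rw [← Real.rpow_add hN0]; congr 2; ring
  calc _ ≤ 138 / δ * (2 / δ * ((N:ℝ)^(1/2-δ) / Real.log N)) + 432 * (N:ℝ)^(1/2-δ) / Real.log N := by
        gcongr
    _ = _ := by ring

/-- the comparison function -/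
noncomputable def GG (P u : ℝ) : ℝ :=
  Real.exp ((Fv ⌊Real.exp u⌋₊ - Real.log u) +
    2 * P * (Real.log (⌊Real.exp u⌋₊ : ℕ)) ^ (-(1/2) : ℝ))

lemma GG_tendsto (P : ℝ) :
    Tendsto (GG P) atTop (nhds (Real.exp Real.eulerMascheroniConstant)) := by
  unfold GG
  refine (Real.continuous_exp.tendsto _).comp ?_
  have h1 : Tendsto (fun u : ℝ => (Real.log (⌊Real.exp u⌋₊ : ℕ)) ^ (-(1/2) : ℝ)) atTop (nhds 0) := by
    refine (tendsto_rpow_neg_atTop (by norm_num : (0:ℝ) < 1/2)).comp ?_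
    refine Real.tendsto_log_atTop.comp ?_
    refine tendsto_natCast_atTop_atTop.comp ?_
    exact tendsto_nat_floor_atTop.comp Real.tendsto_exp_atTop
  have h2 := mertens3.add (h1.const_mul (2*P))
  simpa using h2

lemma main_bound {q : ℕ} [NeZero q] {χ : DirichletCharacter ℂ q} (hχ : χ ≠ 1) (hq : 3 ≤ q)
    (hz : ∀ s : ℂ, 1/2 < s.re → DirichletCharacter.LFunction χ s ≠ 0)
    {δ : ℝ} (hδ : 0 < δ) (hδ1 : δ ≤ 1/8) {u : ℝ}
    (hu : u = 2 / (1 - 4 * δ) * Real.log (Real.log q)) (hu3 : 3 ≤ u) :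
    ‖DirichletCharacter.LFunction χ 1‖ ≤ GG (276 / δ^2 + 432) u * u := by
  obtain ⟨l, hl, hle, hls⟩ := exists_log hχ hz
  have hq' : (3:ℝ) ≤ q := by exact_mod_cast hq
  have hlogq : 1 ≤ Real.log q := log_three_ge.trans (Real.log_le_log (by norm_num) hq')
  set N := ⌊Real.exp u⌋₊ with hNdef
  have hN : 3 ≤ N := by
    refine Nat.le_floor ?_
    have := Real.add_one_le_exp u
    push_cast; linarith
  have hL : Real.log q = Real.exp ((1/2-2*δ)*u) := by
    have : (1/2-2*δ)*u = Real.log (Real.log q) := by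
      rw [hu]
      have : 1 - 4*δ ≠ 0 := by linarith
      have e : (1/2-2*δ) * (2 / (1 - 4*δ)) = 1 := by
        rw [mul_div_assoc', div_eq_one_iff_eq this]; ring
      rw [← mul_assoc, e, one_mul]
    rw [this, Real.exp_log (by linarith)]
  have hA := choose_N hδ hδ1 hN (Nat.lt_floor_add_one _) hL
  have hP : 1 ≤ 276 / δ^2 + 432 := by
    have : 0 < 276 / δ^2 := by positivity
    linarith
  have h3 := three_lines hχ hq hl hle hls hδ hδ1 hN hP hA
  have h4 := DN_one χ N
  have h5 : ‖l 1‖ ≤ Fv N + 2 * (276 / δ^2 + 432) * (Real.log N) ^ (-(1/2) : ℝ) := by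
    have := norm_add_le (l 1 - DN χ N 1) (DN χ N 1)
    rw [sub_add_cancel] at this
    linarith
  rw [← hle 1 (by norm_num), Complex.norm_exp]
  have hu0 : 0 < u := by linarith
  have : GG (276 / δ^2 + 432) u * u =
      Real.exp (Fv N + 2 * (276 / δ^2 + 432) * (Real.log N) ^ (-(1/2) : ℝ)) := by
    unfold GG
    rw [← hNdef]
    have e : ∀ a : ℝ, Real.exp a * u = Real.exp (a + Real.log u) := fun a => by
      rw [Real.exp_add, Real.exp_log hu0]
    rw [e]
    congr 1; ring
  rw [this]
  exact Real.exp_le_exp.2 ((Complex.re_le_norm _).trans h5)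

lemma eventually_bound {ε : ℝ} (hε : 0 < ε) : ∀ᶠ q : ℕ in atTop, ∀ (_ : NeZero q)
    (χ : DirichletCharacter ℂ q), χ ≠ 1 →
    (∀ s : ℂ, 1/2 < s.re → DirichletCharacter.LFunction χ s ≠ 0) →
    ‖DirichletCharacter.LFunction χ 1‖ ≤
      (2 * Real.exp Real.eulerMascheroniConstant + ε) * Real.log (Real.log q) := by
  set E := Real.exp Real.eulerMascheroniConstant with hE
  have hc : ContinuousAt (fun δ : ℝ => 2 / (1 - 4 * δ) * E) 0 := by
    refine ContinuousAt.mul (ContinuousAt.div continuousAt_const ?_ (by norm_num)) continuousAt_const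
    fun_prop
  have hc' : ∀ᶠ δ : ℝ in nhds 0, 2 / (1 - 4 * δ) * E < 2 * E + ε :=
    hc.eventually (eventually_lt_nhds (by simp; linarith))
  have hc2 := (eventually_nhdsWithin_of_eventually_nhds (s := Set.Ioi 0)
    (hc'.and (eventually_le_nhds (by norm_num : (0:ℝ) < 1/8)))).and
    (self_mem_nhdsWithin)
  obtain ⟨δ, ⟨hδE, hδ1⟩, hδ⟩ := hc2.exists
  have hδ : 0 < δ := hδ
  have hk : 0 < 2 / (1 - 4 * δ) := div_pos (by norm_num) (by linarith)
  have hG := ((GG_tendsto (276 / δ^2 + 432)).const_mul (2 / (1 - 4 * δ))).eventually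
    (eventually_lt_nhds hδE)
  have hll : Tendsto (fun q : ℕ => Real.log (Real.log q)) atTop atTop :=
    Real.tendsto_log_atTop.comp (Real.tendsto_log_atTop.comp tendsto_natCast_atTop_atTop)
  have hut : Tendsto (fun q : ℕ => 2 / (1 - 4 * δ) * Real.log (Real.log q)) atTop atTop :=
    hll.const_mul_atTop hk
  filter_upwards [hut.eventually hG, hut.eventually_ge_atTop 3, eventually_ge_atTop 3,
    hll.eventually_ge_atTop 0] with q h1 h2 h3 h4 inst χ hχ hz
  have := main_bound hχ h3 hz hδ hδ1 rfl h2
  refine this.trans ?_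
  rw [mul_left_comm, ← mul_assoc]
  exact mul_le_mul_of_nonneg_right h1.le h4

end Litt


namespace Litt

lemma LFun_eq {q : ℕ} [h : NeZero q] (χ : DirichletCharacter ℂ q) (s : ℂ) :
    LFun q χ s = DirichletCharacter.LFunction χ s := by
  unfold LFun
  rw [dif_pos h.ne]

lemma nonvanish (hGRH : GRH) {q : ℕ} [NeZero q] {χ : DirichletCharacter ℂ q} (hχ : χ ≠ 1)
    (s : ℂ) (hs : 1/2 < s.re) : DirichletCharacter.LFunction χ s ≠ 0 := by
  rcases le_or_gt 1 s.re with h | h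
  · exact DirichletCharacter.LFunction_ne_zero_of_one_le_re χ (.inl hχ) h
  · intro h0
    rw [← LFun_eq] at h0
    have := hGRH q (NeZero.ne q) χ s h0 (by linarith) h
    linarith

end Litt

/-- Littlewood: assuming GRH, for any non-principal primitive Dirichlet
character `χ` of modulus `q`, `|L(1, χ)| ≤ (2 e^γ + o(1)) log log q` as `q → ∞`. -/
theorem statement_19 (hGRH : GRH) :
    ∃ f : ℕ → ℝ, Filter.Tendsto f Filter.atTop (nhds 0) ∧
      ∀ q : ℕ, 3 ≤ q → ∀ χ : DirichletCharacter ℂ q, χ ≠ 1 → χ.IsPrimitive →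
        ‖LFun q χ 1‖ ≤
          (2 * Real.exp Real.eulerMascheroniConstant + f q) * Real.log (Real.log q) := by
  obtain hz := fun (q : ℕ) (_ : NeZero q) (χ : DirichletCharacter ℂ q) (hχ : χ ≠ 1) =>
    Litt.nonvanish hGRH hχ
  set E := Real.exp Real.eulerMascheroniConstant with hE
  classical
  set a : (q : ℕ) → DirichletCharacter ℂ q → ℝ := fun q χ =>
    if χ ≠ 1 then max 0 (‖LFun q χ 1‖ / Real.log (Real.log q) - 2 * E) else 0 with ha
  have ha0 : ∀ q χ, 0 ≤ a q χ := by
    intro q χ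
    simp only [ha]
    split_ifs
    · exact le_max_left _ _
    · exact le_rfl
  have hll : ∀ q : ℕ, 3 ≤ q → 0 < Real.log (Real.log q) := by
    intro q hq
    have hq3 : (3:ℝ) ≤ q := by exact_mod_cast hq
    refine Real.log_pos ?_
    rw [Real.lt_log_iff_exp_lt (by linarith)]
    have := Real.exp_one_lt_d9
    linarith
  refine ⟨fun q => ⨆ χ : DirichletCharacter ℂ q, a q χ, ?_, ?_⟩
  · rw [Metric.tendsto_nhds]
    intro ε hε
    filter_upwards [Litt.eventually_bound (half_pos hε), eventually_ge_atTop 3] with q h1 h2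
    have : NeZero q := ⟨by omega⟩
    have hnn : 0 ≤ ⨆ χ : DirichletCharacter ℂ q, a q χ := Real.iSup_nonneg (ha0 q)
    have hle : ⨆ χ : DirichletCharacter ℂ q, a q χ ≤ ε / 2 := by
      refine Real.iSup_le (fun χ => ?_) (half_pos hε).le
      simp only [ha]
      split_ifs with hχ
      · refine max_le (half_pos hε).le ?_
        have h3 := h1 this χ hχ (hz q this χ hχ)
        rw [← Litt.LFun_eq, ← div_le_iff₀ (hll q h2)] at h3
        linarith
      · exact (half_pos hε).le
    rw [Real.dist_eq, sub_zero, abs_of_nonneg hnn]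
    linarith
  · intro q hq χ hχ _
    have : NeZero q := ⟨by omega⟩
    have hb : a q χ ≤ ⨆ χ : DirichletCharacter ℂ q, a q χ :=
      le_ciSup (Set.finite_range (a q)).bddAbove χ
    have h1 : ‖LFun q χ 1‖ / Real.log (Real.log q) - 2 * E ≤ a q χ := by
      simp only [ha]
      rw [if_pos hχ]
      exact le_max_right _ _
    rw [← div_le_iff₀ (hll q hq)]
    linarith
end
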